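/- (Malgrange–Palamodov) The space C^∞ = C^∞(ℝⁿ, ℂ) of smooth complex-valued functions on ℝⁿ, regarded as a module over the polynomial ring A = ℂ[∂₁,…,∂ₙ] acting by partial differentiation, is an injective A-module: for every injective A-module homomorphism ι : M → M' and every A-module homomorphism φ : M → C^∞, there exists an A-module homomorphism ψ : M' → C^∞ with ψ ∘ ι = φ. -/

import Mathlib

noncomputable section

/-- The space of smooth (infinitely differentiable) functions `ℝⁿ → ℂ`,
as a `ℂ`-submodule of the space of all functions `ℝⁿ → ℂ`. -/
def Cinf (n : ℕ) : Submodule ℂ ((Fin n → ℝ) → ℂ) where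
  carrier := {f | ContDiff ℝ (⊤ : ℕ∞) f}
  add_mem' := fun {f g} hf hg => by
    simp only [Set.mem_setOf_eq] at *
    exact hf.add hg
  zero_mem' := by
    simp only [Set.mem_setOf_eq]
    exact contDiff_const
  smul_mem' := fun c f hf => by
    simp only [Set.mem_setOf_eq] at *
    exact hf.const_smul c

noncomputable section MPsec1
namespace MP
open scoped ContDiff
open Complex

/-- complex parameter space -/
abbrev V (n : ℕ) := Fin n → ℂ

/-- real basis directions of `V n` -/
def bv {n : ℕ} (b : Fin n × Bool) : V n := Pi.single b.1 (if b.2 then I else 1)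

/-- directional derivative -/
def D {n : ℕ} (b : Fin n × Bool) (g : V n → ℂ) : V n → ℂ := fun z => fderiv ℝ g z (bv b)

variable {n : ℕ} {ι : Type}

/-- directional derivative of families -/
def DF (b : Fin n × Bool) (F : ι → V n → ℂ) : ι → V n → ℂ := fun k => D b (F k)

/-- iterated derivatives -/
def DL : List (Fin n × Bool) → (ι → V n → ℂ) → (ι → V n → ℂ)
  | [], F => F
  | b :: l, F => DL l (DF b F)

/-- all derivatives exist and are in `Bd` -/
def IsG (Bd : Submodule ℂ (ι → V n → ℂ)) (F : ι → V n → ℂ) : Prop :=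
  ∀ l, (∀ k, Differentiable ℝ (DL l F k)) ∧ DL l F ∈ Bd

lemma IsG.diff {Bd : Submodule ℂ (ι → V n → ℂ)} {F : ι → V n → ℂ} (h : IsG Bd F) (k : ι) :
    Differentiable ℝ (F k) := (h []).1 k

lemma IsG.mem {Bd : Submodule ℂ (ι → V n → ℂ)} {F : ι → V n → ℂ} (h : IsG Bd F) :
    F ∈ Bd := (h []).2

lemma IsG.DF {Bd : Submodule ℂ (ι → V n → ℂ)} {F : ι → V n → ℂ} (h : IsG Bd F)
    (b : Fin n × Bool) : IsG Bd (DF b F) := fun l => h (b :: l)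

lemma D_add {b : Fin n × Bool} {f g : V n → ℂ} (hf : Differentiable ℝ f)
    (hg : Differentiable ℝ g) : D b (f + g) = D b f + D b g := by
  funext z
  simp [D, fderiv_add (hf z) (hg z)]

lemma D_smul {b : Fin n × Bool} {f : V n → ℂ} (c : ℂ) (hf : Differentiable ℝ f) :
    D b (c • f) = c • D b f := by
  funext z
  simp [D, fderiv_const_smul (hf z) c]

lemma D_mul {b : Fin n × Bool} {f g : V n → ℂ} (hf : Differentiable ℝ f)
    (hg : Differentiable ℝ g) : D b (f * g) = D b f * g + f * D b g := by
  funext z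
  simp only [D, fderiv_mul (hf z) (hg z), Pi.add_apply, Pi.mul_apply]
  simp [mul_comm]
  ring

lemma D_zero {b : Fin n × Bool} : D b (0 : V n → ℂ) = 0 := by
  funext z; simp [D]

lemma D_const {b : Fin n × Bool} (c : ℂ) : D b (fun _ : V n => c) = 0 := by
  funext z; simp [D]

lemma DF_add {b : Fin n × Bool} {F G : ι → V n → ℂ} (hF : ∀ k, Differentiable ℝ (F k))
    (hG : ∀ k, Differentiable ℝ (G k)) : DF b (F + G) = DF b F + DF b G := by
  funext k; exact D_add (hF k) (hG k)

lemma DF_smul {b : Fin n × Bool} {F : ι → V n → ℂ} (c : ℂ) (hF : ∀ k, Differentiable ℝ (F k)) :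
    DF b (c • F) = c • DF b F := by
  funext k; exact D_smul c (hF k)

lemma DF_mul {b : Fin n × Bool} {F G : ι → V n → ℂ} (hF : ∀ k, Differentiable ℝ (F k))
    (hG : ∀ k, Differentiable ℝ (G k)) : DF b (F * G) = DF b F * G + F * DF b G := by
  funext k; exact D_mul (hF k) (hG k)

lemma DF_zero {b : Fin n × Bool} : DF b (0 : ι → V n → ℂ) = 0 := by
  funext k; exact D_zero

/-- coinduction principle -/
lemma coind (Bd : Submodule ℂ (ι → V n → ℂ)) (𝒞 : Set (ι → V n → ℂ))
    (hd : ∀ F ∈ 𝒞, ∀ k, Differentiable ℝ (F k)) (hB : ∀ F ∈ 𝒞, F ∈ Bd)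
    (hD : ∀ F ∈ 𝒞, ∀ b, DF b F ∈ Submodule.span ℂ 𝒞) {F : ι → V n → ℂ}
    (hF : F ∈ Submodule.span ℂ 𝒞) : IsG Bd F := by
  have key : ∀ F ∈ Submodule.span ℂ 𝒞, (∀ k, Differentiable ℝ (F k)) ∧ F ∈ Bd ∧
      ∀ b, DF b F ∈ Submodule.span ℂ 𝒞 := by
    intro F hF
    induction hF using Submodule.span_induction with
    | mem F h => exact ⟨hd F h, hB F h, hD F h⟩
    | zero =>
      refine ⟨fun k => ?_, Bd.zero_mem, fun b => ?_⟩
      · exact differentiable_const (0 : ℂ)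
      · rw [DF_zero]; exact Submodule.zero_mem _
    | add F G _ _ h1 h2 =>
      refine ⟨fun k => (h1.1 k).add (h2.1 k), Bd.add_mem h1.2.1 h2.2.1, fun b => ?_⟩
      rw [DF_add h1.1 h2.1]
      exact Submodule.add_mem _ (h1.2.2 b) (h2.2.2 b)
    | smul c F _ h1 =>
      refine ⟨fun k => (h1.1 k).const_smul c, Bd.smul_mem c h1.2.1, fun b => ?_⟩
      rw [DF_smul c h1.1]
      exact Submodule.smul_mem _ c (h1.2.2 b)
  intro l
  induction l generalizing F with
  | nil => exact ⟨(key F hF).1, (key F hF).2.1⟩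
  | cons b l ih => exact ih ((key F hF).2.2 b)

lemma coind' (Bd : Submodule ℂ (ι → V n → ℂ)) (𝒞 : Set (ι → V n → ℂ))
    (hd : ∀ F ∈ 𝒞, ∀ k, Differentiable ℝ (F k)) (hB : ∀ F ∈ 𝒞, F ∈ Bd)
    (hD : ∀ F ∈ 𝒞, ∀ b, DF b F ∈ Submodule.span ℂ 𝒞) {F : ι → V n → ℂ}
    (hF : F ∈ 𝒞) : IsG Bd F := coind Bd 𝒞 hd hB hD (Submodule.subset_span hF)

/-- the submodule of `IsG` families -/
def Gm (Bd : Submodule ℂ (ι → V n → ℂ)) : Submodule ℂ (ι → V n → ℂ) where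
  carrier := {F | IsG Bd F}
  zero_mem' := by
    refine coind' Bd {0} ?_ ?_ ?_ rfl
    · rintro F rfl k; exact differentiable_const (0 : ℂ)
    · rintro F rfl; exact Bd.zero_mem
    · rintro F rfl b; rw [DF_zero]; exact Submodule.zero_mem _
  add_mem' := by
    intro F G hF hG
    refine coind Bd {F | IsG Bd F} (fun F h => h.diff) (fun F h => h.mem)
      (fun F h b => Submodule.subset_span (h.DF b)) ?_
    exact Submodule.add_mem _ (Submodule.subset_span hF) (Submodule.subset_span hG)
  smul_mem' := by
    intro c F hF
    refine coind Bd {F | IsG Bd F} (fun F h => h.diff) (fun F h => h.mem)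
      (fun F h b => Submodule.subset_span (h.DF b)) ?_
    exact Submodule.smul_mem _ c (Submodule.subset_span hF)

lemma mem_Gm {Bd : Submodule ℂ (ι → V n → ℂ)} {F : ι → V n → ℂ} : F ∈ Gm Bd ↔ IsG Bd F := Iff.rfl

lemma IsG.add {Bd : Submodule ℂ (ι → V n → ℂ)} {F G : ι → V n → ℂ} (hF : IsG Bd F)
    (hG : IsG Bd G) : IsG Bd (F + G) := (Gm Bd).add_mem hF hG

lemma IsG.smul {Bd : Submodule ℂ (ι → V n → ℂ)} {F : ι → V n → ℂ} (c : ℂ) (hF : IsG Bd F) :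
    IsG Bd (c • F) := (Gm Bd).smul_mem c hF

lemma IsG.mono {B1 B2 : Submodule ℂ (ι → V n → ℂ)} (h : B1 ≤ B2) {F : ι → V n → ℂ}
    (hF : IsG B1 F) : IsG B2 F := fun l => ⟨(hF l).1, h (hF l).2⟩

/-- product rule -/
lemma IsG.mul {B1 B2 B3 : Submodule ℂ (ι → V n → ℂ)}
    (h : ∀ F ∈ B1, ∀ G ∈ B2, F * G ∈ B3) {F G : ι → V n → ℂ}
    (hF : IsG B1 F) (hG : IsG B2 G) : IsG B3 (F * G) := by
  refine coind' B3 {H | ∃ F G, IsG B1 F ∧ IsG B2 G ∧ H = F * G} ?_ ?_ ?_ ⟨F, G, hF, hG, rfl⟩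
  · rintro _ ⟨F, G, hF, hG, rfl⟩ k
    exact (hF.diff k).mul (hG.diff k)
  · rintro _ ⟨F, G, hF, hG, rfl⟩
    exact h F hF.mem G hG.mem
  · rintro _ ⟨F, G, hF, hG, rfl⟩ b
    rw [DF_mul hF.diff hG.diff]
    exact Submodule.add_mem _ (Submodule.subset_span ⟨_, _, hF.DF b, hG, rfl⟩)
      (Submodule.subset_span ⟨_, _, hF, hG.DF b, rfl⟩)

/-- expansion of a vector in the real basis -/
lemma vec_expand (y : V n) : y = ∑ j, ((y j).re • bv (j, false) + (y j).im • bv (j, true)) := by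
  funext i
  simp only [bv, Finset.sum_apply, Pi.add_apply, Pi.smul_apply, Pi.single_apply]
  rw [Finset.sum_eq_single i]
  · simp [Complex.re_add_im]
  · intro j _ hj; simp [Ne.symm hj]
  · simp

lemma fderiv_expand (g : V n → ℂ) (z y : V n) :
    fderiv ℝ g z y = ∑ j, ((y j).re • D (j, false) g z + (y j).im • D (j, true) g z) := by
  conv_lhs => rw [vec_expand y]
  simp [D, map_sum, map_add, map_smul]

lemma IsG.contDiff {Bd : Submodule ℂ (ι → V n → ℂ)} {F : ι → V n → ℂ} (h : IsG Bd F) (k : ι) :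
    ContDiff ℝ ∞ (F k) := by
  rw [contDiff_infty]
  intro m
  induction m generalizing F with
  | zero => exact contDiff_zero.2 (h.diff k).continuous
  | succ m ih =>
    have : ((m + 1 : ℕ) : WithTop ℕ∞) = (m : WithTop ℕ∞) + 1 := by norm_cast
    rw [this, contDiff_succ_iff_fderiv_apply]
    refine ⟨h.diff k, by simp, fun y => ?_⟩
    simp_rw [fderiv_expand]
    refine ContDiff.sum fun j _ => ContDiff.add ?_ ?_
    · exact (ih (h.DF (j, false))).const_smul (y j).re
    · exact (ih (h.DF (j, true))).const_smul (y j).im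

lemma contDiff_D {g : V n → ℂ} (h : ContDiff ℝ ∞ g) (b : Fin n × Bool) : ContDiff ℝ ∞ (D b g) := by
  have := (contDiff_infty_iff_fderiv.1 h).2
  exact this.clm_apply contDiff_const

lemma D_comm {g : V n → ℂ} (h : ContDiff ℝ ∞ g) (b c : Fin n × Bool) :
    D b (D c g) = D c (D b g) := by
  funext z
  have hd : Differentiable ℝ (fderiv ℝ g) :=
    (contDiff_infty_iff_fderiv.1 h).2.differentiable (by simp)
  have hs : IsSymmSndFDerivAt ℝ g z := by
    apply (h.contDiffAt).isSymmSndFDerivAt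
    rw [minSmoothness_of_isRCLikeNormedField]
    exact WithTop.coe_le_coe.2 le_top
  have e : ∀ (u v : V n), fderiv ℝ (fun w => fderiv ℝ g w u) z v = fderiv ℝ (fderiv ℝ g) z v u := by
    intro u v
    rw [fderiv_clm_apply (hd z) (differentiableAt_const _)]
    simp
  unfold D
  rw [e, e]
  exact hs _ _

lemma DF_congr_support {b : Fin n × Bool} {g : V n → ℂ} {K : Set (V n)} (hK : IsClosed K)
    (h : ∀ z, z ∉ K → g z = 0) : ∀ z, z ∉ K → D b g z = 0 := by
  intro z hz
  have : g =ᶠ[nhds z] 0 := by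
    filter_upwards [hK.isOpen_compl.mem_nhds hz] with w hw using h w hw
  simp [D, this.fderiv_eq]

lemma norm_fderiv_le (g : V n → ℂ) (z : V n) :
    ‖fderiv ℝ g z‖ ≤ ∑ j, (‖D (j, false) g z‖ + ‖D (j, true) g z‖) := by
  refine ContinuousLinearMap.opNorm_le_bound _ (by positivity) fun y => ?_
  rw [fderiv_expand, Finset.sum_mul]
  refine (norm_sum_le _ _).trans (Finset.sum_le_sum fun j _ => ?_)
  refine (norm_add_le _ _).trans ?_
  rw [norm_smul, norm_smul, add_mul]
  have h1 : ‖(y j).re‖ ≤ ‖y‖ := (Complex.abs_re_le_norm _).trans (norm_le_pi_norm y j)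
  have h2 : ‖(y j).im‖ ≤ ‖y‖ := (Complex.abs_im_le_norm _).trans (norm_le_pi_norm y j)
  have := norm_nonneg (D (j, false) g z)
  have := norm_nonneg (D (j, true) g z)
  nlinarith

end MP
end MPsec1

noncomputable section MPsec2
namespace MP
open scoped ContDiff
open Complex
variable {n : ℕ} {ι : Type}

/-- one variable weight -/
def om (w : ℂ) : ℝ := (1 + ‖w‖) * Real.exp |w.im|

lemma one_le_om (w : ℂ) : 1 ≤ om w := by
  unfold om
  have h1 : 1 ≤ 1 + ‖w‖ := by linarith [norm_nonneg w]
  have h2 : 1 ≤ Real.exp |w.im| := Real.one_le_exp (abs_nonneg _)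
  nlinarith

lemma norm_le_om (w : ℂ) : 1 + ‖w‖ ≤ om w := by
  unfold om
  have h1 : 0 ≤ 1 + ‖w‖ := by linarith [norm_nonneg w]
  have h2 : 1 ≤ Real.exp |w.im| := Real.one_le_exp (abs_nonneg _)
  nlinarith

lemma exp_le_om (w : ℂ) : Real.exp |w.im| ≤ om w := by
  unfold om
  have h1 : 1 ≤ 1 + ‖w‖ := by linarith [norm_nonneg w]
  have h2 : 0 ≤ Real.exp |w.im| := (Real.exp_pos _).le
  nlinarith

/-- the weight -/
def OM (S : Finset (Fin n)) (z : V n) : ℝ := ∏ i ∈ S, om (z i)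

lemma one_le_OM (S : Finset (Fin n)) (z : V n) : 1 ≤ OM S z :=
  Finset.one_le_prod (fun i _ => one_le_om (z i))

lemma OM_pos (S : Finset (Fin n)) (z : V n) : 0 < OM S z := lt_of_lt_of_le one_pos (one_le_OM S z)

lemma om_le_OM {S : Finset (Fin n)} {i : Fin n} (hi : i ∈ S) (z : V n) : om (z i) ≤ OM S z := by
  unfold OM
  rw [← Finset.mul_prod_erase S _ hi]
  have h1 := one_le_om (z i)
  have : 1 ≤ ∏ j ∈ S.erase i, om (z j) := Finset.one_le_prod (fun i _ => one_le_om (z i))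
  nlinarith

lemma OM_insert {S : Finset (Fin n)} {i : Fin n} (hi : i ∉ S) (z : V n) :
    OM (insert i S) z = om (z i) * OM S z := Finset.prod_insert hi

/-- rapidly decaying families -/
def BdS (ι : Type) (S : Finset (Fin n)) : Submodule ℂ (ι → V n → ℂ) where
  carrier := {F | ∀ N : ℕ, ∃ C : ℝ, ∀ k z, (∀ i, i ∉ S → |(z i).re| ≤ (N : ℝ)) →
    ‖F k z‖ * OM S z ^ N ≤ C}
  zero_mem' := fun N => ⟨0, by simp⟩
  add_mem' := by
    intro F G hF hG N
    obtain ⟨C, hC⟩ := hF N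
    obtain ⟨C', hC'⟩ := hG N
    refine ⟨C + C', fun k z hz => ?_⟩
    have := hC k z hz
    have := hC' k z hz
    have h3 := norm_add_le (F k z) (G k z)
    have h4 : 0 ≤ OM S z ^ N := (pow_pos (OM_pos S z) N).le
    simp only [Pi.add_apply]
    nlinarith [mul_le_mul_of_nonneg_right h3 h4]
  smul_mem' := by
    intro c F hF N
    obtain ⟨C, hC⟩ := hF N
    refine ⟨‖c‖ * C, fun k z hz => ?_⟩
    simp only [Pi.smul_apply, norm_smul, mul_assoc]
    exact mul_le_mul_of_nonneg_left (hC k z hz) (norm_nonneg _)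

/-- multiplier families -/
def MuB (ι : Type) (S : Finset (Fin n)) : Submodule ℂ (ι → V n → ℂ) where
  carrier := {F | ∀ N : ℕ, ∃ C : ℝ, ∃ m : ℕ, ∀ k z, (∀ i, i ∉ S → |(z i).re| ≤ (N : ℝ)) →
    ‖F k z‖ ≤ C * OM S z ^ m}
  zero_mem' := fun N => ⟨0, 0, by simp⟩
  add_mem' := by
    intro F G hF hG N
    obtain ⟨C, m, hC⟩ := hF N
    obtain ⟨C', m', hC'⟩ := hG N
    refine ⟨|C| + |C'|, m + m', fun k z hz => ?_⟩
    have h1 := hC k z hz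
    have h2 := hC' k z hz
    have h3 := norm_add_le (F k z) (G k z)
    have h4 : OM S z ^ m ≤ OM S z ^ (m + m') := pow_le_pow_right₀ (one_le_OM S z) (by omega)
    have h5 : OM S z ^ m' ≤ OM S z ^ (m + m') := pow_le_pow_right₀ (one_le_OM S z) (by omega)
    have h6 : 0 < OM S z ^ m := pow_pos (OM_pos S z) _
    have h7 : 0 < OM S z ^ m' := pow_pos (OM_pos S z) _
    simp only [Pi.add_apply]
    have h8 : C * OM S z ^ m ≤ |C| * OM S z ^ (m + m') :=
      mul_le_mul (le_abs_self C) h4 h6.le (abs_nonneg _)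
    have h9 : C' * OM S z ^ m' ≤ |C'| * OM S z ^ (m + m') :=
      mul_le_mul (le_abs_self C') h5 h7.le (abs_nonneg _)
    linarith
  smul_mem' := by
    intro c F hF N
    obtain ⟨C, m, hC⟩ := hF N
    refine ⟨‖c‖ * C, m, fun k z hz => ?_⟩
    simp only [Pi.smul_apply, norm_smul, mul_assoc]
    exact mul_le_mul_of_nonneg_left (hC k z hz) (norm_nonneg _)

lemma MuB_mul_BdS {S : Finset (Fin n)} : ∀ F ∈ MuB ι S, ∀ G ∈ BdS ι S, F * G ∈ BdS ι S := by
  intro F hF G hG N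
  obtain ⟨C, m, hC⟩ := hF N
  obtain ⟨C', hC'⟩ := hG (N + m)
  refine ⟨|C| * C', fun k z hz => ?_⟩
  have h1 := hC k z hz
  have h2 := hC' k z (fun i hi => (hz i hi).trans (by push_cast; linarith [m.cast_nonneg (α := ℝ)]))
  simp only [Pi.mul_apply, norm_mul]
  have h6 : 0 < OM S z ^ m := pow_pos (OM_pos S z) _
  have h7 : 0 < OM S z ^ N := pow_pos (OM_pos S z) _
  calc ‖F k z‖ * ‖G k z‖ * OM S z ^ N ≤ (|C| * OM S z ^ m) * ‖G k z‖ * OM S z ^ N := by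
        gcongr
        exact h1.trans (mul_le_mul_of_nonneg_right (le_abs_self C) h6.le)
    _ = |C| * (‖G k z‖ * OM S z ^ (N + m)) := by rw [pow_add]; ring
    _ ≤ |C| * C' := mul_le_mul_of_nonneg_left h2 (abs_nonneg _)

lemma MuB_mul {S : Finset (Fin n)} : ∀ F ∈ MuB ι S, ∀ G ∈ MuB ι S, F * G ∈ MuB ι S := by
  intro F hF G hG N
  obtain ⟨C, m, hC⟩ := hF N
  obtain ⟨C', m', hC'⟩ := hG N
  refine ⟨|C| * |C'|, m + m', fun k z hz => ?_⟩
  have h1 := hC k z hz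
  have h2 := hC' k z hz
  have h6 : 0 < OM S z ^ m := pow_pos (OM_pos S z) _
  have h7 : 0 < OM S z ^ m' := pow_pos (OM_pos S z) _
  simp only [Pi.mul_apply, norm_mul]
  calc ‖F k z‖ * ‖G k z‖ ≤ (|C| * OM S z ^ m) * (|C'| * OM S z ^ m') := by
        gcongr
        · exact h1.trans (mul_le_mul_of_nonneg_right (le_abs_self C) h6.le)
        · exact h2.trans (mul_le_mul_of_nonneg_right (le_abs_self C') h7.le)
    _ = _ := by rw [pow_add]; ring

/-- dependence on imaginary parts only in `S` -/
def Ind (S : Finset (Fin n)) (g : V n → ℂ) : Prop :=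
  ∀ z w : V n, (∀ i ∈ S, z i = w i) → (∀ i, (z i).re = (w i).re) → g z = g w

lemma Ind.D {S : Finset (Fin n)} {g : V n → ℂ} (h : Ind S g) (b : Fin n × Bool) :
    Ind S (D b g) := by
  intro z w h1 h2
  have : g = fun x => g (x + (w - z)) := by
    funext x
    apply h
    · intro i hi; simp [h1 i hi]
    · intro i; simp [h2 i]
  unfold MP.D
  conv_lhs => rw [this]
  rw [fderiv_comp_add_right]
  simp

lemma Ind.D_true {S : Finset (Fin n)} {g : V n → ℂ} (h : Ind S g) {j : Fin n} (hj : j ∉ S) :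
    MP.D (j, true) g = 0 := by
  funext z
  by_cases hd : DifferentiableAt ℝ g z
  · unfold MP.D
    rw [← hd.lineDeriv_eq_fderiv]
    have : (fun t : ℝ => g (z + t • bv (j, true))) = fun _ => g z := by
      funext t
      apply h
      · intro i hi
        have : i ≠ j := fun e => hj (e ▸ hi)
        simp [bv, this]
      · intro i
        by_cases e : i = j
        · subst e; simp [bv]
        · simp [bv, e]
    simp [lineDeriv, this]
  · simp [MP.D, fderiv_zero_of_not_differentiableAt hd]

lemma Ind.mul {S : Finset (Fin n)} {f g : V n → ℂ} (hf : Ind S f) (hg : Ind S g) :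
    Ind S (f * g) := by
  intro z w h1 h2
  simp [hf z w h1 h2, hg z w h1 h2]

/-- The basic spaces -/
def SS (S : Finset (Fin n)) : Submodule ℂ (V n → ℂ) where
  carrier := {g | IsG (BdS Unit S) (fun _ => g) ∧ Ind S g}
  zero_mem' := ⟨(Gm (BdS Unit S)).zero_mem, fun _ _ _ _ => rfl⟩
  add_mem' := fun {f g} hf hg => ⟨hf.1.add hg.1, fun z w h1 h2 => by
    simp [hf.2 z w h1 h2, hg.2 z w h1 h2]⟩
  smul_mem' := fun c g hg => ⟨hg.1.smul c, fun z w h1 h2 => by simp [hg.2 z w h1 h2]⟩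

lemma mem_SS {S : Finset (Fin n)} {g : V n → ℂ} :
    g ∈ SS S ↔ IsG (BdS Unit S) (fun _ => g) ∧ Ind S g := Iff.rfl

lemma SS.contDiff {S : Finset (Fin n)} {g : V n → ℂ} (h : g ∈ SS S) : ContDiff ℝ ∞ g :=
  h.1.contDiff ()

lemma SS.diff {S : Finset (Fin n)} {g : V n → ℂ} (h : g ∈ SS S) : Differentiable ℝ g :=
  h.1.diff ()

lemma SS.bound {S : Finset (Fin n)} {g : V n → ℂ} (h : g ∈ SS S) (N : ℕ) :
    ∃ C : ℝ, ∀ z, (∀ i, i ∉ S → |(z i).re| ≤ (N : ℝ)) → ‖g z‖ * OM S z ^ N ≤ C := by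
  obtain ⟨C, hC⟩ := h.1.mem N
  exact ⟨C, hC ()⟩

lemma SS.D {S : Finset (Fin n)} {g : V n → ℂ} (h : g ∈ SS S) (b : Fin n × Bool) :
    D b g ∈ SS S := ⟨h.1.DF b, h.2.D b⟩

/-- multipliers -/
def Mu (S : Finset (Fin n)) (f : V n → ℂ) : Prop := IsG (MuB Unit S) (fun _ => f) ∧ Ind S f

lemma SS.mul {S : Finset (Fin n)} {f g : V n → ℂ} (hf : Mu S f) (h : g ∈ SS S) :
    f * g ∈ SS S := ⟨hf.1.mul MuB_mul_BdS h.1, hf.2.mul h.2⟩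

lemma Mu.mul {S : Finset (Fin n)} {f g : V n → ℂ} (hf : Mu S f) (h : Mu S g) :
    Mu S (f * g) := ⟨hf.1.mul MuB_mul h.1, hf.2.mul h.2⟩

lemma Mu.add {S : Finset (Fin n)} {f g : V n → ℂ} (hf : Mu S f) (hg : Mu S g) :
    Mu S (f + g) := ⟨hf.1.add hg.1, fun z w h1 h2 => by
    simp [hf.2 z w h1 h2, hg.2 z w h1 h2]⟩

/-- constant families are nice -/
lemma isG_const (Bd : Submodule ℂ (ι → V n → ℂ)) (c : ℂ) (h : (fun _ _ => c) ∈ Bd) :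
    IsG Bd (fun _ _ => c) := by
  refine coind' Bd {fun _ _ => c} ?_ ?_ ?_ rfl
  · rintro F rfl k; exact differentiable_const c
  · rintro F rfl; exact h
  · rintro F rfl b
    have : DF b (fun (_ : ι) (_ : V n) => c) = 0 := by funext k; exact D_const c
    rw [this]; exact Submodule.zero_mem _

lemma const_mem_MuB (S : Finset (Fin n)) (c : ℂ) : (fun _ _ => c) ∈ MuB ι S :=
  fun N => ⟨‖c‖, 0, fun k z _ => by simp⟩

lemma Mu.const (S : Finset (Fin n)) (c : ℂ) : Mu S (fun _ => c) :=
  ⟨isG_const _ c (const_mem_MuB S c), fun _ _ _ _ => rfl⟩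

/-- families whose derivatives are constants -/
lemma isG_of_const_D (Bd : Submodule ℂ (ι → V n → ℂ)) (f : V n → ℂ) (hd : Differentiable ℝ f)
    (hf : (fun _ => f) ∈ Bd) (hc : ∀ c : ℂ, (fun _ _ => c) ∈ Bd)
    (h : ∀ b, ∃ c : ℂ, MP.D b f = fun _ => c) :
    IsG Bd (fun _ => f) := by
  refine coind' Bd ({fun _ => f} ∪ {F | ∃ c : ℂ, F = fun _ _ => c}) ?_ ?_ ?_ (Or.inl rfl)
  · rintro F (rfl | ⟨c, rfl⟩) k
    · exact hd
    · exact differentiable_const c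
  · rintro F (rfl | ⟨c, rfl⟩)
    · exact hf
    · exact hc c
  · rintro F (rfl | ⟨c, rfl⟩) b
    · obtain ⟨c, hc⟩ := h b
      have : DF b (fun _ : ι => f) = fun _ _ => c := by funext k; exact hc
      rw [this]; exact Submodule.subset_span (Or.inr ⟨c, rfl⟩)
    · have : DF b (fun (_ : ι) (_ : V n) => c) = 0 := by funext k; exact D_const c
      rw [this]; exact Submodule.zero_mem _

lemma D_clm (b : Fin n × Bool) (f : V n →L[ℝ] ℂ) : D b (fun z => f z) = fun _ => f (bv b) := by
  funext z
  simp [D]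

/-- coordinate as real linear map -/
def coordL (j : Fin n) : V n →L[ℝ] ℂ := ContinuousLinearMap.proj (R := ℝ) (φ := fun _ : Fin n => ℂ) j

@[simp] lemma coordL_apply (j : Fin n) (z : V n) : coordL j z = z j := rfl

/-- real part of coordinate as real linear map -/
def reL (j : Fin n) : V n →L[ℝ] ℂ := Complex.ofRealCLM.comp (Complex.reCLM.comp (coordL j))

@[simp] lemma reL_apply (j : Fin n) (z : V n) : reL j z = ((z j).re : ℂ) := rfl

lemma D_coord (b : Fin n × Bool) (j : Fin n) : D b (fun z : V n => z j) = fun _ => bv b j :=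
  D_clm b (coordL j)

lemma D_re (b : Fin n × Bool) (j : Fin n) :
    D b (fun z : V n => ((z j).re : ℂ)) = fun _ => ((bv b j).re : ℂ) :=
  D_clm b (reL j)

lemma diff_coord (j : Fin n) : Differentiable ℝ (fun z : V n => z j) := (coordL j).differentiable

lemma Mu.coord {S : Finset (Fin n)} {j : Fin n} (hj : j ∈ S) : Mu S (fun z => z j) := by
  refine ⟨isG_of_const_D _ _ (coordL j).differentiable ?_ (const_mem_MuB S)
    fun b => ⟨_, D_clm b (coordL j)⟩, fun z w h1 _ => h1 j hj⟩
  intro N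
  refine ⟨1, 1, fun k z _ => ?_⟩
  have h1 := norm_le_om (z j)
  have := om_le_OM hj z
  simp; linarith

lemma Mu.re {S : Finset (Fin n)} (j : Fin n) : Mu S (fun z => ((z j).re : ℂ)) := by
  refine ⟨isG_of_const_D _ _ (reL j).differentiable ?_ (const_mem_MuB S)
    fun b => ⟨_, D_clm b (reL j)⟩, fun z w _ h2 => by simp [h2 j]⟩
  intro N
  refine ⟨N + 1, 1, fun k z hz => ?_⟩
  have h0 := one_le_OM S z
  have hN : (0 : ℝ) ≤ N := N.cast_nonneg
  rw [pow_one]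
  rw [Complex.norm_real, Real.norm_eq_abs]
  by_cases hj : j ∈ S
  · have h1 := norm_le_om (z j)
    have h2 := om_le_OM hj z
    have h3 := Complex.abs_re_le_norm (z j)
    nlinarith
  · have := hz j hj
    nlinarith

/-- exponential multipliers -/
lemma Mu.exp {S : Finset (Fin n)} {j : Fin n} (hj : j ∈ S) (x : ℝ) :
    Mu S (fun z => Complex.exp (2 * Real.pi * I * x * z j)) := by
  set f : V n → ℂ := fun z => Complex.exp (2 * Real.pi * I * x * z j) with hf
  have hdf : Differentiable ℝ f := by
    have := diff_coord (n := n) j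
    fun_prop
  refine ⟨coind' _ {fun _ => f} ?_ ?_ ?_ rfl, fun z w h1 _ => by simp [hf, h1 j hj]⟩
  · rintro F rfl k; exact hdf
  · rintro F rfl N
    obtain ⟨m, hm⟩ := exists_nat_ge (2 * Real.pi * |x|)
    refine ⟨1, m, fun k z _ => ?_⟩
    rw [one_mul]
    refine le_trans ?_ (pow_le_pow_left₀ (by linarith [one_le_om (z j)]) (om_le_OM hj z) m)
    refine le_trans ?_ (pow_le_pow_left₀ (Real.exp_pos _).le (exp_le_om (z j)) m)
    rw [← Real.exp_nat_mul, hf, Complex.norm_exp]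
    apply Real.exp_le_exp.2
    have : (2 * Real.pi * I * x * z j).re = (2 * Real.pi) * (- (x * (z j).im)) := by
      simp [mul_re, mul_im]; ring
    rw [this]
    have h2 : -(x * (z j).im) ≤ |x| * |(z j).im| := by
      rw [← abs_mul]; exact neg_le_abs _
    have := Real.pi_pos
    have := abs_nonneg (z j).im
    nlinarith
  · rintro F rfl b
    have : DF b (fun _ : Unit => f) = (2 * Real.pi * I * x * bv b j) • (fun _ : Unit => f) := by
      funext k z
      have h1 : HasFDerivAt f (f z • ((2 * Real.pi * I * x : ℂ) • coordL j)) z := by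
        have : HasFDerivAt (fun z : V n => 2 * Real.pi * I * x * z j)
            ((2 * Real.pi * I * x : ℂ) • coordL j) z :=
          ((coordL j).hasFDerivAt (x := z)).const_mul (2 * Real.pi * I * x : ℂ)
        exact this.cexp
      simp only [DF, D, h1.fderiv]
      simp [smul_eq_mul]; ring
    rw [this]
    exact Submodule.smul_mem _ _ (Submodule.subset_span rfl)

/-- the symbol of `X_j` on the Fourier side -/
def zz (j : Fin n) : V n → ℂ := fun z => 2 * Real.pi * I * z j

lemma Mu.zz {S : Finset (Fin n)} {j : Fin n} (hj : j ∈ S) : Mu S (zz j) :=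
  (Mu.const S (2 * Real.pi * I)).mul (Mu.coord hj)

lemma diff_zz (j : Fin n) : Differentiable ℝ (zz (n := n) j) := by
  have := diff_coord (n := n) j
  unfold zz
  fun_prop

lemma D_zz (b : Fin n × Bool) (j : Fin n) : D b (zz j) = fun _ => 2 * Real.pi * I * bv b j := by
  funext z
  have h : HasFDerivAt (zz j) ((2 * Real.pi * I : ℂ) • coordL j) z :=
    ((coordL j).hasFDerivAt (x := z)).const_mul (2 * Real.pi * I : ℂ)
  simp [D, h.fderiv, smul_eq_mul]

lemma D_zz_mul {g : V n → ℂ} (hg : Differentiable ℝ g) {b : Fin n × Bool} {j : Fin n}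
    (h : b.1 ≠ j) : D b (zz j * g) = zz j * D b g := by
  rw [D_mul (diff_zz j) hg, D_zz]
  funext z
  simp [bv, Ne.symm h]

/-- the Cauchy-Riemann operator (without the factor 1/2) -/
def dbar (i : Fin n) (g : V n → ℂ) : V n → ℂ := D (i, false) g + I • D (i, true) g

lemma SS.dbar {S : Finset (Fin n)} {g : V n → ℂ} (h : g ∈ SS S) (i : Fin n) :
    dbar i g ∈ SS S := (SS S).add_mem (SS.D h _) ((SS S).smul_mem _ (SS.D h _))

lemma dbar_zz_mul {g : V n → ℂ} (hg : Differentiable ℝ g) (i j : Fin n) :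
    dbar i (zz j * g) = zz j * dbar i g := by
  unfold dbar
  rw [D_mul (diff_zz j) hg, D_mul (diff_zz j) hg, D_zz, D_zz]
  funext z
  by_cases h : j = i
  · subst h
    simp [bv]
    linear_combination (2 * Real.pi * g z * I) * I_mul_I
  · simp [bv, h]
    ring

lemma dbar_D {g : V n → ℂ} (hg : ContDiff ℝ ∞ g) (i : Fin n) (b : Fin n × Bool) :
    dbar i (D b g) = D b (dbar i g) := by
  unfold dbar
  rw [D_comm hg _ b, D_comm hg _ b, D_add, D_smul]
  · exact (contDiff_D hg _).differentiable (by simp)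
  · exact (contDiff_D hg _).differentiable (by simp)
  · exact ((contDiff_D hg _).differentiable (by simp)).const_smul I

/-- the operator `X_j` on functions -/
def XO (S : Finset (Fin n)) (j : Fin n) (g : V n → ℂ) : V n → ℂ :=
  if j ∈ S then zz j * g else D (j, false) g

lemma XO_mem {S : Finset (Fin n)} {g : V n → ℂ} (h : g ∈ SS S) (j : Fin n) :
    XO S j g ∈ SS S := by
  unfold XO
  split_ifs with hj
  · exact SS.mul (Mu.zz hj) h
  · exact SS.D h _

lemma XO_comm {S : Finset (Fin n)} {g : V n → ℂ} (h : g ∈ SS S) (j k : Fin n) :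
    XO S j (XO S k g) = XO S k (XO S j g) := by
  unfold XO
  split_ifs with hj hk hk
  · ring
  · rw [D_zz_mul (SS.diff h)]; rintro rfl; exact hk hj
  · rw [D_zz_mul (SS.diff h)]; rintro rfl; exact hj hk
  · exact D_comm (SS.contDiff h) _ _

/-- `X_j` as an endomorphism -/
def Xe (S : Finset (Fin n)) (j : Fin n) : Module.End ℂ (SS S) where
  toFun g := ⟨XO S j g, XO_mem g.2 j⟩
  map_add' f g := by
    apply Subtype.ext
    simp only [XO, Submodule.coe_add]
    split_ifs
    · ring
    · rw [D_add (SS.diff f.2) (SS.diff g.2)]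
  map_smul' c g := by
    apply Subtype.ext
    simp only [XO, Submodule.coe_smul, RingHom.id_apply]
    split_ifs
    · rw [mul_smul_comm]
    · rw [D_smul c (SS.diff g.2)]

/-- dbar as an endomorphism -/
def dbe (S : Finset (Fin n)) (i : Fin n) : Module.End ℂ (SS S) where
  toFun g := ⟨dbar i g, SS.dbar g.2 i⟩
  map_add' f g := by
    apply Subtype.ext
    simp only [dbar, Submodule.coe_add]
    rw [D_add (SS.diff f.2) (SS.diff g.2), D_add (SS.diff f.2) (SS.diff g.2), smul_add]
    abel
  map_smul' c g := by
    apply Subtype.ext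
    simp only [dbar, Submodule.coe_smul, RingHom.id_apply]
    rw [D_smul c (SS.diff g.2), D_smul c (SS.diff g.2), smul_add, smul_comm c I]

lemma Xe_comm (S : Finset (Fin n)) (j k : Fin n) : Xe S j * Xe S k = Xe S k * Xe S j := by
  ext g : 1
  exact Subtype.ext (XO_comm g.2 j k)

lemma dbe_Xe (S : Finset (Fin n)) (i j : Fin n) : dbe S i * Xe S j = Xe S j * dbe S i := by
  ext g : 1
  apply Subtype.ext
  show dbar i (XO S j g) = XO S j (dbar i g)
  unfold XO
  split_ifs
  · exact dbar_zz_mul (SS.diff g.2) i j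
  · exact dbar_D (SS.contDiff g.2) i _

end MP
end MPsec2

noncomputable section MPsec3
namespace MP
open scoped ContDiff
open Complex MeasureTheory
variable {n : ℕ} {ι : Type}

lemma aesm_fderiv {X : Type*} [MeasurableSpace X] {μ : Measure X} {F : X → V n → ℂ} {z : V n}
    (hm : ∀ b, AEStronglyMeasurable (fun x => D b (F x) z) μ) :
    AEStronglyMeasurable (fun x => fderiv ℝ (F x) z) μ := by
  have e : (fun x => fderiv ℝ (F x) z) = fun x => ∑ j : Fin n,
      ((Complex.reCLM.comp (coordL j)).smulRight (D (j, false) (F x) z) +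
        (Complex.imCLM.comp (coordL j)).smulRight (D (j, true) (F x) z)) := by
    funext x
    ext y
    rw [fderiv_expand]
    simp
  rw [e]
  refine Finset.aestronglyMeasurable_fun_sum _ fun j _ => AEStronglyMeasurable.add ?_ ?_
  · exact ((ContinuousLinearMap.smulRightL ℝ (V n) ℂ
      (Complex.reCLM.comp (coordL j))).continuous).comp_aestronglyMeasurable (hm (j, false))
  · exact ((ContinuousLinearMap.smulRightL ℝ (V n) ℂ
      (Complex.imCLM.comp (coordL j))).continuous).comp_aestronglyMeasurable (hm (j, true))

/-- differentiation of kernel operators under the integral sign -/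
lemma kernel_D {X : Type*} [MeasurableSpace X] {μ : Measure X} {α : Type*} (P : α → Prop)
    (Fi : α → X → V n → ℂ) (der : Fin n × Bool → α → α) (hP : ∀ b g, P g → P (der b g))
    (hd : ∀ g, P g → ∀ x, Differentiable ℝ (Fi g x))
    (hD : ∀ g, P g → ∀ b x, D b (Fi g x) = Fi (der b g) x)
    (hm : ∀ g, P g → ∀ z, AEStronglyMeasurable (fun x => Fi g x z) μ)
    (hb : ∀ g, P g → ∀ z₀ : V n, ∃ ε > 0, ∃ bound : X → ℝ, Integrable bound μ ∧
      ∀ x, ∀ z ∈ Metric.ball z₀ ε, ‖Fi g x z‖ ≤ bound x) {g : α} (hg : P g) :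
    Differentiable ℝ (fun z => ∫ x, Fi g x z ∂μ) ∧
      ∀ b, D b (fun z => ∫ x, Fi g x z ∂μ) = fun z => ∫ x, Fi (der b g) x z ∂μ := by
  have hI : ∀ g, P g → ∀ z, Integrable (fun x => Fi g x z) μ := by
    intro g hg z
    obtain ⟨ε, hε, bound, hbi, hbb⟩ := hb g hg z
    exact hbi.mono' (hm g hg z) (Filter.Eventually.of_forall
      fun x => hbb x z (Metric.mem_ball_self hε))
  have key : ∀ z₀, HasFDerivAt (fun z => ∫ x, Fi g x z ∂μ)
      (∫ x, fderiv ℝ (Fi g x) z₀ ∂μ) z₀ ∧ Integrable (fun x => fderiv ℝ (Fi g x) z₀) μ := by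
    intro z₀
    have hB : ∃ ε > 0, ∃ bound : X → ℝ, Integrable bound μ ∧
        ∀ x, ∀ z ∈ Metric.ball z₀ ε, ‖fderiv ℝ (Fi g x) z‖ ≤ bound x := by
      choose ε hε bound hbi hbb using fun b => hb (der b g) (hP b g hg) z₀
      have hfin : (Set.range ε).Finite := Set.finite_range ε
      obtain ⟨δ, hδ, hδ'⟩ : ∃ δ > 0, ∀ b, δ ≤ ε b := by
        by_cases hne : Nonempty (Fin n × Bool)
        · obtain ⟨b0, hb0⟩ := Finite.exists_min ε
          exact ⟨ε b0, hε b0, hb0⟩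
        · exact ⟨1, one_pos, fun b => (hne ⟨b⟩).elim⟩
      refine ⟨δ, hδ, fun x => ∑ j, (bound (j, false) x + bound (j, true) x), ?_, ?_⟩
      · exact integrable_finsetSum _ fun j _ => (hbi _).add (hbi _)
      · intro x z hz
        refine (norm_fderiv_le _ _).trans (Finset.sum_le_sum fun j _ => add_le_add ?_ ?_)
        · rw [hD g hg]; exact hbb _ x z (Metric.ball_subset_ball (hδ' _) hz)
        · rw [hD g hg]; exact hbb _ x z (Metric.ball_subset_ball (hδ' _) hz)
    obtain ⟨ε, hε, bound, hbi, hbb⟩ := hB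
    have hmm : AEStronglyMeasurable (fun x => fderiv ℝ (Fi g x) z₀) μ := by
      apply aesm_fderiv
      intro b
      simp_rw [hD g hg]
      exact hm _ (hP b g hg) z₀
    refine ⟨?_, hbi.mono' hmm (Filter.Eventually.of_forall
      fun x => hbb x z₀ (Metric.mem_ball_self hε))⟩
    refine hasFDerivAt_integral_of_dominated_of_fderiv_le (Metric.ball_mem_nhds z₀ hε)
      (Filter.Eventually.of_forall fun z => hm g hg z) (hI g hg z₀) hmm
      (Filter.Eventually.of_forall fun x z hz => hbb x z hz) hbi
      (Filter.Eventually.of_forall fun x z _ => (hd g hg x z).hasFDerivAt)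
  refine ⟨fun z => (key z).1.differentiableAt, fun b => ?_⟩
  funext z
  unfold D
  rw [(key z).1.fderiv, ContinuousLinearMap.integral_apply (key z).2]
  congr 1
  funext x
  exact congrFun (hD g hg b x) z

/-- kill coordinate `i` -/
def updL (i : Fin n) : V n →L[ℝ] V n :=
  ContinuousLinearMap.pi fun j => if j = i then 0 else coordL j

lemma update_eq (i : Fin n) (z : V n) (ζ : ℂ) :
    Function.update z i ζ = updL i z + Pi.single i ζ := by
  funext j
  by_cases h : j = i
  · subst h; simp [updL]
  · simp [updL, h]

lemma hasFDerivAt_update {g : V n → ℂ} (hg : Differentiable ℝ g) (i : Fin n) (ζ : ℂ) (z : V n) :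
    HasFDerivAt (fun z => g (Function.update z i ζ))
      ((fderiv ℝ g (Function.update z i ζ)).comp (updL i)) z := by
  have h1 : HasFDerivAt (fun z : V n => Function.update z i ζ) (updL i) z := by
    have : (fun z : V n => Function.update z i ζ) = fun z => updL i z + Pi.single i ζ := by
      funext z; exact update_eq i z ζ
    rw [this]
    exact (updL i).hasFDerivAt.add_const _
  exact (hg (Function.update z i ζ)).hasFDerivAt.comp z h1

lemma updL_bv_same (i : Fin n) (c : Bool) : updL i (bv (i, c)) = 0 := by
  funext j
  by_cases h : j = i
  · simp [updL, h]
  · simp [updL, bv, h]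

lemma updL_bv_ne {i : Fin n} {b : Fin n × Bool} (h : b.1 ≠ i) : updL i (bv b) = bv b := by
  funext j
  by_cases h' : j = i
  · subst h'; simp [updL, bv, Ne.symm h]
  · simp [updL, h']

lemma D_update {g : V n → ℂ} (hg : Differentiable ℝ g) (i : Fin n) (ζ : ℂ) (b : Fin n × Bool) :
    D b (fun z => g (Function.update z i ζ)) =
      fun z => if b.1 = i then 0 else D b g (Function.update z i ζ) := by
  funext z
  simp only [D, (hasFDerivAt_update hg i ζ z).fderiv]
  split_ifs with h
  · obtain ⟨j, c⟩ := b
    simp only at h; subst h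
    simp [updL_bv_same]
  · simp [updL_bv_ne h]

lemma exp_re_bound {x : ℝ} {N : ℕ} (hx : |x| ≤ N) (ζ : ℂ) :
    ‖Complex.exp (2 * Real.pi * I * x * ζ)‖ ≤ om ζ ^ (7 * N) := by
  refine le_trans ?_ (pow_le_pow_left₀ (Real.exp_pos _).le (exp_le_om ζ) (7 * N))
  rw [← Real.exp_nat_mul, Complex.norm_exp]
  apply Real.exp_le_exp.2
  have : (2 * Real.pi * I * x * ζ).re = (2 * Real.pi) * (- (x * ζ.im)) := by
    simp [mul_re, mul_im]; ring
  rw [this]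
  have h2 : -(x * ζ.im) ≤ |x| * |ζ.im| := by
    rw [← abs_mul]; exact neg_le_abs _
  have h3 : |x| * |ζ.im| ≤ N * |ζ.im| := mul_le_mul_of_nonneg_right hx (abs_nonneg _)
  have := Real.pi_pos
  have h4 := Real.pi_lt_d2
  have := abs_nonneg ζ.im
  have h5 : (0:ℝ) ≤ N * |ζ.im| := by positivity
  push_cast
  nlinarith

/-- integrand of L -/
def Lint (i : Fin n) (g : V n → ℂ) (ζ : ℂ) (z : V n) : ℂ :=
  Complex.exp (2 * Real.pi * I * (z i).re * ζ) * g (Function.update z i ζ)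

/-- the Fourier-Laplace operator -/
def Lop (i : Fin n) (g : V n → ℂ) (z : V n) : ℂ := ∫ ζ : ℂ, Lint i g ζ z

lemma OM_update {S : Finset (Fin n)} {i : Fin n} (hi : i ∉ S) (z : V n) (ζ : ℂ) :
    OM S (Function.update z i ζ) = OM S z := by
  unfold OM
  refine Finset.prod_congr rfl fun j hj => ?_
  rw [Function.update_of_ne]
  rintro rfl; exact hi hj

lemma Lint_bound {S : Finset (Fin n)} {i : Fin n} (hi : i ∉ S) {g : V n → ℂ}
    (hg : g ∈ SS (insert i S)) (N : ℕ) : ∃ C : ℝ, 0 ≤ C ∧ ∀ ζ z,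
    (∀ j, j ∉ S → |(z j).re| ≤ (N : ℝ)) →
    ‖Lint i g ζ z‖ * OM S z ^ N ≤ C * (1 + ‖ζ‖) ^ (-3 : ℝ) := by
  obtain ⟨C, hC⟩ := SS.bound hg (8 * N + 3)
  refine ⟨|C|, abs_nonneg _, fun ζ z hz => ?_⟩
  have h1 := hC (Function.update z i ζ) (by
    intro j hj
    rw [Finset.mem_insert, not_or] at hj
    rw [Function.update_of_ne hj.1]
    refine (hz j hj.2).trans ?_
    push_cast
    linarith [N.cast_nonneg (α := ℝ)])
  rw [OM_insert hi, OM_update hi, Function.update_self, mul_pow] at h1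
  have h2 := exp_re_bound (hz i hi) ζ
  have o1 := one_le_om ζ
  have O1 := one_le_OM S z
  have h3 : (1 + ‖ζ‖) ^ (-3 : ℝ) = ((1 + ‖ζ‖) ^ 3)⁻¹ := by
    rw [Real.rpow_neg (by positivity)]
    norm_cast
  rw [h3, ← div_eq_mul_inv, le_div_iff₀ (by positivity)]
  unfold Lint
  rw [norm_mul]
  set a := ‖g (Function.update z i ζ)‖
  have ha : 0 ≤ a := norm_nonneg _
  have h4 : (1 + ‖ζ‖) ^ 3 ≤ om ζ ^ 3 := pow_le_pow_left₀ (by positivity) (norm_le_om ζ) 3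
  have O0 := OM_pos S z
  have h5 : OM S z ^ N ≤ OM S z ^ (8 * N + 3) := pow_le_pow_right₀ O1 (by omega)
  have h6 : om ζ ^ (7 * N + 3) ≤ om ζ ^ (8 * N + 3) := pow_le_pow_right₀ o1 (by omega)
  calc _ ≤ om ζ ^ (7 * N) * a * OM S z ^ N * om ζ ^ 3 := by gcongr
    _ = a * (om ζ ^ (7 * N + 3) * OM S z ^ N) := by rw [pow_add]; ring
    _ ≤ a * (om ζ ^ (8 * N + 3) * OM S z ^ (8 * N + 3)) := by gcongr
    _ ≤ C := h1
    _ ≤ |C| := le_abs_self C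

lemma integrable_m3 : Integrable (fun ζ : ℂ => (1 + ‖ζ‖) ^ (-3 : ℝ)) := by
  apply integrable_one_add_norm
  norm_num [Complex.finrank_real_complex]

/-- derivatives of the integrand -/
def Lder (i : Fin n) (b : Fin n × Bool) (g : V n → ℂ) : V n → ℂ :=
  if b.1 = i then (if b.2 then 0 else zz i * g) else D b g

lemma Lder_mem {S : Finset (Fin n)} {i : Fin n} {g : V n → ℂ}
    (hg : g ∈ SS (insert i S)) (b : Fin n × Bool) : Lder i b g ∈ SS (insert i S) := by
  unfold Lder
  split_ifs
  · exact Submodule.zero_mem _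
  · exact SS.mul (Mu.zz (Finset.mem_insert_self _ _)) hg
  · exact SS.D hg b

lemma continuous_update_right (z : V n) (i : Fin n) :
    Continuous (fun ζ : ℂ => Function.update z i ζ) := continuous_const.update i continuous_id

lemma diff_expre (i : Fin n) (ζ : ℂ) :
    Differentiable ℝ (fun z : V n => Complex.exp (2 * Real.pi * I * (z i).re * ζ)) := by
  have : Differentiable ℝ (fun z : V n => ((z i).re : ℂ)) := (reL i).differentiable
  fun_prop

lemma D_expre (i : Fin n) (ζ : ℂ) (b : Fin n × Bool) :
    D b (fun z : V n => Complex.exp (2 * Real.pi * I * (z i).re * ζ)) =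
    fun z => 2 * Real.pi * I * (bv b i).re * ζ * Complex.exp (2 * Real.pi * I * (z i).re * ζ) := by
  funext z
  have h1 : HasFDerivAt (fun z : V n => 2 * Real.pi * I * (z i).re * ζ)
      (((2 * Real.pi * I * ζ : ℂ)) • reL i) z := by
    have e : (fun z : V n => 2 * Real.pi * I * (z i).re * ζ) =
        fun z => (2 * Real.pi * I * ζ : ℂ) * reL i z := by
      funext w
      simp; ring
    rw [e]
    exact ((reL i).hasFDerivAt (x := z)).const_mul (2 * Real.pi * I * ζ : ℂ)
  have h2 := h1.cexp
  simp only [D, h2.fderiv]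
  simp [smul_eq_mul]; ring

lemma Lint_diff {i : Fin n} {g : V n → ℂ} (hg : Differentiable ℝ g) (ζ : ℂ) :
    Differentiable ℝ (Lint i g ζ) :=
  (diff_expre i ζ).mul (fun z => (hasFDerivAt_update hg i ζ z).differentiableAt)

lemma D_Lint {i : Fin n} {g : V n → ℂ} (hg : Differentiable ℝ g) (b : Fin n × Bool) (ζ : ℂ) :
    D b (Lint i g ζ) = Lint i (Lder i b g) ζ := by
  have e : Lint i g ζ = (fun z : V n => Complex.exp (2 * Real.pi * I * (z i).re * ζ)) *
    (fun z => g (Function.update z i ζ)) := rfl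
  rw [e, D_mul (diff_expre i ζ) (fun z => (hasFDerivAt_update hg i ζ z).differentiableAt),
    D_expre, D_update hg]
  funext z
  obtain ⟨j, c⟩ := b
  by_cases h : j = i
  · subst h
    cases c
    · simp [Lint, Lder, bv, zz]; ring
    · simp [Lint, Lder, bv]
  · simp [Lint, Lder, h, bv, Ne.symm h]

lemma Lint_cont {i : Fin n} {g : V n → ℂ} (hg : Continuous g) (z : V n) :
    Continuous (fun ζ => Lint i g ζ z) := by
  unfold Lint
  have := hg.comp (continuous_update_right z i)
  have h2 : Continuous (fun ζ : ℂ => Complex.exp (2 * Real.pi * I * (z i).re * ζ)) := by fun_prop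
  exact h2.mul this

lemma exists_nat_ball (z₀ : V n) : ∃ N : ℕ, ∀ z ∈ Metric.ball z₀ 1, ∀ j, |(z j).re| ≤ (N : ℝ) := by
  obtain ⟨N, hN⟩ := exists_nat_ge (‖z₀‖ + 1)
  refine ⟨N, fun z hz j => ?_⟩
  have h1 : ‖z‖ ≤ ‖z₀‖ + ‖z - z₀‖ := by
    have := norm_add_le z₀ (z - z₀); simpa using this
  rw [Metric.mem_ball, dist_eq_norm] at hz
  have := (Complex.abs_re_le_norm (z j)).trans (norm_le_pi_norm z j)
  linarith

lemma Lop_D {S : Finset (Fin n)} {i : Fin n} (hi : i ∉ S) {g : V n → ℂ}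
    (hg : g ∈ SS (insert i S)) : Differentiable ℝ (Lop i g) ∧
      ∀ b, D b (Lop i g) = Lop i (Lder i b g) := by
  refine kernel_D (μ := volume) (fun g => g ∈ SS (insert i S)) (Lint i) (Lder i)
    (fun b g hg => Lder_mem hg b) (fun g hg ζ => Lint_diff (SS.diff hg) ζ)
    (fun g hg b ζ => D_Lint (SS.diff hg) b ζ)
    (fun g hg z => (Lint_cont (SS.diff hg).continuous z).aestronglyMeasurable) ?_ hg
  intro g hg z₀
  obtain ⟨N, hN⟩ := exists_nat_ball z₀
  obtain ⟨C, hC, hb⟩ := Lint_bound hi hg N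
  refine ⟨1, one_pos, _, integrable_m3.const_mul C, fun ζ z hz => ?_⟩
  refine le_trans ?_ (hb ζ z fun j _ => hN z hz j)
  exact le_mul_of_one_le_right (norm_nonneg _) (one_le_pow₀ (one_le_OM S z))

lemma Lint_integrable {S : Finset (Fin n)} {i : Fin n} (hi : i ∉ S) {g : V n → ℂ}
    (hg : g ∈ SS (insert i S)) (z : V n) : Integrable (fun ζ => Lint i g ζ z) := by
  obtain ⟨N, hN⟩ := exists_nat_ball z
  obtain ⟨C, hC, hb⟩ := Lint_bound hi hg N
  refine (integrable_m3.const_mul C).mono'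
    (Lint_cont (SS.diff hg).continuous z).aestronglyMeasurable
    (Filter.Eventually.of_forall fun ζ => ?_)
  refine le_trans ?_ (hb ζ z fun j _ => hN z (Metric.mem_ball_self one_pos) j)
  exact le_mul_of_one_le_right (norm_nonneg _) (one_le_pow₀ (one_le_OM S z))

lemma Lop_mem {S : Finset (Fin n)} {i : Fin n} (hi : i ∉ S) {g : V n → ℂ}
    (hg : g ∈ SS (insert i S)) : Lop i g ∈ SS S := by
  refine ⟨coind' _ {F | ∃ g ∈ SS (insert i S), F = fun _ => Lop i g} ?_ ?_ ?_ ⟨g, hg, rfl⟩, ?_⟩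
  · rintro F ⟨g, hg, rfl⟩ k; exact (Lop_D hi hg).1
  · rintro F ⟨g, hg, rfl⟩ N
    obtain ⟨C, hC, hb⟩ := Lint_bound hi hg N
    refine ⟨∫ ζ : ℂ, C * (1 + ‖ζ‖) ^ (-3 : ℝ), fun _ z hz => ?_⟩
    have hO : 0 < OM S z ^ N := pow_pos (OM_pos S z) N
    rw [← le_div_iff₀ hO, ← integral_div]
    refine norm_integral_le_of_norm_le ((integrable_m3.const_mul C).div_const _)
      (Filter.Eventually.of_forall fun ζ => ?_)
    rw [le_div_iff₀ hO]
    exact hb ζ z hz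
  · rintro F ⟨g, hg, rfl⟩ b
    refine Submodule.subset_span ⟨Lder i b g, Lder_mem hg b, ?_⟩
    funext k
    exact (Lop_D hi hg).2 b
  · intro z w h1 h2
    unfold Lop Lint
    congr 1
    funext ζ
    rw [h2 i, hg.2 (Function.update z i ζ) (Function.update w i ζ)]
    · intro j hj
      by_cases h : j = i
      · subst h; simp
      · simp [h, h1 j ((Finset.mem_insert.1 hj).resolve_left h)]
    · intro j
      by_cases h : j = i
      · subst h; simp
      · simp [h, h2 j]

/-- bundled L -/
def Le (S : Finset (Fin n)) (i : Fin n) (hi : i ∉ S) : SS (insert i S) →ₗ[ℂ] SS S where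
  toFun g := ⟨Lop i g, Lop_mem hi g.2⟩
  map_add' f g := by
    apply Subtype.ext
    funext z
    simp only [Submodule.coe_add, Pi.add_apply, Lop]
    rw [← integral_add (Lint_integrable hi f.2 z) (Lint_integrable hi g.2 z)]
    congr 1; funext ζ
    simp [Lint, mul_add]
  map_smul' c g := by
    apply Subtype.ext
    funext z
    simp only [Submodule.coe_smul, Pi.smul_apply, Lop, RingHom.id_apply]
    rw [smul_eq_mul, ← integral_const_mul]
    congr 1; funext ζ
    simp [Lint]; ring

lemma Le_Xe (S : Finset (Fin n)) (i : Fin n) (hi : i ∉ S) (j : Fin n) (g : SS (insert i S)) :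
    Le S i hi (Xe (insert i S) j g) = Xe S j (Le S i hi g) := by
  apply Subtype.ext
  show Lop i (XO (insert i S) j g) = XO S j (Lop i g)
  unfold XO
  by_cases h : j = i
  · subst h
    rw [if_pos (Finset.mem_insert_self _ _), if_neg hi, (Lop_D hi g.2).2]
    simp [Lder]
  · by_cases hj : j ∈ S
    · rw [if_pos (Finset.mem_insert_of_mem hj), if_pos hj]
      funext z
      simp only [Lop, Pi.mul_apply]
      rw [← integral_const_mul]
      congr 1; funext ζ
      simp [Lint, zz, h]; ring
    · rw [if_neg (by simp [h, hj]), if_neg hj, (Lop_D hi g.2).2]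
      simp [Lder, h]

lemma hasFDerivAt_upd {g : V n → ℂ} (hg : Differentiable ℝ g) (z : V n) (i : Fin n) (ζ : ℂ) :
    HasFDerivAt (fun ζ : ℂ => g (Function.update z i ζ))
      ((fderiv ℝ g (Function.update z i ζ)).comp
        (ContinuousLinearMap.single ℝ (fun _ : Fin n => ℂ) i)) ζ := by
  have h1 : HasFDerivAt (fun ζ : ℂ => Function.update z i ζ)
      (ContinuousLinearMap.single ℝ (fun _ : Fin n => ℂ) i) ζ := by
    have e : (fun ζ : ℂ => Function.update z i ζ) = fun ζ => updL i z +
        ContinuousLinearMap.single ℝ (fun _ : Fin n => ℂ) i ζ := by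
      funext ζ; rw [update_eq]; rfl
    rw [e]
    exact (ContinuousLinearMap.hasFDerivAt _).const_add _
  exact (hg (Function.update z i ζ)).hasFDerivAt.comp ζ h1

lemma fderiv_upd {g : V n → ℂ} (hg : Differentiable ℝ g) (z : V n) (i : Fin n) (ζ : ℂ) (c : Bool) :
    fderiv ℝ (fun ζ : ℂ => g (Function.update z i ζ)) ζ (if c then I else 1) =
      D (i, c) g (Function.update z i ζ) := by
  rw [(hasFDerivAt_upd hg z i ζ).fderiv]
  simp [D, bv]

lemma fderiv_cexp (x : ℝ) (ζ v : ℂ) :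
    fderiv ℝ (fun ζ : ℂ => Complex.exp (2 * Real.pi * I * x * ζ)) ζ v =
      2 * Real.pi * I * x * v * Complex.exp (2 * Real.pi * I * x * ζ) := by
  have h1 : HasFDerivAt (fun ζ : ℂ => 2 * Real.pi * I * x * ζ)
      ((2 * Real.pi * I * x : ℂ) • ContinuousLinearMap.id ℝ ℂ) ζ :=
    (hasFDerivAt_id (𝕜 := ℝ) ζ).const_mul (2 * Real.pi * I * x : ℂ)
  rw [h1.cexp.fderiv]
  simp; ring

lemma Lop_Di {S : Finset (Fin n)} {i : Fin n} (hi : i ∉ S) {g : V n → ℂ}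
    (hg : g ∈ SS (insert i S)) (z : V n) : ∀ c : Bool, Lop i (D (i, c) g) z =
      - (2 * Real.pi * I * (z i).re * (if c then I else 1)) * Lop i g z := by
  unfold Lop
  intro c
  have := integral_mul_fderiv_eq_neg_fderiv_mul_of_integrable (μ := (volume : Measure ℂ))
    (f := fun ζ : ℂ => Complex.exp (2 * Real.pi * I * (z i).re * ζ))
    (g := fun ζ : ℂ => g (Function.update z i ζ)) (v := if c then I else 1) ?_ ?_ ?_ ?_ ?_
  · simp_rw [fderiv_upd (SS.diff hg), fderiv_cexp] at this
    unfold Lint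
    rw [this, neg_mul, ← integral_const_mul]
    congr 2
    funext ζ
    ring
  · simp_rw [fderiv_cexp]
    convert (Lint_integrable hi hg z).const_mul
      (2 * Real.pi * I * (z i).re * (if c then I else 1)) using 1
    funext ζ; simp [Lint]; ring
  · simp_rw [fderiv_upd (SS.diff hg)]
    exact Lint_integrable hi (SS.D hg (i, c)) z
  · exact Lint_integrable hi hg z
  · intro ζ _
    have : Differentiable ℝ (fun ζ : ℂ => Complex.exp (2 * Real.pi * I * (z i).re * ζ)) := by
      fun_prop
    exact this ζ
  · intro ζ _
    exact (hasFDerivAt_upd (SS.diff hg) z i ζ).differentiableAt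

lemma Lop_dbar {S : Finset (Fin n)} {i : Fin n} (hi : i ∉ S) {g : V n → ℂ}
    (hg : g ∈ SS (insert i S)) : Lop i (dbar i g) = 0 := by
  funext z
  have key := Lop_Di hi hg z
  unfold Lop at key
  have h1 := key false
  have h2 := key true
  have e : Lop i (dbar i g) z = (∫ ζ, Lint i (D (i, false) g) ζ z) +
      I * ∫ ζ, Lint i (D (i, true) g) ζ z := by
    unfold Lop
    rw [← integral_const_mul, ← integral_add (Lint_integrable hi (SS.D hg _) z)
      ((Lint_integrable hi (SS.D hg _) z).const_mul I)]
    congr 1; funext ζ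
    simp [Lint, dbar]; ring
  rw [e, h1, h2]
  simp
  linear_combination (-(2 * Real.pi * I * (z i).re) * ∫ ζ, Lint i g ζ z) * I_mul_I

end MP
end MPsec3

noncomputable section MPsec4
namespace MP
open scoped ContDiff
open Complex MeasureTheory
variable {n : ℕ} {ι : Type}

lemma integrableOn_m3 : IntegrableOn (fun r : ℝ => (1 + r) ^ (-3 : ℝ)) (Set.Ioi 0) := by
  have h : Integrable (fun r : ℝ => (1 + ‖r‖) ^ (-3 : ℝ)) := by
    apply integrable_one_add_norm; norm_num
  refine h.integrableOn.congr_fun (fun r hr => ?_) measurableSet_Ioi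
  simp [abs_of_pos (Set.mem_Ioi.1 hr)]

lemma integrable_cauchy : Integrable (fun ζ : ℂ => ‖ζ‖⁻¹ * (1 + ‖ζ‖) ^ (-3 : ℝ)) := by
  have := (integrable_fun_norm_addHaar (volume : Measure ℂ)
    (f := fun r : ℝ => r⁻¹ * (1 + r) ^ (-3 : ℝ))).2
  apply this
  refine integrableOn_m3.congr_fun (fun r hr => ?_) measurableSet_Ioi
  have hr' : r ≠ 0 := (Set.mem_Ioi.1 hr).ne'
  simp [Complex.finrank_real_complex]
  field_simp

/-- Cauchy's formula (Pompeiu) for rapidly decaying functions -/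
lemma cauchy_pompeiu {h : ℂ → ℂ} (hh : ContDiff ℝ 1 h) {C : ℝ}
    (h0 : ∀ ζ, ‖h ζ‖ ≤ C * (1 + ‖ζ‖) ^ (-3 : ℝ))
    (h1 : ∀ ζ, ‖fderiv ℝ h ζ‖ ≤ C * (1 + ‖ζ‖) ^ (-3 : ℝ)) :
    ∫ ζ : ℂ, ζ⁻¹ * (fderiv ℝ h ζ 1 + I * fderiv ℝ h ζ I) = -(2 * Real.pi) * h 0 := by
  set e : ℝ → ℂ := fun θ => Complex.exp (θ * I) with he
  have hec : Continuous e := by fun_prop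
  have hen : ∀ θ, ‖e θ‖ = 1 := fun θ => Complex.norm_exp_ofReal_mul_I θ
  have hdc : Continuous (fderiv ℝ h) := hh.continuous_fderiv (by norm_num)
  set U : ℝ × ℝ → ℂ := fun p => fderiv ℝ h (p.1 * e p.2) (e p.2) with hU
  set W : ℝ × ℝ → ℂ := fun p => fderiv ℝ h (p.1 * e p.2) (I * e p.2) with hW
  have hUc : Continuous U := by
    refine Continuous.clm_apply (hdc.comp ?_) ?_ <;> fun_prop
  have hWc : Continuous W := by
    refine Continuous.clm_apply (hdc.comp ?_) ?_ <;> fun_prop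
  have hb : ∀ p : ℝ × ℝ, 0 < p.1 → ∀ v : ℂ, ‖v‖ = 1 → ‖fderiv ℝ h (p.1 * e p.2) v‖ ≤
      C * (1 + p.1) ^ (-3 : ℝ) := by
    intro p hp v hv
    have := (fderiv ℝ h (p.1 * e p.2)).le_opNorm v
    rw [hv, mul_one] at this
    refine this.trans ((h1 _).trans_eq ?_)
    rw [norm_mul, hen, mul_one, Complex.norm_real, Real.norm_of_nonneg hp.le]
  set μ : Measure ℝ := volume.restrict (Set.Ioi 0) with hμ
  set ν : Measure ℝ := volume.restrict (Set.Ioo (-Real.pi) Real.pi) with hν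
  have hbi : Integrable (fun p : ℝ × ℝ => C * (1 + p.1) ^ (-3 : ℝ)) (μ.prod ν) := by
    have h1 : Integrable (fun r : ℝ => C * (1 + r) ^ (-3 : ℝ)) μ := integrableOn_m3.const_mul C
    have h2 : Integrable (fun _ : ℝ => (1 : ℝ)) ν := by
      apply integrable_const_iff.2; right
      constructor
      simp [hν]
    have := h1.mul_prod h2
    simpa using this
  have hpos : ∀ᵐ p ∂(μ.prod ν), 0 < p.1 := by
    rw [hμ, hν, Measure.prod_restrict]
    filter_upwards [ae_restrict_mem (measurableSet_Ioi.prod measurableSet_Ioo)] with p hp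
    exact hp.1
  have hUi : Integrable U (μ.prod ν) := by
    refine hbi.mono' hUc.aestronglyMeasurable ?_
    filter_upwards [hpos] with p hp
    exact hb p hp _ (hen _)
  have hWi : Integrable W (μ.prod ν) := by
    refine hbi.mono' hWc.aestronglyMeasurable ?_
    filter_upwards [hpos] with p hp
    exact hb p hp _ (by simp [hen])
  have eU : ∫ p, U p ∂(μ.prod ν) = -(2 * Real.pi) * h 0 := by
    rw [integral_prod_symm _ hUi]
    have : ∀ θ : ℝ, ∫ r, U (r, θ) ∂μ = - h 0 := by
      intro θ
      have hd : ∀ r : ℝ, HasDerivAt (fun r : ℝ => h (r * e θ)) (U (r, θ)) r := by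
        intro r
        have a1 : HasDerivAt (fun r : ℝ => (r : ℂ) * e θ) (e θ) r := by
          simpa using (Complex.ofRealCLM.hasDerivAt (x := r)).mul_const (e θ)
        exact ((hh.differentiable (by norm_num)) _).hasFDerivAt.comp_hasDerivAt r a1
      have := integral_Ioi_of_hasDerivAt_of_tendsto (a := 0) (m := 0)
        (f := fun r : ℝ => h (r * e θ)) (f' := fun r => U (r, θ)) ?_ (fun r _ => hd r) ?_ ?_
      · rw [hμ, this]; simp
      · exact (hd 0).continuousAt.continuousWithinAt
      · refine (integrableOn_m3.const_mul C).mono' ?_ ?_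
        · exact (hUc.comp (by fun_prop : Continuous fun r : ℝ => (r, θ))).aestronglyMeasurable
        · filter_upwards [ae_restrict_mem measurableSet_Ioi] with r hr
          exact hb (r, θ) hr _ (hen _)
      · have hz : Filter.Tendsto (fun r : ℝ => C * (1 + r) ^ (-3 : ℝ)) Filter.atTop (nhds 0) := by
          have := (tendsto_rpow_neg_atTop (y := 3) (by norm_num)).comp
            (Filter.tendsto_atTop_add_const_left Filter.atTop (1 : ℝ) Filter.tendsto_id)
          simpa using this.const_mul C
        refine squeeze_zero_norm' ?_ hz
        filter_upwards [Filter.eventually_gt_atTop 0] with r hr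
        refine (h0 _).trans_eq ?_
        rw [norm_mul, hen, mul_one, Complex.norm_real, Real.norm_of_nonneg hr.le]
    simp_rw [this]
    simp only [hν, integral_const, measureReal_restrict_apply_univ, Real.volume_real_Ioo]
    rw [max_eq_left (by linarith [Real.pi_pos]), Complex.real_smul]
    push_cast
    ring
  have eW : ∫ p, W p ∂(μ.prod ν) = 0 := by
    rw [integral_prod _ hWi]
    have : ∀ᵐ r ∂μ, ∫ θ, W (r, θ) ∂ν = 0 := by
      filter_upwards [ae_restrict_mem measurableSet_Ioi] with r hr
      have hr0 : (r : ℂ) ≠ 0 := by exact_mod_cast (Set.mem_Ioi.1 hr).ne'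
      have hd : ∀ θ : ℝ, HasDerivAt (fun θ : ℝ => h (r * e θ)) (r * W (r, θ)) θ := by
        intro θ
        have a1 : HasDerivAt (fun θ : ℝ => (r : ℂ) * e θ) (r * (I * e θ)) θ := by
          have a2 : HasDerivAt (fun θ : ℝ => (θ : ℂ) * I) I θ := by
            simpa using (Complex.ofRealCLM.hasDerivAt (x := θ)).mul_const I
          have a3 := a2.cexp.const_mul (r : ℂ)
          refine a3.congr_deriv ?_
          simp only [he]; ring
        have a4 := ((hh.differentiable (by norm_num)) _).hasFDerivAt.comp_hasDerivAt θ a1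
        refine a4.congr_deriv ?_
        have : (r : ℂ) * (I * e θ) = r • (I * e θ) := by simp
        rw [this, map_smul]; simp [hW]
      have hi := intervalIntegral.integral_eq_sub_of_hasDerivAt (a := -Real.pi) (b := Real.pi)
        (f := fun θ : ℝ => h (r * e θ)) (f' := fun θ => r * W (r, θ)) (fun θ _ => hd θ)
        (Continuous.intervalIntegrable (continuous_const.mul
          (hWc.comp (by fun_prop : Continuous fun θ : ℝ => (r, θ)))) _ _)
      have ee : e Real.pi = e (-Real.pi) := by
        simp [he, Complex.exp_neg]
      rw [ee, sub_self, intervalIntegral.integral_const_mul] at hi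
      have hi2 := (mul_eq_zero.1 hi).resolve_left hr0
      rw [intervalIntegral.integral_of_le (by linarith [Real.pi_pos]),
        integral_Ioc_eq_integral_Ioo] at hi2
      exact hi2
    rw [integral_congr_ae this]; simp
  rw [← Complex.integral_comp_polarCoord_symm]
  have : ∫ p in polarCoord.target, p.1 • ((Complex.polarCoord.symm p)⁻¹ *
      (fderiv ℝ h (Complex.polarCoord.symm p) 1 + I * fderiv ℝ h (Complex.polarCoord.symm p) I)) =
      ∫ p, (U p + I * W p) ∂(μ.prod ν) := by
    rw [hμ, hν, Measure.prod_restrict]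
    have ht : polarCoord.target = Set.Ioi (0 : ℝ) ×ˢ Set.Ioo (-Real.pi) Real.pi := rfl
    rw [ht]
    refine setIntegral_congr_fun (measurableSet_Ioi.prod measurableSet_Ioo) fun p hp => ?_
    have hp0 : (p.1 : ℂ) ≠ 0 := by exact_mod_cast (Set.mem_Ioi.1 hp.1).ne'
    have es : Complex.polarCoord.symm p = p.1 * e p.2 := by
      rw [Complex.polarCoord_symm_apply, he]
      simp only
      rw [Complex.exp_mul_I]; push_cast; rfl
    have ev : ∀ (A : ℂ →L[ℝ] ℂ) (v : ℂ), A v = v.re * A 1 + v.im * A I := by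
      intro A v
      conv_lhs => rw [← Complex.re_add_im v]
      have : (v.re : ℂ) + v.im * I = v.re • (1 : ℂ) + v.im • I := by simp
      rw [this, map_add, map_smul, map_smul]; simp
    simp only [es, hU, hW]
    generalize fderiv ℝ h (p.1 * e p.2) = A
    rw [ev A (e p.2), ev A (I * e p.2)]
    have e1 : (e p.2)⁻¹ = Real.cos p.2 - Real.sin p.2 * I := by
      simp only [he]
      rw [← Complex.exp_neg, ← neg_mul, Complex.exp_mul_I]
      simp [sub_eq_add_neg]
    have e2 : (e p.2).re = Real.cos p.2 := Complex.exp_ofReal_mul_I_re _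
    have e3 : (e p.2).im = Real.sin p.2 := Complex.exp_ofReal_mul_I_im _
    have e4 : (p.1 : ℂ) * (p.1 * e p.2)⁻¹ = (e p.2)⁻¹ := by
      rw [mul_inv, ← mul_assoc, mul_inv_cancel₀ hp0, one_mul]
    rw [Complex.real_smul, ← mul_assoc, e4, e1]
    simp only [mul_re, mul_im, I_re, I_im, e2, e3]
    push_cast
    linear_combination (- Complex.sin p.2 * A I) * I_mul_I
  rw [this, integral_add hUi (hWi.const_mul I), integral_const_mul, eU, eW]
  simp

end MP
end MPsec4

noncomputable section MPsec5
namespace MP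
open scoped ContDiff
open Complex MeasureTheory
variable {n : ℕ} {ι : Type}

/-- integrand of the Cauchy transform -/
def Tint (i : Fin n) (g : V n → ℂ) (ζ : ℂ) (z : V n) : ℂ := ζ⁻¹ * g (z + Pi.single i ζ)

/-- Cauchy transform -/
def Top (i : Fin n) (g : V n → ℂ) (z : V n) : ℂ := ∫ ζ : ℂ, Tint i g ζ z

lemma add_single_eq_update (z : V n) (i : Fin n) (ζ : ℂ) :
    z + Pi.single i ζ = Function.update z i (z i + ζ) := by
  funext j
  by_cases h : j = i
  · subst h; simp
  · simp [h]

lemma shift_m3 (w ζ : ℂ) :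
    (1 + ‖w + ζ‖) ^ (-3 : ℝ) ≤ (1 + ‖w‖) ^ 3 * (1 + ‖ζ‖) ^ (-3 : ℝ) := by
  have e : ∀ a : ℝ, 0 < a → a ^ (-3 : ℝ) = (a ^ 3)⁻¹ := by
    intro a ha
    rw [Real.rpow_neg ha.le]; norm_cast
  have h1 := norm_nonneg w
  have h2 := norm_nonneg ζ
  have h3 := norm_nonneg (w + ζ)
  rw [e _ (by positivity), e _ (by positivity), ← div_eq_mul_inv, inv_eq_one_div,
    div_le_div_iff₀ (by positivity) (by positivity), one_mul, ← mul_pow]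
  apply pow_le_pow_left₀ (by positivity)
  have : ‖ζ‖ ≤ ‖w + ζ‖ + ‖w‖ := by
    have := norm_sub_le (w + ζ) w; simpa using this
  nlinarith

lemma g_bound {S : Finset (Fin n)} {i : Fin n} (hi : i ∉ S) {g : V n → ℂ}
    (hg : g ∈ SS (insert i S)) (M : ℕ) : ∃ C : ℝ, 0 ≤ C ∧ ∀ ζ z,
    (∀ j, j ∉ insert i S → |(z j).re| ≤ (M : ℝ)) →
    ‖g (z + Pi.single i ζ)‖ * OM S z ^ M ≤ C * (1 + ‖z i‖) ^ 3 * (1 + ‖ζ‖) ^ (-3 : ℝ) := by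
  obtain ⟨C, hC⟩ := SS.bound hg (M + 3)
  refine ⟨|C|, abs_nonneg _, fun ζ z hz => ?_⟩
  have h1 := hC (z + Pi.single i ζ) (by
    intro j hj
    have hj' := hj
    rw [Finset.mem_insert, not_or] at hj
    simp only [Pi.add_apply, Pi.single_apply, hj.1, if_false, add_zero]
    refine (hz j hj').trans ?_
    push_cast
    linarith)
  rw [add_single_eq_update] at h1 ⊢
  rw [OM_insert hi, OM_update hi, Function.update_self, mul_pow] at h1
  have o1 := one_le_om (z i + ζ)
  have O1 := one_le_OM S z
  have O0 := OM_pos S z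
  rw [mul_assoc]
  refine le_trans ?_ (mul_le_mul_of_nonneg_left (shift_m3 (z i) ζ) (abs_nonneg C))
  have h3 : (1 + ‖z i + ζ‖) ^ (-3 : ℝ) = ((1 + ‖z i + ζ‖) ^ 3)⁻¹ := by
    rw [Real.rpow_neg (by positivity)]
    norm_cast
  rw [h3, ← div_eq_mul_inv, le_div_iff₀ (by positivity)]
  set a := ‖g (Function.update z i (z i + ζ))‖
  have ha : 0 ≤ a := norm_nonneg _
  have h4 : (1 + ‖z i + ζ‖) ^ 3 ≤ om (z i + ζ) ^ (M + 3) :=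
    (pow_le_pow_left₀ (by positivity) (norm_le_om _) 3).trans (pow_le_pow_right₀ o1 (by omega))
  have h5 : OM S z ^ M ≤ OM S z ^ (M + 3) := pow_le_pow_right₀ O1 (by omega)
  calc _ ≤ a * OM S z ^ (M + 3) * om (z i + ζ) ^ (M + 3) := by gcongr
    _ = a * (om (z i + ζ) ^ (M + 3) * OM S z ^ (M + 3)) := by ring
    _ ≤ C := h1
    _ ≤ |C| := le_abs_self C

lemma Tint_bound {S : Finset (Fin n)} {i : Fin n} (hi : i ∉ S) {g : V n → ℂ}
    (hg : g ∈ SS (insert i S)) (M : ℕ) : ∃ C : ℝ, 0 ≤ C ∧ ∀ ζ z,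
    (∀ j, j ∉ insert i S → |(z j).re| ≤ (M : ℝ)) →
    ‖Tint i g ζ z‖ * OM S z ^ M ≤ C * (1 + ‖z i‖) ^ 3 * (‖ζ‖⁻¹ * (1 + ‖ζ‖) ^ (-3 : ℝ)) := by
  obtain ⟨C, hC, h⟩ := g_bound hi hg M
  refine ⟨C, hC, fun ζ z hz => ?_⟩
  have := h ζ z hz
  unfold Tint
  rw [norm_mul, norm_inv]
  calc _ = ‖ζ‖⁻¹ * (‖g (z + Pi.single i ζ)‖ * OM S z ^ M) := by ring
    _ ≤ ‖ζ‖⁻¹ * (C * (1 + ‖z i‖) ^ 3 * (1 + ‖ζ‖) ^ (-3 : ℝ)) := by gcongr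
    _ = _ := by ring

lemma continuous_single_shift (z : V n) (i : Fin n) :
    Continuous (fun ζ : ℂ => z + Pi.single i ζ) := by
  simp_rw [add_single_eq_update]
  exact continuous_const.update i (continuous_const.add continuous_id)

lemma Tint_aesm {i : Fin n} {g : V n → ℂ} (hg : Continuous g) (z : V n) :
    AEStronglyMeasurable (fun ζ => Tint i g ζ z) := by
  unfold Tint
  exact (measurable_inv.aestronglyMeasurable).mul
    (hg.comp (continuous_single_shift z i)).aestronglyMeasurable

lemma Tint_diff {i : Fin n} {g : V n → ℂ} (hg : Differentiable ℝ g) (ζ : ℂ) :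
    Differentiable ℝ (Tint i g ζ) := by
  unfold Tint
  exact (hg.comp (differentiable_id.add_const _)).const_mul _

lemma D_Tint {i : Fin n} {g : V n → ℂ} (hg : Differentiable ℝ g) (b : Fin n × Bool) (ζ : ℂ) :
    D b (Tint i g ζ) = Tint i (D b g) ζ := by
  have e : Tint i g ζ = ζ⁻¹ • (fun z => g (z + Pi.single i ζ)) := rfl
  have hd : Differentiable ℝ (fun z : V n => g (z + Pi.single i ζ)) := by
    have h1 : Differentiable ℝ (fun z : V n => z + (Pi.single i ζ : V n)) :=
      differentiable_id.add_const _
    exact hg.comp h1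
  rw [e, D_smul _ hd]
  funext z
  simp [Tint, D, fderiv_comp_add_right]

lemma Tint_loc {S : Finset (Fin n)} {i : Fin n} (hi : i ∉ S) {g : V n → ℂ}
    (hg : g ∈ SS (insert i S)) (z₀ : V n) : ∃ ε > 0, ∃ bound : ℂ → ℝ, Integrable bound ∧
      ∀ ζ, ∀ z ∈ Metric.ball z₀ ε, ‖Tint i g ζ z‖ ≤ bound ζ := by
  obtain ⟨N, hN⟩ := exists_nat_ball z₀
  obtain ⟨C, hC, hb⟩ := Tint_bound hi hg N
  refine ⟨1, one_pos, _, integrable_cauchy.const_mul (C * (1 + (‖z₀‖ + 1)) ^ 3), fun ζ z hz => ?_⟩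
  have h1 : ‖Tint i g ζ z‖ ≤ ‖Tint i g ζ z‖ * OM S z ^ N :=
    le_mul_of_one_le_right (norm_nonneg _) (one_le_pow₀ (one_le_OM S z))
  refine h1.trans ((hb ζ z fun j _ => hN z hz j).trans ?_)
  have h2 : ‖z i‖ ≤ ‖z₀‖ + 1 := by
    rw [Metric.mem_ball, dist_eq_norm] at hz
    have h1 : ‖z‖ ≤ ‖z₀‖ + ‖z - z₀‖ := by
      have := norm_add_le z₀ (z - z₀); simpa using this
    have := norm_le_pi_norm z i
    linarith
  gcongr

lemma Tint_integrable {S : Finset (Fin n)} {i : Fin n} (hi : i ∉ S) {g : V n → ℂ}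
    (hg : g ∈ SS (insert i S)) (z : V n) : Integrable (fun ζ => Tint i g ζ z) := by
  obtain ⟨ε, hε, bd, hbd, h⟩ := Tint_loc hi hg z
  exact hbd.mono' (Tint_aesm (SS.diff hg).continuous z)
    (Filter.Eventually.of_forall fun ζ => h ζ z (Metric.mem_ball_self hε))

lemma Top_D {S : Finset (Fin n)} {i : Fin n} (hi : i ∉ S) {g : V n → ℂ}
    (hg : g ∈ SS (insert i S)) : Differentiable ℝ (Top i g) ∧
      ∀ b, D b (Top i g) = Top i (D b g) := by
  refine kernel_D (μ := volume) (fun g => g ∈ SS (insert i S)) (Tint i) D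
    (fun b g hg => SS.D hg b) (fun g hg ζ => Tint_diff (SS.diff hg) ζ)
    (fun g hg b ζ => D_Tint (SS.diff hg) b ζ)
    (fun g hg z => Tint_aesm (SS.diff hg).continuous z) (fun g hg z₀ => Tint_loc hi hg z₀) hg

/-- kernel of L -/
def KL (S : Finset (Fin n)) (i : Fin n) (g : V n → ℂ) : Prop := g ∈ SS (insert i S) ∧ Lop i g = 0

lemma KL.D {S : Finset (Fin n)} {i : Fin n} (hi : i ∉ S) {g : V n → ℂ} (h : KL S i g)
    (b : Fin n × Bool) : KL S i (D b g) := by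
  refine ⟨SS.D h.1 b, ?_⟩
  obtain ⟨j, c⟩ := b
  by_cases hj : j = i
  · subst hj
    funext z
    rw [Lop_Di hi h.1 z c, h.2]; simp
  · have := (Lop_D hi h.1).2 (j, c)
    rw [h.2, D_zero] at this
    simpa [Lder, hj] using this.symm

lemma KL.coord {S : Finset (Fin n)} {i : Fin n} (hi : i ∉ S) {g : V n → ℂ} (h : KL S i g) :
    KL S i ((fun z => z i) * g) := by
  refine ⟨SS.mul (Mu.coord (Finset.mem_insert_self i S)) h.1, ?_⟩
  have := (Lop_D hi h.1).2 (i, false)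
  rw [h.2, D_zero] at this
  have e : (fun z => z i) * g = (2 * Real.pi * I : ℂ)⁻¹ • (zz i * g) := by
    funext z
    have : (2 * Real.pi * I : ℂ) ≠ 0 := by simp [Real.pi_ne_zero]
    simp only [zz, Pi.mul_apply, Pi.smul_apply, smul_eq_mul]
    field_simp
  have e2 : Lop i (zz i * g) = 0 := by simpa [Lder] using this.symm
  have hz : zz i * g ∈ SS (insert i S) := SS.mul (Mu.zz (Finset.mem_insert_self i S)) h.1
  have := (Le S i hi).map_smul (2 * Real.pi * I : ℂ)⁻¹ ⟨zz i * g, hz⟩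
  have := congrArg Subtype.val this
  simp only [Le, LinearMap.coe_mk, AddHom.coe_mk, Submodule.coe_smul, e2, smul_zero] at this
  rw [e]; exact this

lemma Lop_exp (i : Fin n) (g : V n → ℂ) (x : ℝ) (z : V n) :
    Lop i ((fun z => Complex.exp (2 * Real.pi * I * x * z i)) * g) z =
      Lop i g (Function.update z i (z i + x)) := by
  unfold Lop Lint
  congr 1
  funext ζ
  simp only [Pi.mul_apply, Function.update_self, Function.update_idem]
  rw [← mul_assoc, ← Complex.exp_add]
  congr 2
  simp; ring

lemma KL.exp {S : Finset (Fin n)} {i : Fin n} {g : V n → ℂ} (h : KL S i g) (x : ℝ) :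
    KL S i ((fun z => Complex.exp (2 * Real.pi * I * x * z i)) * g) := by
  refine ⟨SS.mul (Mu.exp (Finset.mem_insert_self i S) x) h.1, ?_⟩
  funext z
  rw [Lop_exp, h.2]; rfl

lemma ae_ne_zero : ∀ᵐ ζ : ℂ, ζ ≠ 0 := by
  have : (volume : Measure ℂ) {0} = 0 := by simp
  filter_upwards [compl_mem_ae_iff.2 this] with ζ h using h

lemma integral_shift_exp {S : Finset (Fin n)} {i : Fin n} {g : V n → ℂ} (h : KL S i g) (x : ℝ)
    (z : V n) : ∫ ζ : ℂ, Complex.exp (2 * Real.pi * I * x * ζ) * g (z + Pi.single i ζ) = 0 := by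
  have h1 : Lop i g (Function.update z i x) = 0 := by rw [h.2]; rfl
  unfold Lop at h1
  rw [← integral_add_left_eq_self _ (z i)] at h1
  have : (fun ζ : ℂ => Complex.exp (2 * Real.pi * I * x * ζ) * g (z + Pi.single i ζ)) =
      fun ζ => Complex.exp (-(2 * Real.pi * I * x * z i)) *
        Lint i g (z i + ζ) (Function.update z i x) := by
    funext ζ
    rw [add_single_eq_update]
    simp only [Lint, Function.update_self, Function.update_idem, Complex.ofReal_re]
    rw [← mul_assoc, ← Complex.exp_add]
    congr 2; ring
  rw [this, integral_const_mul, h1, mul_zero]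

lemma Top_coord {S : Finset (Fin n)} {i : Fin n} (hi : i ∉ S) {g : V n → ℂ} (h : KL S i g)
    (z : V n) : Top i ((fun z => z i) * g) z = z i * Top i g z := by
  have h0 := integral_shift_exp h 0 z
  simp only [Complex.ofReal_zero, mul_zero, zero_mul, Complex.exp_zero, one_mul] at h0
  have hgi : Integrable (fun ζ : ℂ => g (z + Pi.single i ζ)) := by
    obtain ⟨N, hN⟩ := exists_nat_ball z
    obtain ⟨C, hC, hb⟩ := g_bound hi h.1 N
    refine (integrable_m3.const_mul (C * (1 + ‖z i‖) ^ 3)).mono'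
      ((SS.diff h.1).continuous.comp (continuous_single_shift z i)).aestronglyMeasurable
      (Filter.Eventually.of_forall fun ζ => ?_)
    refine le_trans ?_ (hb ζ z fun j _ => hN z (Metric.mem_ball_self one_pos) j)
    exact le_mul_of_one_le_right (norm_nonneg _) (one_le_pow₀ (one_le_OM S z))
  unfold Top
  have : ∫ ζ : ℂ, Tint i ((fun z => z i) * g) ζ z =
      ∫ ζ : ℂ, (z i * Tint i g ζ z + g (z + Pi.single i ζ)) := by
    apply integral_congr_ae
    filter_upwards [ae_ne_zero] with ζ hζ
    simp only [Tint, Pi.mul_apply, Pi.add_apply, Pi.single_eq_same]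
    field_simp
  rw [this, integral_add ((Tint_integrable hi h.1 z).const_mul _) hgi, h0, integral_const_mul,
    add_zero]

lemma Top_exp {S : Finset (Fin n)} {i : Fin n} (hi : i ∉ S) {g : V n → ℂ} (h : KL S i g)
    (x : ℝ) (z : V n) : Top i ((fun z => Complex.exp (2 * Real.pi * I * x * z i)) * g) z =
      Complex.exp (2 * Real.pi * I * x * z i) * Top i g z := by
  set Φ : ℝ → ℂ := fun x => ∫ ζ : ℂ, Complex.exp (2 * Real.pi * I * x * ζ) * Tint i g ζ z with hΦ
  have e1 : ∀ x : ℝ, ∀ ζ : ℂ, Complex.exp (2 * Real.pi * I * x * ζ) * Tint i g ζ z =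
      Complex.exp (2 * Real.pi * I * (-x : ℝ) * z i) *
      Tint i ((fun z => Complex.exp (2 * Real.pi * I * x * z i)) * g) ζ z := by
    intro x ζ
    simp only [Tint, Pi.mul_apply, Pi.add_apply, Pi.single_eq_same]
    have : Complex.exp (2 * Real.pi * I * x * ζ) = Complex.exp (2 * Real.pi * I * (-x : ℝ) * z i) *
      Complex.exp (2 * Real.pi * I * x * (z i + ζ)) := by
      rw [← Complex.exp_add]; congr 1; push_cast; ring
    rw [this]; ring
  have hder : ∀ x₀, HasDerivAt Φ 0 x₀ := by
    intro x₀
    obtain ⟨N, hN⟩ := exists_nat_ball z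
    obtain ⟨M, hM⟩ := exists_nat_ge (N + |x₀| + 1)
    obtain ⟨C, hC, hb⟩ := Lint_bound hi h.1 M
    have hI : Integrable (fun ζ : ℂ => Complex.exp (2 * Real.pi * I * x₀ * ζ) * Tint i g ζ z) := by
      simp_rw [e1 x₀]
      exact (Tint_integrable hi (h.exp x₀).1 z).const_mul _
    have key := hasDerivAt_integral_of_dominated_loc_of_deriv_le (μ := (volume : Measure ℂ))
      (F := fun (x : ℝ) (ζ : ℂ) => Complex.exp (2 * Real.pi * I * x * ζ) * Tint i g ζ z)
      (F' := fun (x : ℝ) (ζ : ℂ) =>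
        (2 * Real.pi * I * ζ) * Complex.exp (2 * Real.pi * I * x * ζ) * Tint i g ζ z)
      (x₀ := x₀) (s := Metric.ball x₀ 1)
      (bound := fun ζ => (2 * Real.pi * om (z i) ^ (7 * M) * (C * (1 + ‖z i‖) ^ 3)) *
        (1 + ‖ζ‖) ^ (-3 : ℝ))
      (Metric.ball_mem_nhds x₀ one_pos) ?_ hI ?_ ?_ ?_ ?_
    · have h2 := key.2
      refine h2.congr_deriv ?_
      have : ∫ ζ : ℂ, (2 * Real.pi * I * ζ) * Complex.exp (2 * Real.pi * I * x₀ * ζ) *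
          Tint i g ζ z = ∫ ζ : ℂ, (2 * Real.pi * I) *
          (Complex.exp (2 * Real.pi * I * x₀ * ζ) * g (z + Pi.single i ζ)) := by
        apply integral_congr_ae
        filter_upwards [ae_ne_zero] with ζ hζ
        simp only [Tint]
        field_simp
      rw [this, integral_const_mul, integral_shift_exp h x₀ z, mul_zero]
    · refine Filter.Eventually.of_forall fun x => ?_
      exact (by fun_prop : Continuous fun ζ : ℂ =>
        Complex.exp (2 * Real.pi * I * x * ζ)).aestronglyMeasurable.mul
        (Tint_aesm (SS.diff h.1).continuous z)
    · exact (by fun_prop : Continuous fun ζ : ℂ => (2 * Real.pi * I * ζ) *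
        Complex.exp (2 * Real.pi * I * x₀ * ζ)).aestronglyMeasurable.mul
        (Tint_aesm (SS.diff h.1).continuous z)
    · refine Filter.Eventually.of_forall fun ζ x hx => ?_
      have hxM : |x| ≤ M := by
        rw [Metric.mem_ball, dist_eq_norm, Real.norm_eq_abs] at hx
        have := abs_add_le x₀ (x - x₀)
        rw [add_sub_cancel] at this
        have : (0:ℝ) ≤ N := N.cast_nonneg
        linarith
      have hl := hb (z i + ζ) (Function.update z i x) (by
        intro j hj
        by_cases hji : j = i
        · subst hji; simpa using hxM
        · rw [Function.update_of_ne hji]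
          have := hN z (Metric.mem_ball_self one_pos) j
          have := abs_nonneg x₀
          linarith)
      have hl2 : ‖Lint i g (z i + ζ) (Function.update z i x)‖ ≤
          C * (1 + ‖z i + ζ‖) ^ (-3 : ℝ) :=
        le_trans (le_mul_of_one_le_right (norm_nonneg _) (one_le_pow₀ (one_le_OM S _))) hl
      have hl3 : ‖Lint i g (z i + ζ) (Function.update z i x)‖ ≤
          C * ((1 + ‖z i‖) ^ 3 * (1 + ‖ζ‖) ^ (-3 : ℝ)) :=
        hl2.trans (mul_le_mul_of_nonneg_left (shift_m3 _ _) hC)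
      have hx2 := exp_re_bound (x := -x) (N := M) (by rwa [abs_neg]) (z i)
      have o0 : 0 < om (z i) := lt_of_lt_of_le one_pos (one_le_om _)
      by_cases hζ : ζ = 0
      · subst hζ
        simp only [mul_zero, zero_mul, norm_zero]
        positivity
      · have : (2 * Real.pi * I * ζ) * Complex.exp (2 * Real.pi * I * x * ζ) * Tint i g ζ z =
          (2 * Real.pi * I) * (Complex.exp (2 * Real.pi * I * (-x : ℝ) * z i) *
            Lint i g (z i + ζ) (Function.update z i x)) := by
          have e3 : Complex.exp (2 * Real.pi * I * x * ζ) =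
            Complex.exp (2 * Real.pi * I * (-x : ℝ) * z i) *
            Complex.exp (2 * Real.pi * I * x * (z i + ζ)) := by
            rw [← Complex.exp_add]; congr 1; push_cast; ring
          rw [e3]
          simp only [Lint, Tint, add_single_eq_update, Function.update_self, Function.update_idem,
            Complex.ofReal_re]
          field_simp
        have n1 : ‖(2 * Real.pi * I : ℂ)‖ = 2 * Real.pi := by
          simp [abs_of_pos Real.pi_pos]
        rw [this, norm_mul, n1, norm_mul]
        calc _ ≤ 2 * Real.pi * (om (z i) ^ (7 * M) *
              (C * ((1 + ‖z i‖) ^ 3 * (1 + ‖ζ‖) ^ (-3 : ℝ)))) := by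
              have := Real.pi_pos
              gcongr
          _ = _ := by ring
    · exact integrable_m3.const_mul _
    · refine Filter.Eventually.of_forall fun ζ x _ => ?_
      have a2 : HasDerivAt (fun x : ℝ => 2 * Real.pi * I * (x : ℂ) * ζ) (2 * Real.pi * I * ζ) x := by
        have := ((Complex.ofRealCLM.hasDerivAt (x := x)).const_mul (2 * Real.pi * I)).mul_const ζ
        simpa using this
      refine (a2.cexp.mul_const (Tint i g ζ z)).congr_deriv ?_
      ring
  have hc : Φ x = Φ 0 := is_const_of_deriv_eq_zero (fun y => (hder y).differentiableAt)
    (fun y => (hder y).deriv) x 0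
  have hΦ0 : Φ 0 = Top i g z := by simp [hΦ, Top]
  have hΦx : Φ x = Complex.exp (2 * Real.pi * I * (-x : ℝ) * z i) *
      Top i ((fun z => Complex.exp (2 * Real.pi * I * x * z i)) * g) z := by
    simp only [hΦ, Top]
    simp_rw [e1 x]
    rw [integral_const_mul]
  rw [← hΦ0, ← hc, hΦx, ← mul_assoc, ← Complex.exp_add]
  push_cast
  ring_nf
  simp

end MP
end MPsec5

noncomputable section MPsec6
namespace MP
open scoped ContDiff
open Complex MeasureTheory
variable {n : ℕ} {ι : Type}

lemma Top_crude {S : Finset (Fin n)} {i : Fin n} (hi : i ∉ S) {g : V n → ℂ}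
    (hg : g ∈ SS (insert i S)) (M : ℕ) : ∃ C : ℝ, 0 ≤ C ∧ ∀ z,
    (∀ j, j ∉ insert i S → |(z j).re| ≤ (M : ℝ)) →
    ‖Top i g z‖ * OM S z ^ M ≤ C * (1 + ‖z i‖) ^ 3 := by
  obtain ⟨C, hC, hb⟩ := Tint_bound hi hg M
  refine ⟨C * ∫ ζ : ℂ, ‖ζ‖⁻¹ * (1 + ‖ζ‖) ^ (-3 : ℝ), ?_, fun z hz => ?_⟩
  · refine mul_nonneg hC (integral_nonneg fun ζ => ?_)
    show 0 ≤ ‖ζ‖⁻¹ * (1 + ‖ζ‖) ^ (-3 : ℝ)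
    positivity
  have o : 0 < OM S z ^ M := pow_pos (OM_pos S z) M
  have h1 : ‖Top i g z‖ ≤ ∫ ζ : ℂ, (C * (1 + ‖z i‖) ^ 3 / OM S z ^ M) *
      (‖ζ‖⁻¹ * (1 + ‖ζ‖) ^ (-3 : ℝ)) := by
    refine norm_integral_le_of_norm_le (integrable_cauchy.const_mul _)
      (Filter.Eventually.of_forall fun ζ => ?_)
    rw [div_mul_eq_mul_div, le_div_iff₀ o]
    exact hb ζ z hz
  rw [integral_const_mul] at h1
  calc _ ≤ (C * (1 + ‖z i‖) ^ 3 / OM S z ^ M * ∫ ζ : ℂ, ‖ζ‖⁻¹ * (1 + ‖ζ‖) ^ (-3 : ℝ)) *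
        OM S z ^ M := by gcongr
    _ = _ := by field_simp

lemma KL.coord_pow {S : Finset (Fin n)} {i : Fin n} (hi : i ∉ S) {g : V n → ℂ} (h : KL S i g)
    (m : ℕ) : ∃ g', KL S i g' ∧ ∀ z, Top i g' z = z i ^ m * Top i g z := by
  induction m with
  | zero => exact ⟨g, h, by simp⟩
  | succ m ih =>
    obtain ⟨g', h', e⟩ := ih
    refine ⟨_, KL.coord hi h', fun z => ?_⟩
    rw [Top_coord hi h', e]; ring

lemma pow_split (r : ℝ) (hr : 0 ≤ r) (m : ℕ) : (1 + r) ^ m ≤ 2 ^ m * (1 + r ^ m) := by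
  rcases le_total r 1 with h | h
  · calc (1 + r) ^ m ≤ 2 ^ m := pow_le_pow_left₀ (by linarith) (by linarith) m
      _ ≤ _ := le_mul_of_one_le_right (by positivity) (by linarith [pow_nonneg hr m])
  · calc (1 + r) ^ m ≤ (2 * r) ^ m := pow_le_pow_left₀ (by linarith) (by linarith) m
      _ = 2 ^ m * r ^ m := mul_pow _ _ _
      _ ≤ _ := by gcongr; linarith

lemma Top_poly {S : Finset (Fin n)} {i : Fin n} (hi : i ∉ S) {g : V n → ℂ} (h : KL S i g)
    (N M : ℕ) : ∃ C : ℝ, 0 ≤ C ∧ ∀ z,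
    (∀ j, j ∉ insert i S → |(z j).re| ≤ (M : ℝ)) →
    ‖Top i g z‖ * OM S z ^ M * (1 + ‖z i‖) ^ N ≤ C := by
  obtain ⟨C, hC, h1⟩ := Top_crude hi h.1 M
  obtain ⟨g', hg', e⟩ := h.coord_pow hi (N + 3)
  obtain ⟨C', hC', h2⟩ := Top_crude hi hg'.1 M
  refine ⟨2 ^ (N + 3) * (C + C'), by positivity, fun z hz => ?_⟩
  have a1 := h1 z hz
  have a2 := h2 z hz
  rw [e, norm_mul, norm_pow] at a2
  have a3 := pow_split ‖z i‖ (norm_nonneg _) (N + 3)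
  have p : 0 < (1 + ‖z i‖) ^ 3 := by positivity
  have q : 0 ≤ ‖Top i g z‖ * OM S z ^ M := mul_nonneg (norm_nonneg _) (pow_pos (OM_pos S z) M).le
  refine le_of_mul_le_mul_right ?_ p
  calc _ = (‖Top i g z‖ * OM S z ^ M) * (1 + ‖z i‖) ^ (N + 3) := by rw [pow_add]; ring
    _ ≤ (‖Top i g z‖ * OM S z ^ M) * (2 ^ (N + 3) * (1 + ‖z i‖ ^ (N + 3))) := by gcongr
    _ = 2 ^ (N + 3) * (‖Top i g z‖ * OM S z ^ M + ‖z i‖ ^ (N + 3) * ‖Top i g z‖ * OM S z ^ M) := by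
      ring
    _ ≤ 2 ^ (N + 3) * (C * (1 + ‖z i‖) ^ 3 + C' * (1 + ‖z i‖) ^ 3) := by gcongr
    _ = _ := by ring

lemma Top_bd {S : Finset (Fin n)} {i : Fin n} (hi : i ∉ S) {g : V n → ℂ} (h : KL S i g)
    (N : ℕ) : ∃ C : ℝ, ∀ z,
    (∀ j, j ∉ insert i S → |(z j).re| ≤ (N : ℝ)) →
    ‖Top i g z‖ * OM (insert i S) z ^ N ≤ C := by
  obtain ⟨C1, hC1, h1⟩ := Top_poly hi (h.exp (N : ℝ)) N N
  obtain ⟨C2, hC2, h2⟩ := Top_poly hi (h.exp (-N : ℝ)) N N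
  have ne : ∀ (x : ℝ) (w : ℂ), ‖Complex.exp (2 * Real.pi * I * x * w)‖ =
      Real.exp (-(2 * Real.pi * x * w.im)) := by
    intro x w
    rw [Complex.norm_exp]
    congr 1
    simp
  refine ⟨C1 + C2, fun z hz => ?_⟩
  have a1 := h1 z hz
  have a2 := h2 z hz
  rw [Top_exp hi h, norm_mul, ne] at a1 a2
  rw [OM_insert hi, om, mul_pow, mul_pow, ← Real.exp_nat_mul]
  have hN : (0 : ℝ) ≤ N := N.cast_nonneg
  have pi3 := Real.pi_gt_three
  have q : 0 ≤ ‖Top i g z‖ * OM S z ^ N * (1 + ‖z i‖) ^ N :=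
    mul_nonneg (mul_nonneg (norm_nonneg _) (pow_pos (OM_pos S z) N).le) (by positivity)
  rcases le_total 0 (z i).im with hy | hy
  · rw [abs_of_nonneg hy]
    have : Real.exp (N * (z i).im) ≤ Real.exp (-(2 * Real.pi * (-N : ℝ) * (z i).im)) := by
      apply Real.exp_le_exp.2
      have : 0 ≤ N * (z i).im := by positivity
      nlinarith
    have := mul_le_mul_of_nonneg_left this q
    nlinarith
  · rw [abs_of_nonpos hy]
    have : Real.exp (N * -(z i).im) ≤ Real.exp (-(2 * Real.pi * (N : ℝ) * (z i).im)) := by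
      apply Real.exp_le_exp.2
      have : 0 ≤ N * -(z i).im := mul_nonneg hN (by linarith)
      nlinarith
    have := mul_le_mul_of_nonneg_left this q
    nlinarith

lemma Top_mem {S : Finset (Fin n)} {i : Fin n} (hi : i ∉ S) {g : V n → ℂ} (h : KL S i g) :
    Top i g ∈ SS (insert i S) := by
  refine ⟨coind' _ {F | ∃ g, KL S i g ∧ F = fun _ => Top i g} ?_ ?_ ?_ ⟨g, h, rfl⟩, ?_⟩
  · rintro _ ⟨g, h, rfl⟩ _
    exact (Top_D hi h.1).1
  · rintro _ ⟨g, h, rfl⟩ N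
    obtain ⟨C, hC⟩ := Top_bd hi h N
    exact ⟨C, fun _ => hC⟩
  · rintro _ ⟨g, h, rfl⟩ b
    exact Submodule.subset_span ⟨_, h.D hi b, by funext _; exact (Top_D hi h.1).2 b⟩
  · intro z w h1 h2
    unfold Top Tint
    congr 1
    funext ζ
    refine congrArg (ζ⁻¹ * ·) (h.1.2 _ _ ?_ ?_)
    · intro j hj; simp [h1 j hj]
    · intro j; simp [h2 j]

lemma Top_dbar {S : Finset (Fin n)} {i : Fin n} (hi : i ∉ S) {g : V n → ℂ}
    (hg : g ∈ SS (insert i S)) : Top i (dbar i g) = (-(2 * Real.pi) : ℂ) • g := by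
  funext z
  have hfd : ∀ ζ : ℂ, HasFDerivAt (fun ζ : ℂ => g (z + Pi.single i ζ))
      ((fderiv ℝ g (z + Pi.single i ζ)).comp
        (ContinuousLinearMap.single ℝ (fun _ : Fin n => ℂ) i)) ζ := by
    intro ζ
    have h1 : HasFDerivAt (fun ζ : ℂ => z + (Pi.single i ζ : V n))
      (ContinuousLinearMap.single ℝ (fun _ : Fin n => ℂ) i) ζ :=
      ((ContinuousLinearMap.single ℝ (fun _ : Fin n => ℂ) i).hasFDerivAt (x := ζ)).const_add z
    exact ((SS.diff hg) _).hasFDerivAt.comp ζ h1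
  obtain ⟨M, hM⟩ := exists_nat_ball z
  have hz : ∀ j, j ∉ insert i S → |(z j).re| ≤ (M : ℝ) := fun j _ =>
    hM z (Metric.mem_ball_self one_pos) j
  obtain ⟨C0, hC0, b0⟩ := g_bound hi hg M
  obtain ⟨C1, hC1, b1⟩ := g_bound hi (SS.D hg (i, false)) M
  obtain ⟨C2, hC2, b2⟩ := g_bound hi (SS.D hg (i, true)) M
  have red : ∀ {f : V n → ℂ} {C : ℝ} {ζ : ℂ}, ‖f (z + Pi.single i ζ)‖ * OM S z ^ M ≤
      C * (1 + ‖z i‖) ^ 3 * (1 + ‖ζ‖) ^ (-3 : ℝ) → ‖f (z + Pi.single i ζ)‖ ≤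
      C * (1 + ‖z i‖) ^ 3 * (1 + ‖ζ‖) ^ (-3 : ℝ) := fun h =>
    le_trans (le_mul_of_one_le_right (norm_nonneg _) (one_le_pow₀ (one_le_OM S z))) h
  have bvf : (bv (i, false) : V n) = Pi.single i 1 := by simp [bv]
  have bvt : (bv (i, true) : V n) = Pi.single i I := by simp [bv]
  have key := cauchy_pompeiu (h := fun ζ : ℂ => g (z + Pi.single i ζ))
    (C := (C0 + C1 + C2) * (1 + ‖z i‖) ^ 3) ?_ ?_ ?_
  · simp only [Pi.single_zero, add_zero] at key
    rw [Pi.smul_apply, smul_eq_mul]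
    rw [← key]
    unfold Top Tint dbar
    congr 1
    funext ζ
    rw [(hfd ζ).fderiv]
    simp [D, bvf, bvt]
  · have h1 : ContDiff ℝ 1 (fun ζ : ℂ => z + (Pi.single i ζ : V n)) :=
      contDiff_const.add (ContinuousLinearMap.single ℝ (fun _ : Fin n => ℂ) i).contDiff
    exact ((SS.contDiff hg).of_le (by exact_mod_cast le_top)).comp h1
  · intro ζ
    refine (red (b0 ζ z hz)).trans ?_
    gcongr
    linarith
  · intro ζ
    rw [(hfd ζ).fderiv]
    refine ContinuousLinearMap.opNorm_le_bound _ (by positivity) fun w => ?_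
    have e : (fderiv ℝ g (z + Pi.single i ζ)).comp
        (ContinuousLinearMap.single ℝ (fun _ : Fin n => ℂ) i) w =
        w.re • D (i, false) g (z + Pi.single i ζ) + w.im • D (i, true) g (z + Pi.single i ζ) := by
      have : (Pi.single i w : V n) = w.re • bv (i, false) + w.im • bv (i, true) := by
        rw [bvf, bvt, ← Pi.single_smul, ← Pi.single_smul, ← Pi.single_add]
        congr 1
        simp
      simp only [ContinuousLinearMap.comp_apply, ContinuousLinearMap.single_apply, D]
      rw [this, map_add, map_smul, map_smul]
    rw [e]
    refine (norm_add_le _ _).trans ?_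
    rw [norm_smul, norm_smul, Real.norm_eq_abs, Real.norm_eq_abs]
    have r1 := red (b1 ζ z hz)
    have r2 := red (b2 ζ z hz)
    have hp : 0 ≤ (1 + ‖z i‖) ^ 3 * (1 + ‖ζ‖) ^ (-3 : ℝ) := by positivity
    calc _ ≤ ‖w‖ * (C1 * (1 + ‖z i‖) ^ 3 * (1 + ‖ζ‖) ^ (-3 : ℝ)) +
          ‖w‖ * (C2 * (1 + ‖z i‖) ^ 3 * (1 + ‖ζ‖) ^ (-3 : ℝ)) := by
          gcongr
          · exact Complex.abs_re_le_norm w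
          · exact Complex.abs_im_le_norm w
      _ ≤ _ := by nlinarith [mul_nonneg (mul_nonneg hC0 hp) (norm_nonneg w)]

/-- exactness in the middle and injectivity -/
lemma dbe_exact {S : Finset (Fin n)} {i : Fin n} (hi : i ∉ S) :
    Function.Injective (dbe (insert i S) i) ∧
    ∀ g, Le S i hi g = 0 ↔ ∃ f, dbe (insert i S) i f = g := by
  have h2 : (-(2 * Real.pi) : ℂ) ≠ 0 := by
    simp [Real.pi_ne_zero]
  constructor
  · rw [← LinearMap.ker_eq_bot, LinearMap.ker_eq_bot']
    intro g hg
    have h0 : dbar i g.1 = 0 := congrArg Subtype.val hg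
    have h1 := Top_dbar hi g.2
    rw [h0] at h1
    have h3 : Top i (0 : V n → ℂ) = 0 := by
      funext z; simp [Top, Tint]
    rw [h3] at h1
    apply Subtype.ext
    exact (smul_eq_zero.1 h1.symm).resolve_left h2
  · intro g
    constructor
    · intro h
      have hL : Lop i g.1 = 0 := congrArg Subtype.val h
      have hK : KL S i g.1 := ⟨g.2, hL⟩
      refine ⟨⟨(-(2 * Real.pi) : ℂ)⁻¹ • Top i g.1, (SS _).smul_mem _ (Top_mem hi hK)⟩, ?_⟩
      apply Subtype.ext
      show dbar i ((-(2 * Real.pi) : ℂ)⁻¹ • Top i g.1) = g.1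
      have e := Top_D hi g.2
      have e2 : dbar i (Top i g.1) = Top i (dbar i g.1) := by
        unfold dbar
        rw [e.2, e.2]
        funext z
        have i1 := Tint_integrable hi (SS.D g.2 (i, false)) z
        have i2 := Tint_integrable hi (SS.D g.2 (i, true)) z
        simp only [Top, Pi.add_apply, Pi.smul_apply, smul_eq_mul]
        rw [← integral_const_mul, ← integral_add i1 (i2.const_mul I)]
        congr 1
        funext ζ
        simp [Tint]; ring
      have e3 : dbar i ((-(2 * Real.pi) : ℂ)⁻¹ • Top i g.1) =
          (-(2 * Real.pi) : ℂ)⁻¹ • dbar i (Top i g.1) := by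
        unfold dbar
        rw [D_smul _ e.1, D_smul _ e.1, smul_add, smul_comm I]
      rw [e3, e2, Top_dbar hi g.2, smul_smul, inv_mul_cancel₀ h2, one_smul]
    · rintro ⟨f, rfl⟩
      apply Subtype.ext
      exact Lop_dbar hi f.2

end MP
end MPsec6

noncomputable section MPsec7
namespace MP
open scoped ContDiff
open Complex MeasureTheory
variable {n : ℕ} {ι : Type}

/-- monic polynomial with coefficients `a` -/
def hp {m : ℕ} (a : V m) (w : ℂ) : ℂ := w ^ m + ∑ r : Fin m, a r * w ^ (r : ℕ)

/-- the same as a polynomial -/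
def hpP {m : ℕ} (a : V m) : Polynomial ℂ :=
  Polynomial.X ^ m + ∑ r : Fin m, Polynomial.C (a r) * Polynomial.X ^ (r : ℕ)

lemma hpP_eval {m : ℕ} (a : V m) (w : ℂ) : (hpP a).eval w = hp a w := by
  simp [hpP, hp, Polynomial.eval_finsetSum]

lemma hpP_deg {m : ℕ} (a : V m) :
    (∑ r : Fin m, Polynomial.C (a r) * Polynomial.X ^ (r : ℕ) : Polynomial ℂ).degree < m := by
  refine (Polynomial.degree_sum_le _ _).trans_lt ?_
  rw [Finset.sup_lt_iff (by exact WithBot.bot_lt_coe m)]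
  intro r _
  exact (Polynomial.degree_C_mul_X_pow_le _ _).trans_lt (by exact_mod_cast r.2)

lemma hpP_monic {m : ℕ} (a : V m) : (hpP a).Monic := Polynomial.monic_X_pow_add (hpP_deg a)

lemma hpP_natDegree {m : ℕ} (a : V m) : (hpP a).natDegree = m := by
  unfold hpP
  rw [Polynomial.natDegree_add_eq_left_of_degree_lt, Polynomial.natDegree_X_pow]
  rw [Polynomial.degree_X_pow]
  exact hpP_deg a

lemma strip {m : ℕ} (a : V m) (t : ℝ) : ∃ l : Fin (m + 1), ∀ z : ℂ,
    |z.im - t - 4 * (l : ℕ)| ≤ 1 → 1 ≤ ‖hp a (2 * Real.pi * I * z)‖ := by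
  have hs : (hpP a).Splits := IsAlgClosed.splits _
  have hev : ∀ w, hp a w = ((hpP a).roots.map (fun r => w - r)).prod := by
    intro w
    rw [← hpP_eval, hs.eval_eq_prod_roots_of_monic (hpP_monic a)]
  obtain ⟨l, hl⟩ : ∃ l : Fin (m + 1), ∀ r ∈ (hpP a).roots,
      2 ≤ |(-r.re / (2 * Real.pi)) - (t + 4 * (l : ℕ))| := by
    by_contra hcon
    push Not at hcon
    choose f hf hf2 using hcon
    have hc : (hpP a).roots.toFinset.card < (Finset.univ : Finset (Fin (m + 1))).card := by
      have h1 := (hpP a).roots.toFinset_card_le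
      have h2 := (hpP a).card_roots'
      rw [hpP_natDegree] at h2
      simp
      omega
    obtain ⟨x, _, y, _, hxy, e⟩ := Finset.exists_ne_map_eq_of_card_lt_of_maps_to hc
      (f := f) (fun x _ => by simpa using hf x)
    have h1 := hf2 x
    have h2 := hf2 y
    rw [← e] at h2
    have h3 : |(4 : ℝ) * ((x : ℕ) : ℝ) - 4 * ((y : ℕ) : ℝ)| < 4 := by
      rw [abs_lt] at *
      constructor <;> linarith [h1.1, h1.2, h2.1, h2.2]
    have h4 : |((x : ℕ) : ℤ) - ((y : ℕ) : ℤ)| < 1 := by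
      have : |((x : ℕ) : ℝ) - ((y : ℕ) : ℝ)| < 1 := by
        rw [abs_lt] at *
        constructor <;> linarith [h3.1, h3.2]
      exact_mod_cast this
    apply hxy
    ext
    rw [Int.abs_lt_one_iff] at h4
    omega
  refine ⟨l, fun z hz => ?_⟩
  rw [hev]
  have en : ∀ s : Multiset ℂ, ‖s.prod‖ = (s.map fun x => ‖x‖).prod := fun s =>
    map_multiset_prod (normHom : ℂ →*₀ ℝ) s
  rw [en, Multiset.map_map]
  refine Multiset.one_le_prod ?_
  intro x hx
  rw [Multiset.mem_map] at hx
  obtain ⟨r, hr, rfl⟩ := hx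
  have h1 := hl r hr
  simp only [Function.comp]
  have h2 := Complex.abs_re_le_norm (2 * Real.pi * I * z - r)
  have h3 : (2 * Real.pi * I * z - r).re = 2 * Real.pi * ((-r.re / (2 * Real.pi)) - z.im) := by
    have := Real.pi_pos
    simp
    field_simp
    ring
  rw [h3, abs_mul, abs_of_pos (by have := Real.pi_pos; positivity)] at h2
  have h4 : 1 ≤ |(-r.re / (2 * Real.pi)) - z.im| := by
    have := abs_sub_abs_le_abs_sub ((-r.re / (2 * Real.pi)) - (t + 4 * (l : ℕ)))
      (z.im - t - 4 * (l : ℕ))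
    have e : (-r.re / (2 * Real.pi)) - (t + 4 * (l : ℕ)) - (z.im - t - 4 * (l : ℕ)) =
      (-r.re / (2 * Real.pi)) - z.im := by ring
    rw [e] at this
    linarith
  have := Real.pi_gt_three
  show (1 : ℝ) ≤ ‖2 * Real.pi * I * z - r‖
  nlinarith

/-- sum of squares -/
def sg {m : ℕ} (a : V m) : ℝ := ∑ r, ‖a r‖ ^ 2

/-- scaling factor -/
def kap {m : ℕ} (a : V m) : ℝ := (1 + sg a) ^ (2 * m)

/-- overall constant -/
def Lam (m : ℕ) : ℝ := 8 * (m + 1) ^ 2 * (1 + 2 * m) ^ m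

/-- rescaled coefficients -/
def Psi {m : ℕ} (a : V m) : V m := fun r => (Lam m * kap a : ℝ) * a r

lemma sg_nonneg {m : ℕ} (a : V m) : 0 ≤ sg a := Finset.sum_nonneg fun _ _ => by positivity

lemma one_le_kap {m : ℕ} (a : V m) : 1 ≤ kap a := one_le_pow₀ (by linarith [sg_nonneg a])

lemma kap_ineq {m : ℕ} (a b : V m) : kap a * kap b * ∑ r, ‖a r - b r‖ ^ 2 ≤
    ∑ r, ‖kap a * a r - kap b * b r‖ ^ 2 := by
  have e1 : ∀ r, ‖a r - b r‖ ^ 2 = ‖a r‖ ^ 2 + ‖b r‖ ^ 2 - 2 * ((a r).re * (b r).re + (a r).im * (b r).im) := by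
    intro r
    simp only [← Complex.normSq_eq_norm_sq, Complex.normSq_apply, Complex.sub_re, Complex.sub_im]
    ring
  have e2 : ∀ r, ‖kap a * a r - kap b * b r‖ ^ 2 = kap a ^ 2 * ‖a r‖ ^ 2 + kap b ^ 2 * ‖b r‖ ^ 2
      - 2 * (kap a * kap b) * ((a r).re * (b r).re + (a r).im * (b r).im) := by
    intro r
    simp only [← Complex.normSq_eq_norm_sq, Complex.normSq_apply, Complex.sub_re, Complex.sub_im,
      Complex.re_ofReal_mul, Complex.im_ofReal_mul]
    ring
  simp_rw [e1, e2, Finset.sum_sub_distrib, Finset.sum_add_distrib, ← Finset.mul_sum]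
  change kap a * kap b * (sg a + sg b - _) ≤ kap a ^ 2 * sg a + kap b ^ 2 * sg b - _
  have key : 0 ≤ (kap a - kap b) * (kap a * sg a - kap b * sg b) := by
    have mono : ∀ a b : V m, sg a ≤ sg b → kap a ≤ kap b := fun a b h =>
      pow_le_pow_left₀ (by linarith [sg_nonneg a]) (by linarith) _
    rcases le_total (sg a) (sg b) with h | h
    · have h1 := mono a b h
      have h2 : kap a * sg a ≤ kap b * sg b :=
        mul_le_mul h1 h (sg_nonneg a) (by linarith [one_le_kap b])
      exact mul_nonneg_of_nonpos_of_nonpos (by linarith) (by linarith)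
    · have h1 := mono b a h
      have h2 : kap b * sg b ≤ kap a * sg a :=
        mul_le_mul h1 h (sg_nonneg b) (by linarith [one_le_kap a])
      exact mul_nonneg (by linarith) (by linarith)
  nlinarith

lemma abs_sub_of_Psi {m : ℕ} {a b : V m} (h : ‖Psi a - Psi b‖ ≤ 4) (r : Fin m) :
    ‖a r - b r‖ * (Lam m * (1 + sg a) ^ m) ≤ 4 * (m + 1) := by
  have hL : 0 < Lam m := by unfold Lam; positivity
  have h1 : ∀ r, Lam m * ‖kap a * a r - kap b * b r‖ ≤ 4 := by
    intro r
    have := (norm_le_pi_norm (Psi a - Psi b) r).trans h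
    have e : (Psi a - Psi b) r = (Lam m : ℂ) * (kap a * a r - kap b * b r) := by
      simp [Psi]; ring
    rw [e, norm_mul, Complex.norm_real, Real.norm_eq_abs, abs_of_pos hL] at this
    exact this
  have h2 : Lam m ^ 2 * ∑ r, ‖kap a * a r - kap b * b r‖ ^ 2 ≤ 16 * m := by
    rw [Finset.mul_sum]
    calc _ ≤ ∑ r : Fin m, (16 : ℝ) := by
          refine Finset.sum_le_sum fun r _ => ?_
          have := h1 r
          have p : 0 ≤ Lam m * ‖kap a * a r - kap b * b r‖ := by positivity
          nlinarith
      _ = _ := by simp; ring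
  have h3 := kap_ineq a b
  have h4 : ‖a r - b r‖ ^ 2 ≤ ∑ r, ‖a r - b r‖ ^ 2 :=
    Finset.single_le_sum (f := fun r => ‖a r - b r‖ ^ 2) (fun _ _ => by positivity)
      (Finset.mem_univ r)
  have ka := one_le_kap a
  have kb := one_le_kap b
  have h5 : kap a * ‖a r - b r‖ ^ 2 ≤ ∑ r, ‖kap a * a r - kap b * b r‖ ^ 2 := by
    refine le_trans ?_ h3
    have : kap a ≤ kap a * kap b := le_mul_of_one_le_right (by linarith) kb
    exact mul_le_mul this h4 (by positivity) (by positivity)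
  have h6 : (‖a r - b r‖ * (Lam m * (1 + sg a) ^ m)) ^ 2 ≤ (4 * (m + 1)) ^ 2 := by
    have e : (‖a r - b r‖ * (Lam m * (1 + sg a) ^ m)) ^ 2 =
        Lam m ^ 2 * (kap a * ‖a r - b r‖ ^ 2) := by
      unfold kap; rw [pow_mul']; ring
    rw [e]
    have hm : (0 : ℝ) ≤ m := m.cast_nonneg
    nlinarith [mul_le_mul_of_nonneg_left h5 (sq_nonneg (Lam m))]
  exact le_of_sq_le_sq h6 (by positivity)

lemma hp_big {m : ℕ} (a : V m) (w : ℂ) (hw : 1 + 2 * ∑ r, ‖a r‖ ≤ ‖w‖) : 1 / 2 ≤ ‖hp a w‖ := by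
  rcases Nat.eq_zero_or_pos m with rfl | hm
  · simp [hp]; norm_num
  have hs : 0 ≤ ∑ r, ‖a r‖ := Finset.sum_nonneg fun _ _ => norm_nonneg _
  have h1 : 1 ≤ ‖w‖ := by linarith
  have h2 : ‖∑ r : Fin m, a r * w ^ (r : ℕ)‖ ≤ (∑ r, ‖a r‖) * ‖w‖ ^ (m - 1) := by
    rw [Finset.sum_mul]
    refine (norm_sum_le _ _).trans (Finset.sum_le_sum fun r _ => ?_)
    rw [norm_mul, norm_pow]
    gcongr
    have := r.2; omega
  have h3 : ‖w ^ m‖ - ‖∑ r : Fin m, a r * w ^ (r : ℕ)‖ ≤ ‖hp a w‖ := by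
    have := norm_sub_norm_le (w ^ m) (-∑ r : Fin m, a r * w ^ (r : ℕ))
    rwa [norm_neg, sub_neg_eq_add] at this
  have h4 : ‖w ^ m‖ = ‖w‖ * ‖w‖ ^ (m - 1) := by
    rw [norm_pow, ← pow_succ']; congr 1; omega
  have h5 : 1 ≤ ‖w‖ ^ (m - 1) := one_le_pow₀ h1
  nlinarith

lemma hp_pert {m : ℕ} {a b : V m} (h : ‖Psi a - Psi b‖ ≤ 4) {w : ℂ} (hw : 1 ≤ ‖hp b w‖) :
    1 / 2 ≤ ‖hp a w‖ := by
  by_cases hb : 1 + 2 * ∑ r, ‖a r‖ ≤ ‖w‖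
  · exact hp_big a w hb
  push Not at hb
  have hm0 : (0 : ℝ) ≤ m := m.cast_nonneg
  have hsg := sg_nonneg a
  have h1 : ∑ r, ‖a r‖ ≤ m * (1 + sg a) := by
    calc ∑ r, ‖a r‖ ≤ ∑ r : Fin m, (1 + sg a) := by
          refine Finset.sum_le_sum fun r _ => ?_
          have h4 : ‖a r‖ ^ 2 ≤ sg a :=
            Finset.single_le_sum (f := fun r => ‖a r‖ ^ 2) (fun _ _ => by positivity)
              (Finset.mem_univ r)
          nlinarith [sq_nonneg (‖a r‖ - 1)]
      _ = _ := by simp; ring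
  set R : ℝ := (1 + 2 * m) * (1 + sg a) with hR
  have hwR : ‖w‖ ≤ R := by rw [hR]; nlinarith
  have hR1 : 1 ≤ R := by rw [hR]; nlinarith [mul_nonneg hm0 hsg]
  have hd : ‖hp b w - hp a w‖ ≤ 1 / 2 := by
    have e : hp b w - hp a w = ∑ r : Fin m, (b r - a r) * w ^ (r : ℕ) := by
      simp [hp, sub_mul, Finset.sum_sub_distrib]
    rw [e]
    calc _ ≤ ∑ r : Fin m, ‖a r - b r‖ * R ^ m := by
          refine (norm_sum_le _ _).trans (Finset.sum_le_sum fun r _ => ?_)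
          rw [norm_mul, norm_sub_rev, norm_pow]
          gcongr
          calc ‖w‖ ^ (r : ℕ) ≤ R ^ (r : ℕ) := by gcongr
            _ ≤ R ^ m := pow_le_pow_right₀ hR1 r.2.le
      _ ≤ ∑ r : Fin m, (1 / (2 * (m + 1)) : ℝ) := by
          refine Finset.sum_le_sum fun r _ => ?_
          have := abs_sub_of_Psi h r
          rw [le_div_iff₀ (by positivity)]
          rw [hR, mul_pow]
          unfold Lam at this
          set x := ‖a r - b r‖ * ((1 + 2 * m : ℝ) ^ m * (1 + sg a) ^ m) with hx
          have e : ‖a r - b r‖ * (8 * (m + 1) ^ 2 * (1 + 2 * m : ℝ) ^ m * (1 + sg a) ^ m) =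
            (4 * (m + 1)) * (x * (2 * (m + 1))) := by rw [hx]; ring
          rw [e] at this
          exact le_of_mul_le_mul_left (by linarith) (by positivity : (0 : ℝ) < 4 * (m + 1))
      _ = m / (2 * (m + 1)) := by simp [div_eq_mul_inv]
      _ ≤ 1 / 2 := by
          rw [div_le_div_iff₀ (by positivity) (by norm_num)]; nlinarith
  have := norm_sub_norm_le (hp b w) (hp a w)
  linarith

/-- integer part -/
def flr {m : ℕ} (u : V m) : Fin m → ℤ × ℤ := fun r => (⌊(u r).re⌋, ⌊(u r).im⌋)

lemma flr_meas {m : ℕ} : Measurable (flr (m := m)) := by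
  unfold flr
  refine measurable_pi_iff.2 fun r => Measurable.prodMk ?_ ?_
  · exact Int.measurable_floor.comp (Complex.measurable_re.comp (measurable_pi_apply r))
  · exact Int.measurable_floor.comp (Complex.measurable_im.comp (measurable_pi_apply r))

lemma flr_close {m : ℕ} {u v : V m} (h : flr u = flr v) : ‖u - v‖ ≤ 2 := by
  rw [pi_norm_le_iff_of_nonneg (by norm_num)]
  intro r
  have h1 := congrFun h r
  simp only [flr, Prod.mk.injEq] at h1
  have a1 := Int.abs_sub_lt_one_of_floor_eq_floor h1.1
  have a2 := Int.abs_sub_lt_one_of_floor_eq_floor h1.2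
  have := Complex.norm_le_abs_re_add_abs_im ((u - v) r)
  simp only [Pi.sub_apply, Complex.sub_re, Complex.sub_im] at this ⊢
  linarith

lemma exists_sel {m : ℕ} (t : ℝ) (γ : Fin m → ℤ × ℤ) : ∃ l : Fin (m + 1), ∀ a u : V m,
    flr u = γ → ‖Psi a - u‖ ≤ 1 → ∀ z : ℂ, |z.im - t - 4 * (l : ℕ)| ≤ 1 →
      1 / 2 ≤ ‖hp a (2 * Real.pi * I * z)‖ := by
  by_cases hex : ∃ a u : V m, flr u = γ ∧ ‖Psi a - u‖ ≤ 1
  · obtain ⟨b, v, hv, hb⟩ := hex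
    obtain ⟨l, hl⟩ := strip b t
    refine ⟨l, fun a u hu ha z hz => hp_pert ?_ (hl z hz)⟩
    have h1 := flr_close (hu.trans hv.symm)
    have e : Psi a - Psi b = (Psi a - u) + (u - v) - (Psi b - v) := by abel
    rw [e]
    exact (norm_sub_le _ _).trans (by linarith [norm_add_le (Psi a - u) (u - v)])
  · exact ⟨0, fun a u hu ha => (hex ⟨a, u, hu, ha⟩).elim⟩

end MP
end MPsec7

noncomputable section MPsec8
namespace MP
open scoped ContDiff
open Complex MeasureTheory
variable {n : ℕ} {ι : Type}

/-- bounded families -/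
def BddB (ι : Type) (n : ℕ) : Submodule ℂ (ι → V n → ℂ) where
  carrier := {F | ∃ C : ℝ, ∀ k z, ‖F k z‖ ≤ C}
  zero_mem' := ⟨0, by simp⟩
  add_mem' := by
    rintro F G ⟨C, hC⟩ ⟨C', hC'⟩
    exact ⟨C + C', fun k z => (norm_add_le _ _).trans (add_le_add (hC k z) (hC' k z))⟩
  smul_mem' := by
    rintro c F ⟨C, hC⟩
    refine ⟨‖c‖ * C, fun k z => ?_⟩
    simp only [Pi.smul_apply, norm_smul]
    exact mul_le_mul_of_nonneg_left (hC k z) (norm_nonneg _)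

/-- mollified indicator -/
def cv (B : Set (V n)) (ρ : V n → ℂ) (v : V n) : ℂ := ∫ u in B, ρ (v - u)

/-- test functions -/
def TF (ρ : V n → ℂ) : Prop := ContDiff ℝ ∞ ρ ∧ HasCompactSupport ρ

lemma TF.D {ρ : V n → ℂ} (h : TF ρ) (b : Fin n × Bool) : TF (D b ρ) :=
  ⟨contDiff_D h.1 b, (h.2.fderiv (𝕜 := ℝ)).comp_left (g := fun L : V n →L[ℝ] ℂ => L (bv b)) (by simp)⟩

lemma TF.integrable {ρ : V n → ℂ} (h : TF ρ) : Integrable ρ :=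
  h.1.continuous.integrable_of_hasCompactSupport h.2

lemma cv_D (B : Set (V n)) {ρ : V n → ℂ} (h : TF ρ) :
    Differentiable ℝ (cv B ρ) ∧ ∀ b, D b (cv B ρ) = cv B (D b ρ) := by
  have hsub : ∀ u : V n, Differentiable ℝ (fun z : V n => z - u) := fun u =>
    differentiable_id.sub_const u
  refine kernel_D (μ := volume.restrict B) TF (fun ρ u z => ρ (z - u)) D
    (fun b g hg => TF.D hg b) ?_ ?_ ?_ ?_ h
  · intro g hg u
    exact (hg.1.differentiable (by simp)).comp (hsub u)
  · intro g hg b u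
    funext z
    simp [D, sub_eq_add_neg, fderiv_comp_add_right]
  · intro g hg z
    have : Continuous fun u : V n => z - u := continuous_const.sub continuous_id
    exact (hg.1.continuous.comp this).aestronglyMeasurable
  · intro g hg z₀
    obtain ⟨C, hC⟩ := hg.2.exists_bound_of_continuous hg.1.continuous
    obtain ⟨R, hR⟩ := hg.2.isCompact.isBounded.subset_closedBall 0
    refine ⟨1, one_pos, (Metric.closedBall z₀ (R + 1)).indicator (fun _ => C), ?_, ?_⟩
    · apply Integrable.restrict
      rw [integrable_indicator_iff measurableSet_closedBall]
      exact integrableOn_const (measure_closedBall_lt_top.ne)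
    · intro u z hz
      by_cases hu : u ∈ Metric.closedBall z₀ (R + 1)
      · rw [Set.indicator_of_mem hu]; exact hC _
      · rw [Set.indicator_of_notMem hu]
        have : g (z - u) = 0 := by
          by_contra hne
          have h1 := hR (subset_tsupport g hne)
          rw [mem_closedBall_zero_iff] at h1
          apply hu
          rw [Metric.mem_closedBall, dist_comm]
          rw [Metric.mem_ball, dist_comm] at hz
          have := dist_triangle z₀ z u
          rw [dist_eq_norm z u] at this
          linarith
        rw [this, norm_zero]

lemma cv_bound (B : Set (V n)) {ρ : V n → ℂ} (h : TF ρ) (v : V n) :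
    ‖cv B ρ v‖ ≤ ∫ u, ‖ρ u‖ := by
  have hi : Integrable (fun u => ρ (v - u)) := h.integrable.comp_sub_left v
  refine (norm_integral_le_integral_norm _).trans ?_
  refine (setIntegral_le_integral hi.norm (Filter.Eventually.of_forall fun _ => norm_nonneg _)).trans ?_
  rw [integral_sub_left_eq_self (fun u => ‖ρ u‖)]

lemma cv_isG (B : ι → Set (V n)) {ρ : V n → ℂ} (h : TF ρ) :
    IsG (BddB ι n) (fun k => cv (B k) ρ) := by
  refine coind' _ {F | ∃ ρ, TF ρ ∧ F = fun k => cv (B k) ρ} ?_ ?_ ?_ ⟨ρ, h, rfl⟩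
  · rintro _ ⟨ρ, h, rfl⟩ k
    exact (cv_D _ h).1
  · rintro _ ⟨ρ, h, rfl⟩
    exact ⟨_, fun k z => cv_bound _ h z⟩
  · rintro _ ⟨ρ, h, rfl⟩ b
    exact Submodule.subset_span ⟨_, h.D b, by funext k; exact (cv_D _ h).2 b⟩

lemma exists_beta (m : ℕ) (t : ι → ℝ) : ∃ β : Fin (m + 1) → ι → V m → ℂ,
    (∀ l, IsG (BddB ι m) (β l)) ∧ (∀ k v, ∑ l, β l k v = 1) ∧
    ∀ l k a, β l k (Psi a) ≠ 0 → ∀ z : ℂ, |z.im - t k - 4 * (l : ℕ)| ≤ 1 →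
      1 / 2 ≤ ‖hp a (2 * Real.pi * I * z)‖ := by
  choose sel hsel using fun k => exists_sel (m := m) (t k)
  let bp : ContDiffBump (0 : V m) := ⟨1 / 2, 1, by norm_num, by norm_num⟩
  let ρ : V m → ℂ := fun v => (bp.normed volume v : ℂ)
  have hρ : TF ρ := by
    refine ⟨Complex.ofRealCLM.contDiff.comp (bp.contDiff_normed (n := ⊤)), ?_⟩
    exact (bp.hasCompactSupport_normed (μ := volume)).comp_left (g := fun x : ℝ => (x : ℂ)) (by simp)
  let B : Fin (m + 1) → ι → Set (V m) := fun l k => flr ⁻¹' {γ | sel k γ = l}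
  have hB : ∀ l k, MeasurableSet (B l k) := fun l k => flr_meas (MeasurableSet.of_discrete)
  refine ⟨fun l k => cv (B l k) ρ, fun l => cv_isG _ hρ, fun k v => ?_, fun l k a hne z hz => ?_⟩
  · unfold cv
    have hi : Integrable (fun u => ρ (v - u)) := hρ.integrable.comp_sub_left v
    rw [← integral_iUnion_fintype (fun l => hB l k) ?_ (fun l => hi.integrableOn)]
    · have : (⋃ l, B l k) = Set.univ := by
        rw [Set.eq_univ_iff_forall]
        intro u
        exact Set.mem_iUnion.2 ⟨sel k (flr u), rfl⟩
      rw [this, setIntegral_univ, integral_sub_left_eq_self ρ]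
      show ∫ u, (bp.normed volume u : ℂ) = 1
      rw [integral_complex_ofReal, bp.integral_normed]; simp
    · intro l l' hll
      rw [Function.onFun, Set.disjoint_left]
      intro u h1 h2
      exact hll (h1.symm.trans h2)
  · obtain ⟨u, hu, hu2⟩ : ∃ u ∈ B l k, ρ (Psi a - u) ≠ 0 := by
      by_contra hcon
      push Not at hcon
      exact hne (setIntegral_eq_zero_of_forall_eq_zero hcon)
    have h1 : bp.normed volume (Psi a - u) ≠ 0 := by
      intro h0; apply hu2; simp [ρ, h0]
    have h2 : Psi a - u ∈ Function.support (bp.normed (volume : Measure (V m))) := h1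
    rw [bp.support_normed_eq, mem_ball_zero_iff] at h2
    have hl : sel k (flr u) = l := hu
    refine hsel k (flr u) a u rfl h2.le z ?_
    rwa [hl]

lemma D_conj {b : Fin n × Bool} {f : V n → ℂ} (hf : Differentiable ℝ f) :
    D b (fun z => (starRingEnd ℂ) (f z)) = fun z => (starRingEnd ℂ) (D b f z) := by
  funext z
  have := (Complex.conjCLE.toContinuousLinearMap.hasFDerivAt (x := f z)).comp z (hf z).hasFDerivAt
  have e : (fun z => (starRingEnd ℂ) (f z)) = (Complex.conjCLE.toContinuousLinearMap : ℂ → ℂ) ∘ f := by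
    funext z; simp
  simp only [D]
  rw [e, this.fderiv]
  simp

lemma IsG.conj {S : Finset (Fin n)} {F : ι → V n → ℂ} (h : IsG (MuB ι S) F) :
    IsG (MuB ι S) (fun k z => (starRingEnd ℂ) (F k z)) := by
  refine coind' _ {H | ∃ F, IsG (MuB ι S) F ∧ H = (fun k z => (starRingEnd ℂ) (F k z))} ?_ ?_ ?_
    ⟨F, h, rfl⟩
  · rintro _ ⟨F, h, rfl⟩ k
    exact (Complex.conjCLE.differentiable).comp (h.diff k)
  · rintro _ ⟨F, h, rfl⟩ N
    obtain ⟨C, m, hC⟩ := h.mem N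
    exact ⟨C, m, fun k z hz => by simpa using hC k z hz⟩
  · rintro _ ⟨F, h, rfl⟩ b
    exact Submodule.subset_span ⟨_, h.DF b, by funext k; exact D_conj (h.diff k)⟩

lemma IsG.mulM {S : Finset (Fin n)} {F G : ι → V n → ℂ} (hF : IsG (MuB ι S) F)
    (hG : IsG (MuB ι S) G) : IsG (MuB ι S) (F * G) := hF.mul MuB_mul hG

lemma IsG.sumM {S : Finset (Fin n)} {α : Type*} (s : Finset α) {F : α → ι → V n → ℂ}
    (hF : ∀ a ∈ s, IsG (MuB ι S) (F a)) : IsG (MuB ι S) (∑ a ∈ s, F a) :=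
  (Gm (MuB ι S)).sum_mem hF

lemma IsG.constM (S : Finset (Fin n)) (c : ℂ) : IsG (MuB ι S) (fun _ _ => c) :=
  isG_const _ c (const_mem_MuB S c)

lemma IsG.powM {S : Finset (Fin n)} {F : ι → V n → ℂ} (hF : IsG (MuB ι S) F) (r : ℕ) :
    IsG (MuB ι S) (F ^ r) := by
  induction r with
  | zero => exact IsG.constM S 1
  | succ r ih => rw [pow_succ]; exact ih.mulM hF

lemma IsG.lift {S : Finset (Fin n)} {f : V n → ℂ} (h : IsG (MuB Unit S) (fun _ => f)) :
    IsG (MuB ι S) (fun _ => f) := by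
  refine coind' _ {H | ∃ f, IsG (MuB Unit S) (fun _ => f) ∧ H = fun _ => f} ?_ ?_ ?_ ⟨f, h, rfl⟩
  · rintro _ ⟨f, h, rfl⟩ k
    exact h.diff ()
  · rintro _ ⟨f, h, rfl⟩ N
    obtain ⟨C, m, hC⟩ := h.mem N
    exact ⟨C, m, fun k z hz => hC () z hz⟩
  · rintro _ ⟨f, h, rfl⟩ b
    exact Submodule.subset_span ⟨_, h.DF b, rfl⟩

lemma MuB_mul_bdd {m : ℕ} {S : Finset (Fin n)} {F : ι → V n → ℂ} (hF : F ∈ MuB ι S)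
    {β : ι → V m → ℂ} (hβ : β ∈ BddB ι m) (v : ι → V n → V m) :
    (fun k z => F k z * β k (v k z)) ∈ MuB ι S := by
  intro N
  obtain ⟨C, r, hC⟩ := hF N
  obtain ⟨C', hC'⟩ := hβ
  refine ⟨C * C', r, fun k z hz => ?_⟩
  rw [norm_mul]
  have h1 := hC k z hz
  calc _ ≤ (C * OM S z ^ r) * C' :=
      mul_le_mul h1 (hC' _ _) (norm_nonneg _) ((norm_nonneg _).trans h1)
    _ = _ := by ring

lemma isG_comp {m : ℕ} {S : Finset (Fin n)} {β : ι → V m → ℂ} (hβ : IsG (BddB ι m) β)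
    {v : Fin m → ι → V n → ℂ} (hv : ∀ r, IsG (MuB ι S) (v r)) :
    IsG (MuB ι S) (fun k z => β k (fun r => v r k z)) := by
  have main : IsG (MuB ι S) (fun k z => (1 : ℂ) * β k (fun r => v r k z)) := by
    refine coind' _ {H | ∃ (F : ι → V n → ℂ) (β : ι → V m → ℂ), IsG (MuB ι S) F ∧
      IsG (BddB ι m) β ∧ H = fun k z => F k z * β k (fun r => v r k z)} ?_ ?_ ?_
      ⟨fun _ _ => 1, β, IsG.constM S 1, hβ, rfl⟩
    · rintro _ ⟨F, β, hF, hβ, rfl⟩ k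
      have h1 : Differentiable ℝ (fun z => (fun r => v r k z : V m)) :=
        differentiable_pi.2 fun r => (hv r).diff k
      exact (hF.diff k).mul ((hβ.diff k).comp h1)
    · rintro _ ⟨F, β, hF, hβ, rfl⟩
      exact MuB_mul_bdd hF.mem hβ.mem (fun k z r => v r k z)
    · rintro _ ⟨F, β, hF, hβ, rfl⟩ b
      have e : DF b (fun k z => F k z * β k (fun r => v r k z)) =
          (fun k z => DF b F k z * β k (fun r => v r k z)) +
          ∑ j : Fin m, ((fun k z => (F * ((1 / 2 : ℂ) • (DF b (v j) + fun k z =>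
            (starRingEnd ℂ) (DF b (v j) k z)))) k z * DF (j, false) β k (fun r => v r k z)) +
          (fun k z => (F * ((-I / 2 : ℂ) • (DF b (v j) + (-1 : ℂ) • fun k z =>
            (starRingEnd ℂ) (DF b (v j) k z)))) k z * DF (j, true) β k (fun r => v r k z))) := by
        funext k z
        have h1 : HasFDerivAt (fun z => (fun r => v r k z : V m))
            (ContinuousLinearMap.pi fun r => fderiv ℝ (v r k) z) z :=
          hasFDerivAt_pi.2 fun r => ((hv r).diff k z).hasFDerivAt
        have h2 := (hβ.diff k (fun r => v r k z)).hasFDerivAt.comp z h1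
        have hd2 : Differentiable ℝ (fun z => β k (fun r => v r k z)) := by
          have h1 : Differentiable ℝ (fun z => (fun r => v r k z : V m)) :=
            differentiable_pi.2 fun r => (hv r).diff k
          exact (hβ.diff k).comp h1
        have e1 : DF b (fun k z => F k z * β k (fun r => v r k z)) k z =
            D b (F k) z * β k (fun r => v r k z) + F k z * D b (fun z => β k (fun r => v r k z)) z :=
          congrFun (D_mul (hF.diff k) hd2) z
        have e2 : D b (fun z => β k (fun r => v r k z)) z =
            fderiv ℝ (β k) (fun r => v r k z) (fun r => D b (v r k) z) := by
          show fderiv ℝ (β k ∘ fun z => (fun r => v r k z : V m)) z (bv b) = _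
          rw [h2.fderiv]
          rfl
        rw [e1, e2, fderiv_expand]
        simp only [Pi.add_apply, Finset.sum_apply, DF, Pi.mul_apply, Pi.smul_apply, smul_eq_mul,
          Complex.real_smul, Finset.mul_sum]
        congr 1
        refine Finset.sum_congr rfl fun j _ => ?_
        rw [Complex.re_eq_add_conj, Complex.im_eq_sub_conj]
        have hI : (I : ℂ) ≠ 0 := I_ne_zero
        have hI2 : (I : ℂ)⁻¹ = -I := Complex.inv_I
        rw [div_eq_mul_inv, div_eq_mul_inv (_ - _), mul_inv, hI2]
        ring
      rw [e]
      refine Submodule.add_mem _ (Submodule.subset_span ⟨_, _, hF.DF b, hβ, rfl⟩)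
        (Submodule.sum_mem _ fun j _ => Submodule.add_mem _ ?_ ?_)
      · exact Submodule.subset_span ⟨_, _, hF.mulM ((((hv j).DF b).add ((hv j).DF b).conj).smul _),
          hβ.DF _, rfl⟩
      · exact Submodule.subset_span ⟨_, _, hF.mulM ((((hv j).DF b).add
          (((hv j).DF b).conj.smul _)).smul _), hβ.DF _, rfl⟩
  simpa using main

end MP
end MPsec8

noncomputable section MPsec9
namespace MP
open scoped ContDiff
open Complex MeasureTheory
variable {n : ℕ} {ι : Type}

lemma isG_bump {S : Finset (Fin n)} {c : ℝ → ℂ} (hc : ContDiff ℝ ∞ c) (hcs : HasCompactSupport c)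
    (i : Fin n) (s : ι → ℝ) : IsG (MuB ι S) (fun k z => c ((z i).im - s k)) := by
  refine coind' _ {F | ∃ c : ℝ → ℂ, ContDiff ℝ ∞ c ∧ HasCompactSupport c ∧
    F = fun k z => c ((z i).im - s k)} ?_ ?_ ?_ ⟨c, hc, hcs, rfl⟩
  · rintro _ ⟨c, hc, hcs, rfl⟩ k
    have h1 : Differentiable ℝ (fun z : V n => (z i).im - s k) :=
      ((Complex.imCLM.comp (coordL i)).differentiable).sub_const _
    exact (hc.differentiable (by simp)).comp h1
  · rintro _ ⟨c, hc, hcs, rfl⟩ N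
    obtain ⟨C, hC⟩ := hcs.exists_bound_of_continuous hc.continuous
    exact ⟨C, 0, fun k z _ => by simpa using hC _⟩
  · rintro _ ⟨c, hc, hcs, rfl⟩ b
    have e : DF b (fun (k : ι) (z : V n) => c ((z i).im - s k)) =
        ((bv b i).im : ℂ) • (fun k z => deriv c ((z i).im - s k)) := by
      funext k z
      have h1 : HasFDerivAt (fun z : V n => (z i).im - s k) (Complex.imCLM.comp (coordL i)) z :=
        ((Complex.imCLM.comp (coordL i)).hasFDerivAt).sub_const _
      have h2 := ((hc.differentiable (by simp)) ((z i).im - s k)).hasFDerivAt.comp z h1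
      show fderiv ℝ (c ∘ fun z : V n => (z i).im - s k) z (bv b) = _
      rw [h2.fderiv]
      simp
    rw [e]
    refine Submodule.smul_mem _ _ (Submodule.subset_span ⟨_, ?_, hcs.deriv, rfl⟩)
    exact ((contDiff_infty_iff_deriv.1 hc).2)

lemma exists_bump1 : ∃ c : ℝ → ℂ, ContDiff ℝ ∞ c ∧ HasCompactSupport c ∧ ∫ x, c x = 1 ∧
    ∀ x, c x ≠ 0 → |x| ≤ 1 := by
  let bp : ContDiffBump (0 : ℝ) := ⟨1 / 2, 1, by norm_num, by norm_num⟩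
  refine ⟨fun v => (bp.normed volume v : ℂ), ?_, ?_, ?_, ?_⟩
  · exact Complex.ofRealCLM.contDiff.comp (bp.contDiff_normed (n := ⊤))
  · exact (bp.hasCompactSupport_normed (μ := volume)).comp_left (g := fun x : ℝ => (x : ℂ)) (by simp)
  · rw [integral_complex_ofReal, bp.integral_normed]; simp
  · intro x hx
    have h2 : x ∈ Function.support (bp.normed (volume : Measure ℝ)) := by
      intro h0; apply hx; simp [h0]
    rw [bp.support_normed_eq, mem_ball_zero_iff] at h2
    exact h2.le

/-- quotients -/
lemma isG_quot {S : Finset (Fin n)} {θ : ι → V n → ℂ} (hθ : IsG (MuB ι S) θ) {P : V n → ℂ}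
    (hP : IsG (MuB Unit S) (fun _ => P)) (hs : ∀ k z, θ k z ≠ 0 → 1 / 2 ≤ ‖P z‖) :
    IsG (MuB ι S) (fun k z => θ k z / P z) := by
  have hPd : Differentiable ℝ P := hP.diff ()
  have hcl : IsClosed {z | 1 / 2 ≤ ‖P z‖} := isClosed_le continuous_const hPd.continuous.norm
  have loc : ∀ {θ : V n → ℂ}, (∀ z, θ z ≠ 0 → 1 / 2 ≤ ‖P z‖) → ∀ (r : ℕ) {z}, P z = 0 →
      (fun z => θ z / P z ^ r) =ᶠ[nhds z] 0 := by
    intro θ hθ r z hz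
    have : z ∈ {z | 1 / 2 ≤ ‖P z‖}ᶜ := by simp [hz]
    filter_upwards [hcl.isOpen_compl.mem_nhds this] with w hw
    have : θ w = 0 := by
      by_contra h; exact hw (hθ w h)
    simp [this]
  have main : IsG (MuB ι S) (fun k z => θ k z / P z ^ 1) := by
    refine coind' _ {H | ∃ (θ : ι → V n → ℂ) (r : ℕ), IsG (MuB ι S) θ ∧
      (∀ k z, θ k z ≠ 0 → 1 / 2 ≤ ‖P z‖) ∧ H = fun k z => θ k z / P z ^ r} ?_ ?_ ?_
      ⟨θ, 1, hθ, hs, rfl⟩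
    · rintro _ ⟨θ, r, hθ, hs, rfl⟩ k z
      by_cases hz : P z = 0
      · exact (loc (hs k) r hz).differentiableAt_iff.2 (differentiableAt_const 0)
      · have h1 : DifferentiableAt ℝ (fun z => P z ^ r) z := (hPd z).pow r
        have h2 : DifferentiableAt ℝ (fun z => (P z ^ r)⁻¹) z := h1.inv (pow_ne_zero _ hz)
        simp_rw [div_eq_mul_inv]
        exact (hθ.diff k z).mul h2
    · rintro _ ⟨θ, r, hθ, hs, rfl⟩ N
      obtain ⟨C, m, hC⟩ := hθ.mem N
      refine ⟨C * 2 ^ r, m, fun k z hz => ?_⟩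
      have h1 := hC k z hz
      by_cases h0 : θ k z = 0
      · rw [h0, norm_zero] at h1
        simp only [h0, zero_div, norm_zero]
        have : (0 : ℝ) ≤ 2 ^ r := by positivity
        nlinarith
      · have h2 := hs k z h0
        rw [norm_div, norm_pow, div_le_iff₀ (by positivity)]
        have h3 : 1 ≤ 2 ^ r * ‖P z‖ ^ r := by
          rw [← mul_pow]; exact one_le_pow₀ (by linarith)
        have h4 : 0 ≤ C * OM S z ^ m := (norm_nonneg _).trans h1
        calc _ ≤ C * OM S z ^ m := h1
          _ ≤ (C * OM S z ^ m) * (2 ^ r * ‖P z‖ ^ r) := le_mul_of_one_le_right h4 h3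
          _ = _ := by ring
    · rintro _ ⟨θ, r, hθ, hs, rfl⟩ b
      have e : DF b (fun k z => θ k z / P z ^ r) = (fun k z => DF b θ k z / P z ^ r) +
          (-(r : ℂ)) • (fun k z => (θ * (fun _ => D b P) : ι → V n → ℂ) k z / P z ^ (r + 1)) := by
        funext k z
        simp only [DF, Pi.add_apply, Pi.smul_apply, Pi.mul_apply, smul_eq_mul]
        by_cases hz : P z = 0
        · have h1 : D b (fun z => θ k z / P z ^ r) z = 0 := by
            simp [D, (loc (hs k) r hz).fderiv_eq]
          have h2 : θ k z = 0 := by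
            by_contra h
            have := hs k z h
            rw [hz, norm_zero] at this
            norm_num at this
          have h3 : D b (θ k) z = 0 := by
            have hm := DF_congr_support (b := b) hcl (g := θ k) (fun w hw => by
              by_contra h; exact hw (hs k w h)) z
            exact hm (by simp [hz])
          rw [h1, h2, h3]; simp
        · have h1 : HasFDerivAt (fun z => P z ^ r) ((r * P z ^ (r - 1)) • fderiv ℝ P z) z := by
            simpa using (hPd z).hasFDerivAt.pow r
          have h2 := (hθ.diff k z).hasFDerivAt.mul ((hasDerivAt_inv (pow_ne_zero r hz)).comp_hasFDerivAt_of_eq z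
            h1 rfl)
          have h3 : (fun z => θ k z / P z ^ r) = θ k * (Inv.inv ∘ fun z => P z ^ r) := by
            funext z; simp [div_eq_mul_inv]
          simp only [D]
          rw [h3, h2.fderiv]
          simp
          rcases r with _ | r
          · simp
          · field_simp
            simp
            ring
      rw [e]
      refine Submodule.add_mem _ (Submodule.subset_span ⟨_, _, hθ.DF b, ?_, rfl⟩)
        (Submodule.smul_mem _ _ (Submodule.subset_span ⟨_, _, hθ.mulM (hP.DF b).lift, ?_, rfl⟩))
      · intro k z hne
        by_contra hlt
        exact hne (DF_congr_support (b := b) hcl (g := θ k) (fun w hw => by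
          by_contra h; exact hw (hs k w h)) z hlt)
      · intro k z hne
        exact hs k z (left_ne_zero_of_mul hne)
  simpa using main

lemma isG_hp {m : ℕ} {S : Finset (Fin n)} {i : Fin n} (a : Fin m → V n → ℂ)
    (ha : ∀ r, IsG (MuB Unit (insert i S)) (fun _ => a r)) :
    IsG (MuB Unit (insert i S)) (fun _ z => hp (fun r => a r z) (zz i z)) := by
  have hz : IsG (MuB Unit (insert i S)) (fun _ => zz (n := n) i) :=
    (Mu.zz (Finset.mem_insert_self i S)).1
  have h := (hz.powM m).add (IsG.sumM Finset.univ fun r _ => (ha r).mulM (hz.powM (r : ℕ)))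
  have e : ((fun (_ : Unit) => zz (n := n) i) ^ m + ∑ r : Fin m, (fun (_ : Unit) => a r) *
      (fun (_ : Unit) => zz (n := n) i) ^ (r : ℕ)) =
      (fun _ z => hp (fun r => a r z) (zz i z)) := by
    funext k z
    simp [hp, Finset.sum_apply]
  rwa [e] at h

lemma theta {m : ℕ} {S : Finset (Fin n)} {i : Fin n} (hi : i ∉ S) (a : Fin m → V n → ℂ)
    (ha : ∀ r, IsG (MuB Unit (insert i S)) (fun _ => a r))
    (haS : ∀ r z w, (∀ j ∈ S, z j = w j) → a r z = a r w) (t : ι → ℝ) :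
    ∃ Θ A : ι → V n → ℂ, IsG (MuB ι (insert i S)) A ∧
      (∀ k z, A k z * hp (fun r => a r z) (zz i z) = Θ k z) ∧
      (∀ k z, A k z ≠ 0 → |(z i).im - t k| ≤ 4 * m + 1) ∧
      (∀ k z w, (∀ j ∈ S, z j = w j) → (z i).im = (w i).im → Θ k z = Θ k w) ∧
      (∀ k z w, (∀ j ∈ insert i S, z j = w j) → A k z = A k w) ∧
      (∀ k z (ξ : ℝ), ∫ τ : ℝ, Θ k (Function.update z i (ξ + τ * I)) = 1) := by
  obtain ⟨β, hβ, hβ1, hβ2⟩ := exists_beta m t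
  obtain ⟨c, hc, hcs, hc1, hc2⟩ := exists_bump1
  set S' := insert i S with hS'
  set P : V n → ℂ := fun z => hp (fun r => a r z) (zz i z) with hPdef
  have hP : IsG (MuB Unit S') (fun _ => P) := isG_hp a ha
  have hPsi : ∀ r, IsG (MuB ι S') (fun _ z => Psi (fun r => a r z) r) := by
    intro r
    have h1 : IsG (MuB ι S') ((fun _ _ => (1 : ℂ)) + ∑ r : Fin m, (fun (_ : ι) => a r) *
        (fun (_ : ι) z => (starRingEnd ℂ) (a r z))) :=
      (IsG.constM S' 1).add (IsG.sumM Finset.univ fun r _ =>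
        ((ha r).lift).mulM (IsG.conj (ha r).lift))
    have h2 := ((h1.powM (2 * m)).mulM (ha r).lift).smul (Lam m : ℂ)
    refine (congrArg (IsG (MuB ι S')) ?_).mp h2
    funext k z
    simp only [Psi, kap, sg, Pi.smul_apply, Pi.mul_apply, Pi.pow_apply, Pi.add_apply,
      Finset.sum_apply, smul_eq_mul]
    push_cast
    simp_rw [Complex.mul_conj, Complex.normSq_eq_norm_sq]
    push_cast
    ring
  set Θ : ι → V n → ℂ := fun k z => ∑ l : Fin (m + 1), β l k (Psi fun r => a r z) *
    c ((z i).im - (t k + 4 * (l : ℕ))) with hΘ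
  have hΘG : IsG (MuB ι S') Θ := by
    have h := IsG.sumM Finset.univ fun l (_ : l ∈ Finset.univ) =>
      (isG_comp (hβ l) hPsi).mulM (isG_bump (S := S') hc hcs i fun k => t k + 4 * (l : ℕ))
    refine (congrArg (IsG (MuB ι S')) ?_).mp h
    funext k z
    simp [hΘ, Finset.sum_apply]
  have hsupp : ∀ k z, Θ k z ≠ 0 → 1 / 2 ≤ ‖P z‖ ∧ |(z i).im - t k| ≤ 4 * m + 1 := by
    intro k z hne
    obtain ⟨l, _, hl⟩ := Finset.exists_ne_zero_of_sum_ne_zero hne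
    have h1 := left_ne_zero_of_mul hl
    have h2 := hc2 _ (right_ne_zero_of_mul hl)
    constructor
    · exact hβ2 l k _ h1 (z i) (by rwa [sub_sub])
    · have h3 : ((l : ℕ) : ℝ) ≤ m := by exact_mod_cast Nat.lt_succ_iff.1 l.2
      have h4 : (0 : ℝ) ≤ ((l : ℕ) : ℝ) := Nat.cast_nonneg _
      rw [abs_le] at *
      constructor <;> linarith [h2.1, h2.2]
  refine ⟨Θ, fun k z => Θ k z / P z, isG_quot hΘG hP fun k z h => (hsupp k z h).1, ?_, ?_, ?_, ?_, ?_⟩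
  · intro k z
    by_cases h0 : P z = 0
    · have : Θ k z = 0 := by
        by_contra h
        have := (hsupp k z h).1
        rw [h0, norm_zero] at this
        norm_num at this
      show Θ k z / P z * P z = Θ k z
      rw [this]; simp
    · exact div_mul_cancel₀ _ h0
  · intro k z h
    exact (hsupp k z (fun h0 => h (by simp [h0]))).2
  · intro k z w h1 h2
    simp only [hΘ]
    rw [h2, funext fun r => haS r z w h1]
  · intro k z w h
    have h1 : ∀ j ∈ S, z j = w j := fun j hj => h j (Finset.mem_insert_of_mem hj)
    have h2 := h i (Finset.mem_insert_self i S)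
    simp only [hΘ, hPdef, zz]
    rw [h2, funext fun r => haS r z w h1]
  · intro k z ξ
    have e : ∀ τ : ℝ, Θ k (Function.update z i (ξ + τ * I)) =
        ∑ l : Fin (m + 1), β l k (Psi fun r => a r z) * c (τ - (t k + 4 * (l : ℕ))) := by
      intro τ
      have h1 : ∀ r, a r (Function.update z i (ξ + τ * I)) = a r z := fun r =>
        haS r _ _ fun j hj => Function.update_of_ne (ne_of_mem_of_not_mem hj hi) _ _
      simp only [hΘ, Function.update_self]
      rw [funext h1]
      simp
    simp_rw [e]
    have hci : Integrable c := hc.continuous.integrable_of_hasCompactSupport hcs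
    rw [integral_finsetSum _ fun l _ => (hci.comp_sub_right _).const_mul _]
    simp_rw [integral_const_mul, integral_sub_right_eq_self c, hc1, mul_one]
    exact hβ1 k _

end MP
end MPsec9

noncomputable section MPsec10
namespace MP
open scoped ContDiff FourierTransform
open Complex MeasureTheory
variable {n : ℕ} {ι : Type}

/-- integrand of the partial Fourier transform -/
def FTi (i : Fin n) (g : V n → ℂ) (s : ℝ) (z : V n) : ℂ :=
  Complex.exp (-(2 * Real.pi * I * s) * z i) * g (Function.update z i s)

/-- partial Fourier-Laplace transform -/
def FT (i : Fin n) (g : V n → ℂ) (z : V n) : ℂ := ∫ s : ℝ, FTi i g s z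

/-- smooth functions supported in a slab -/
def PP (i : Fin n) (k : ℤ) (g : V n → ℂ) : Prop :=
  ContDiff ℝ ∞ g ∧ ∀ z, g z ≠ 0 → |(z i).re - k| ≤ 1

/-- multiplication by the real part -/
def reM (i : Fin n) (g : V n → ℂ) : V n → ℂ := (fun z => ((z i).re : ℂ)) * g

/-- derivation of the transform -/
def Fder (i : Fin n) (b : Fin n × Bool) (g : V n → ℂ) : V n → ℂ :=
  if b.1 = i then (-(2 * Real.pi * I) * bv b i) • reM i g else D b g

lemma closed_slab (i : Fin n) (k : ℤ) : IsClosed {z : V n | |(z i).re - k| ≤ 1} := by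
  refine isClosed_le ?_ continuous_const
  fun_prop

lemma PP.D {i : Fin n} {k : ℤ} {g : V n → ℂ} (h : PP i k g) (b : Fin n × Bool) :
    PP i k (D b g) := by
  refine ⟨contDiff_D h.1 b, fun z hz => ?_⟩
  by_contra hn
  exact hz (DF_congr_support (closed_slab i k) (fun w hw => by
    by_contra h0; exact hw (h.2 w h0)) z hn)

lemma PP.reM {i : Fin n} {k : ℤ} {g : V n → ℂ} (h : PP i k g) : PP i k (reM i g) :=
  ⟨((reL i).contDiff).mul h.1, fun z hz => h.2 z (right_ne_zero_of_mul hz)⟩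

lemma PP.smul {i : Fin n} {k : ℤ} {g : V n → ℂ} (h : PP i k g) (c : ℂ) : PP i k (c • g) :=
  ⟨h.1.const_smul c, fun z hz => h.2 z (right_ne_zero_of_mul hz)⟩

lemma PP.Fder {i : Fin n} {k : ℤ} {g : V n → ℂ} (h : PP i k g) (b : Fin n × Bool) :
    PP i k (Fder i b g) := by
  unfold MP.Fder
  split_ifs
  · exact h.reM.smul _
  · exact h.D b

lemma FTi_cont {i : Fin n} {g : V n → ℂ} (h : Continuous g) :
    Continuous (fun p : ℝ × V n => FTi i g p.1 p.2) := by
  unfold FTi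
  have h1 : Continuous (fun p : ℝ × V n => Function.update p.2 i (p.1 : ℂ)) :=
    continuous_snd.update i (Complex.continuous_ofReal.comp continuous_fst)
  have h2 := h.comp h1
  have h3 : Continuous (fun p : ℝ × V n => Complex.exp (-(2 * Real.pi * I * p.1) * p.2 i)) := by
    fun_prop
  exact h3.mul h2

lemma FTi_zero {i : Fin n} {k : ℤ} {g : V n → ℂ} (h : PP i k g) {s : ℝ} (z : V n)
    (hs : s ∉ Set.Icc (k - 1 : ℝ) (k + 1)) : FTi i g s z = 0 := by
  unfold FTi
  have : g (Function.update z i s) = 0 := by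
    by_contra h0
    have := h.2 _ h0
    simp only [Function.update_self, ofReal_re] at this
    rw [abs_le] at this
    exact hs ⟨by linarith [this.1], by linarith [this.2]⟩
  rw [this, mul_zero]

lemma FTi_diff {i : Fin n} {g : V n → ℂ} (hg : Differentiable ℝ g) (s : ℝ) :
    Differentiable ℝ (FTi i g s) ∧ ∀ b, D b (FTi i g s) = FTi i (Fder i b g) s := by
  have hde : ∀ z : V n, HasFDerivAt (fun z : V n => Complex.exp (-(2 * Real.pi * I * s) * z i))
      (Complex.exp (-(2 * Real.pi * I * s) * z i) • ((-(2 * Real.pi * I * s) : ℂ) • coordL i)) z := by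
    intro z
    exact (((coordL i).hasFDerivAt (x := z)).const_mul (-(2 * Real.pi * I * s) : ℂ)).cexp
  have hu : Differentiable ℝ (fun z : V n => g (Function.update z i s)) :=
    fun z => (hasFDerivAt_update hg i s z).differentiableAt
  have he : Differentiable ℝ (fun z : V n => Complex.exp (-(2 * Real.pi * I * s) * z i)) :=
    fun z => (hde z).differentiableAt
  have e : FTi i g s = (fun z : V n => Complex.exp (-(2 * Real.pi * I * s) * z i)) *
      (fun z => g (Function.update z i s)) := rfl
  refine ⟨he.mul hu, fun b => ?_⟩
  rw [e, D_mul he hu, D_update hg]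
  funext z
  have e2 : D b (fun z : V n => Complex.exp (-(2 * Real.pi * I * s) * z i)) z =
      Complex.exp (-(2 * Real.pi * I * s) * z i) * (-(2 * Real.pi * I * s) * bv b i) := by
    simp only [D, (hde z).fderiv]
    simp
  simp only [Pi.add_apply, Pi.mul_apply, e2]
  unfold FTi Fder
  split_ifs with h
  · simp [reM]; ring
  · have : bv b i = 0 := by simp [bv, Ne.symm h]
    simp [this]

lemma FTi_bound {i : Fin n} {k : ℤ} {g : V n → ℂ} (h : PP i k g) (z₀ : V n) :
    ∃ bound : ℝ → ℝ, Integrable bound ∧ ∀ s, ∀ z ∈ Metric.ball z₀ 1, ‖FTi i g s z‖ ≤ bound s := by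
  have hK : IsCompact ((Set.Icc (k - 1 : ℝ) (k + 1)) ×ˢ Metric.closedBall z₀ 1) :=
    isCompact_Icc.prod (isCompact_closedBall z₀ 1)
  obtain ⟨C, hC⟩ := hK.exists_bound_of_continuousOn (FTi_cont (i := i) h.1.continuous).continuousOn
  refine ⟨(Set.Icc (k - 1 : ℝ) (k + 1)).indicator fun _ => C, ?_, fun s z hz => ?_⟩
  · exact (integrable_indicator_iff measurableSet_Icc).2
      (integrableOn_const (by simp [Real.volume_Icc]))
  · by_cases hs : s ∈ Set.Icc (k - 1 : ℝ) (k + 1)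
    · rw [Set.indicator_of_mem hs]
      exact hC (s, z) ⟨hs, Metric.ball_subset_closedBall hz⟩
    · rw [Set.indicator_of_notMem hs, FTi_zero h z hs, norm_zero]

lemma FTi_contS {i : Fin n} {g : V n → ℂ} (h : Continuous g) (z : V n) :
    Continuous (fun s : ℝ => FTi i g s z) :=
  (FTi_cont (i := i) h).comp (continuous_id.prodMk continuous_const)

lemma FT_D {i : Fin n} {k : ℤ} {g : V n → ℂ} (h : PP i k g) :
    Differentiable ℝ (FT i g) ∧ ∀ b, D b (FT i g) = FT i (Fder i b g) := by
  refine kernel_D (P := PP i k) (Fi := FTi i) (der := Fder i) (fun b g hg => hg.Fder b)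
    (fun g hg s => (FTi_diff (hg.1.differentiable (by simp)) s).1)
    (fun g hg b s => (FTi_diff (hg.1.differentiable (by simp)) s).2 b)
    (fun g hg z => (FTi_contS hg.1.continuous z).aestronglyMeasurable) ?_ h
  intro g hg z₀
  obtain ⟨bd, h1, h2⟩ := FTi_bound hg z₀
  exact ⟨1, one_pos, bd, h1, h2⟩

lemma FTi_int {i : Fin n} {k : ℤ} {g : V n → ℂ} (h : PP i k g) (z : V n) :
    Integrable (fun s => FTi i g s z) := by
  obtain ⟨bd, h1, h2⟩ := FTi_bound h z
  exact h1.mono' (FTi_contS h.1.continuous z).aestronglyMeasurable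
    (Filter.Eventually.of_forall fun s => h2 s z (Metric.mem_ball_self one_pos))

lemma hasDerivAt_upd {g : V n → ℂ} (hg : Differentiable ℝ g) (i : Fin n) (z : V n) (s : ℝ) :
    HasDerivAt (fun s : ℝ => g (Function.update z i (s : ℂ))) (D (i, false) g (Function.update z i (s:ℂ))) s := by
  have h1 : HasDerivAt (fun s : ℝ => Function.update z i (s : ℂ)) (bv (i, false)) s := by
    have e : (fun s : ℝ => Function.update z i (s : ℂ)) =
        fun s : ℝ => updL i z + s • (bv (i, false) : V n) := by
      funext s
      rw [update_eq]
      congr 1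
      funext j
      by_cases hj : j = i
      · subst hj; simp [bv]
      · simp [bv, hj]
    rw [e]
    have := ((hasDerivAt_id s).smul_const (bv (i, false) : V n)).const_add (updL i z)
    simpa using this
  exact (hg _).hasFDerivAt.comp_hasDerivAt s h1

lemma FT_ibp {i : Fin n} {k : ℤ} {g : V n → ℂ} (h : PP i k g) (z : V n) :
    zz i z * FT i g z = FT i (D (i, false) g) z := by
  have hd : ∀ s : ℝ, HasDerivAt (fun s => FTi i g s z)
      (FTi i (D (i, false) g) s z - zz i z * FTi i g s z) s := by
    intro s
    have h1 := hasDerivAt_upd (h.1.differentiable (by simp)) i z s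
    have h2 : HasDerivAt (fun s : ℝ => Complex.exp (-(2 * Real.pi * I * s) * z i))
        (Complex.exp (-(2 * Real.pi * I * s) * z i) * (-(zz i z))) s := by
      have h3 : HasDerivAt (fun s : ℝ => -(2 * Real.pi * I * (s : ℂ)) * z i) (-(zz i z)) s := by
        have := (Complex.ofRealCLM.hasDerivAt (x := s)).const_mul (-(zz i z))
        have e : (fun s : ℝ => -(2 * Real.pi * I * (s : ℂ)) * z i) =
            fun s : ℝ => -(zz i z) * Complex.ofRealCLM s := by
          funext s; simp [zz]; ring
        rw [e]
        exact this.congr_deriv (by simp)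
      exact h3.cexp
    refine (h2.mul h1).congr_deriv ?_
    unfold FTi
    ring
  have i1 := FTi_int h z
  have i2 := FTi_int (h.D (i, false)) z
  have h0 := integral_eq_zero_of_hasDerivAt_of_integrable hd (i2.sub (i1.const_mul _)) i1
  rw [integral_sub i2 (i1.const_mul _), integral_const_mul] at h0
  exact (sub_eq_zero.1 h0).symm

lemma FT_inv {i : Fin n} {k : ℤ} {g : V n → ℂ} (h : PP i k g) (z : V n) (τ x : ℝ) :
    ∫ ξ : ℝ, Complex.exp (2 * Real.pi * I * x * (ξ + τ * I)) *
      FT i g (Function.update z i (ξ + τ * I)) = g (Function.update z i (x : ℂ)) := by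
  set f : ℝ → ℂ := fun s => Complex.exp (2 * Real.pi * s * τ) * g (Function.update z i (s : ℂ)) with hf
  have hcd : ContDiff ℝ ∞ f := by
    have h1 : ContDiff ℝ ∞ (fun s : ℝ => Function.update z i (s : ℂ)) := by
      have e : (fun s : ℝ => Function.update z i (s : ℂ)) =
        fun s : ℝ => updL i z + Pi.single i (s : ℂ) := by
        funext s; exact update_eq i z s
      rw [e]
      refine contDiff_const.add ?_
      rw [contDiff_pi]
      intro j
      by_cases hj : j = i
      · subst hj; simp; exact Complex.ofRealCLM.contDiff
      · simp [hj]; exact contDiff_const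
    have h2 : ContDiff ℝ ∞ (fun s : ℝ => Complex.exp (2 * Real.pi * s * τ)) := by
      have : ContDiff ℝ ∞ (fun s : ℝ => (s : ℂ)) := Complex.ofRealCLM.contDiff
      fun_prop
    exact h2.mul (h.1.comp h1)
  have hcs : HasCompactSupport f := by
    refine HasCompactSupport.intro (isCompact_Icc (a := (k - 1 : ℝ)) (b := k + 1)) fun s hs => ?_
    have := FTi_zero h z hs
    unfold FTi at this
    rcases mul_eq_zero.1 this with h0 | h0
    · exact absurd h0 (Complex.exp_ne_zero _)
    · simp [hf, h0]
  set F := hcs.toSchwartzMap hcd with hF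
  have hFc : ⇑F = f := rfl
  have hinv : 𝓕⁻ (𝓕 f) = f := by
    refine Continuous.fourierInv_fourier_eq hcd.continuous ?_ ?_
    · rw [← hFc]; exact F.integrable
    · rw [← hFc, ← SchwartzMap.fourier_coe]; exact (𝓕 F).integrable
  have e1 : ∀ ξ : ℝ, FT i g (Function.update z i (ξ + τ * I)) = 𝓕 f ξ := by
    intro ξ
    rw [Real.fourier_eq']
    unfold FT
    congr 1
    funext s
    unfold FTi
    simp only [hf, Function.update_idem, Function.update_self, smul_eq_mul]
    rw [← mul_assoc, ← Complex.exp_add]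
    congr 2
    simp
    ring_nf
    simp
  have e2 := congrFun hinv x
  rw [Real.fourierInv_eq'] at e2
  have e3 : ∀ ξ : ℝ, Complex.exp (2 * Real.pi * I * x * (ξ + τ * I)) *
      FT i g (Function.update z i (ξ + τ * I)) = Complex.exp (-(2 * Real.pi * x * τ)) *
      (Complex.exp (((2 * Real.pi * inner ℝ ξ x : ℝ) : ℂ) * I) • 𝓕 f ξ) := by
    intro ξ
    rw [e1, smul_eq_mul, ← mul_assoc, ← Complex.exp_add]
    congr 2
    simp
    ring_nf
    simp
    ring
  simp_rw [e3]
  rw [integral_const_mul, e2, hf]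
  rw [← mul_assoc, ← Complex.exp_add]
  simp

end MP
end MPsec10

noncomputable section MPsec11
namespace MP
open scoped ContDiff
open Complex MeasureTheory
variable {n : ℕ} {ι : Type}

/-- data for heights -/
structure HT (M : ℝ) (T t : ℤ → ℝ) : Prop where
  nn : ∀ k, 0 ≤ T k
  b1 : ∀ k : ℤ, 2 * Real.pi * (M * (|(k : ℝ)| + 1)) ≤ T k
  b2 : ∀ k : ℤ, |(k : ℝ)| ≤ T k
  tp : ∀ k, 0 < k → t k = - T k
  tn : ∀ k, k < 0 → t k = T k
  t0 : t 0 = 0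
  sep : ∀ k l, k ≠ l → 2 * M + 2 < |t k - t l|

/-- slab-wise decay with growth controlled by `T` -/
def Dom (S : Finset (Fin n)) (i : Fin n) (T : ℤ → ℝ) : Submodule ℂ (ℤ → V n → ℂ) where
  carrier := {F | ∀ N : ℕ, ∃ C : ℝ, 0 ≤ C ∧ ∃ A : ℝ, 0 ≤ A ∧ ∀ (k : ℤ) z, |(z i).re - (k : ℝ)| ≤ (1 : ℝ) →
    (∀ j, j ∉ S → j ≠ i → |(z j).re| ≤ (N : ℝ)) → ‖F k z‖ * OM S z ^ N ≤ C * Real.exp (A * |T k|)}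
  zero_mem' := fun N => ⟨0, le_rfl, 0, le_rfl, by simp⟩
  add_mem' := by
    intro F G hF hG N
    obtain ⟨C, hC0, A, hA0, hC⟩ := hF N
    obtain ⟨C', hC0', A', hA0', hC'⟩ := hG N
    refine ⟨C + C', by positivity, A + A', by positivity, fun k z hk hz => ?_⟩
    have h1 := hC k z hk hz
    have h2 := hC' k z hk hz
    have h3 := norm_add_le (F k z) (G k z)
    have h4 : 0 ≤ OM S z ^ N := (pow_pos (OM_pos S z) N).le
    have e1 : Real.exp (A * |T k|) ≤ Real.exp ((A + A') * |T k|) := by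
      apply Real.exp_le_exp.2; nlinarith [abs_nonneg (T k), mul_nonneg hA0' (abs_nonneg (T k))]
    have e2 : Real.exp (A' * |T k|) ≤ Real.exp ((A + A') * |T k|) := by
      apply Real.exp_le_exp.2; nlinarith [abs_nonneg (T k), mul_nonneg hA0 (abs_nonneg (T k))]
    simp only [Pi.add_apply]
    nlinarith [mul_le_mul_of_nonneg_right h3 h4, mul_le_mul_of_nonneg_left e1 hC0,
      mul_le_mul_of_nonneg_left e2 hC0']
  smul_mem' := by
    intro c F hF N
    obtain ⟨C, hC0, A, hA0, hC⟩ := hF N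
    refine ⟨‖c‖ * C, by positivity, A, hA0, fun k z hk hz => ?_⟩
    simp only [Pi.smul_apply, norm_smul, mul_assoc]
    exact mul_le_mul_of_nonneg_left (hC k z hk hz) (norm_nonneg _)

/-- multipliers for `Dom` -/
def MD (S : Finset (Fin n)) (i : Fin n) (T : ℤ → ℝ) : Submodule ℂ (ℤ → V n → ℂ) where
  carrier := {F | ∃ C : ℝ, 0 ≤ C ∧ ∃ A : ℝ, 0 ≤ A ∧ ∃ m : ℕ, ∀ (k : ℤ) z, |(z i).re - (k : ℝ)| ≤ (1 : ℝ) →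
    ‖F k z‖ ≤ C * Real.exp (A * |T k|) * OM S z ^ m}
  zero_mem' := ⟨0, le_rfl, 0, le_rfl, 0, by simp⟩
  add_mem' := by
    rintro F G ⟨C, hC0, A, hA0, m, hC⟩ ⟨C', hC0', A', hA0', m', hC'⟩
    refine ⟨C + C', by positivity, A + A', by positivity, m + m', fun k z hk => ?_⟩
    have h1 := hC k z hk
    have h2 := hC' k z hk
    have h3 := norm_add_le (F k z) (G k z)
    have e1 : Real.exp (A * |T k|) ≤ Real.exp ((A + A') * |T k|) := by
      apply Real.exp_le_exp.2; nlinarith [abs_nonneg (T k), mul_nonneg hA0' (abs_nonneg (T k))]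
    have e2 : Real.exp (A' * |T k|) ≤ Real.exp ((A + A') * |T k|) := by
      apply Real.exp_le_exp.2; nlinarith [abs_nonneg (T k), mul_nonneg hA0 (abs_nonneg (T k))]
    have h4 : OM S z ^ m ≤ OM S z ^ (m + m') := pow_le_pow_right₀ (one_le_OM S z) (by omega)
    have h5 : OM S z ^ m' ≤ OM S z ^ (m + m') := pow_le_pow_right₀ (one_le_OM S z) (by omega)
    have h6 : 0 < OM S z ^ m := pow_pos (OM_pos S z) _
    have h7 : 0 < OM S z ^ m' := pow_pos (OM_pos S z) _
    simp only [Pi.add_apply]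
    calc _ ≤ _ := h3
      _ ≤ C * Real.exp (A * |T k|) * OM S z ^ m + C' * Real.exp (A' * |T k|) * OM S z ^ m' :=
        add_le_add h1 h2
      _ ≤ C * Real.exp ((A + A') * |T k|) * OM S z ^ (m + m') +
          C' * Real.exp ((A + A') * |T k|) * OM S z ^ (m + m') := by gcongr
      _ = _ := by ring
  smul_mem' := by
    rintro c F ⟨C, hC0, A, hA0, m, hC⟩
    refine ⟨‖c‖ * C, by positivity, A, hA0, m, fun k z hk => ?_⟩
    simp only [Pi.smul_apply, norm_smul, mul_assoc]
    have := hC k z hk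
    rw [mul_assoc] at this
    exact mul_le_mul_of_nonneg_left this (norm_nonneg _)

lemma MD_mul_Dom {S : Finset (Fin n)} {i : Fin n} {T : ℤ → ℝ} :
    ∀ F ∈ MD S i T, ∀ G ∈ Dom S i T, F * G ∈ Dom S i T := by
  rintro F ⟨C, hC0, A, hA0, m, hC⟩ G hG N
  obtain ⟨C', hC0', A', hA0', hC'⟩ := hG (N + m)
  refine ⟨C * C', by positivity, A + A', by positivity, fun k z hk hz => ?_⟩
  have h1 := hC k z hk
  have h2 := hC' k z hk (fun j hj hji => (hz j hj hji).trans (by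
    push_cast; linarith [m.cast_nonneg (α := ℝ)]))
  simp only [Pi.mul_apply, norm_mul]
  have h7 : 0 < OM S z ^ N := pow_pos (OM_pos S z) _
  calc ‖F k z‖ * ‖G k z‖ * OM S z ^ N
      ≤ (C * Real.exp (A * |T k|) * OM S z ^ m) * ‖G k z‖ * OM S z ^ N := by gcongr
    _ = C * Real.exp (A * |T k|) * (‖G k z‖ * OM S z ^ (N + m)) := by rw [pow_add]; ring
    _ ≤ C * Real.exp (A * |T k|) * (C' * Real.exp (A' * |T k|)) := by gcongr
    _ = C * C' * Real.exp ((A + A') * |T k|) := by rw [add_mul, Real.exp_add]; ring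

lemma MD_const {S : Finset (Fin n)} {i : Fin n} {T : ℤ → ℝ} (c : ℂ) :
    (fun _ _ => c) ∈ MD S i T := ⟨‖c‖, norm_nonneg _, 0, le_rfl, 0, by simp⟩

lemma MD_zz {S : Finset (Fin n)} {i j : Fin n} (hj : j ∈ S) {T : ℤ → ℝ} :
    IsG (MD S i T) (fun _ => zz j) := by
  refine isG_of_const_D _ _ (diff_zz j) ?_ MD_const fun b => ⟨_, D_zz b j⟩
  refine ⟨2 * Real.pi, by positivity, 0, le_rfl, 1, fun k z _ => ?_⟩
  have h1 := norm_le_om (z j)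
  have h2 := om_le_OM hj z
  have h3 : ‖zz j z‖ = 2 * Real.pi * ‖z j‖ := by
    simp [zz, abs_of_pos Real.pi_pos]
  rw [h3]
  simp
  have := Real.pi_pos
  nlinarith

lemma MD_re {S : Finset (Fin n)} {i : Fin n} {T t : ℤ → ℝ} {M : ℝ} (h : HT M T t) :
    IsG (MD S i T) (fun _ z => ((z i).re : ℂ)) := by
  refine isG_of_const_D _ _ (reL i).differentiable ?_ MD_const fun b => ⟨_, D_re b i⟩
  refine ⟨1, by positivity, 1, by norm_num, 0, fun k z hk => ?_⟩
  rw [Complex.norm_real, Real.norm_eq_abs, abs_of_nonneg (h.nn k)]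
  simp
  have h1 := h.b2 k
  have h2 := Real.add_one_le_exp (T k)
  have h3 : |(z i).re| ≤ |(z i).re - k| + |(k : ℝ)| := by
    have := abs_add_le ((z i).re - k) (k : ℝ); simpa using this
  linarith

/-- admissible families -/
def GG (S : Finset (Fin n)) (i : Fin n) (T : ℤ → ℝ) (G : ℤ → V n → ℂ) : Prop :=
  IsG (Dom S i T) G ∧ ∀ k z, G k z ≠ 0 → |(z i).re - k| ≤ 1

lemma GG.PP {S : Finset (Fin n)} {i : Fin n} {T : ℤ → ℝ} {G : ℤ → V n → ℂ} (h : GG S i T G) (k : ℤ) :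
    PP i k (G k) := ⟨h.1.contDiff k, h.2 k⟩

lemma GG_D {S : Finset (Fin n)} {i : Fin n} {T : ℤ → ℝ} {G : ℤ → V n → ℂ} (h : GG S i T G)
    (b : Fin n × Bool) : GG S i T (DF b G) := ⟨h.1.DF b, fun k => ((h.PP k).D b).2⟩

lemma GG_Fder {S : Finset (Fin n)} {i : Fin n} {T t : ℤ → ℝ} {M : ℝ} (hT : HT M T t)
    {G : ℤ → V n → ℂ} (h : GG S i T G)
    (b : Fin n × Bool) : GG S i T (fun k => Fder i b (G k)) := by
  refine ⟨?_, fun k => ((h.PP k).Fder b).2⟩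
  unfold Fder
  by_cases hb : b.1 = i
  · simp only [hb, if_true]
    exact ((MD_re hT).mul MD_mul_Dom h.1).smul (-(2 * Real.pi * I) * bv b i)
  · simp only [hb, if_false]
    exact h.1.DF b

/-- decay in moving strips -/
def BdT (S' : Finset (Fin n)) (i : Fin n) (M : ℝ) (t : ℤ → ℝ) : Submodule ℂ (ℤ → V n → ℂ) where
  carrier := {F | ∀ N : ℕ, ∃ C : ℝ, ∀ k z, |(z i).im - t k| ≤ M →
    (∀ j, j ∉ S' → |(z j).re| ≤ (N : ℝ)) → ‖F k z‖ * OM S' z ^ N ≤ C}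
  zero_mem' := fun N => ⟨0, by simp⟩
  add_mem' := by
    intro F G hF hG N
    obtain ⟨C, hC⟩ := hF N
    obtain ⟨C', hC'⟩ := hG N
    refine ⟨C + C', fun k z hk hz => ?_⟩
    have := hC k z hk hz
    have := hC' k z hk hz
    have h3 := norm_add_le (F k z) (G k z)
    have h4 : 0 ≤ OM S' z ^ N := (pow_pos (OM_pos S' z) N).le
    simp only [Pi.add_apply]
    nlinarith [mul_le_mul_of_nonneg_right h3 h4]
  smul_mem' := by
    intro c F hF N
    obtain ⟨C, hC⟩ := hF N
    refine ⟨‖c‖ * C, fun k z hk hz => ?_⟩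
    simp only [Pi.smul_apply, norm_smul, mul_assoc]
    exact mul_le_mul_of_nonneg_left (hC k z hk hz) (norm_nonneg _)

lemma MuB_mul_BdT {S : Finset (Fin n)} {i : Fin n} {M : ℝ} {t : ℤ → ℝ} :
    ∀ F ∈ MuB ℤ S, ∀ G ∈ BdT S i M t, F * G ∈ BdT S i M t := by
  intro F hF G hG N
  obtain ⟨C, m, hC⟩ := hF N
  obtain ⟨C', hC'⟩ := hG (N + m)
  refine ⟨|C| * C', fun k z hk hz => ?_⟩
  have h1 := hC k z hz
  have h2 := hC' k z hk (fun i hi => (hz i hi).trans (by push_cast; linarith [m.cast_nonneg (α := ℝ)]))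
  simp only [Pi.mul_apply, norm_mul]
  have h6 : 0 < OM S z ^ m := pow_pos (OM_pos S z) _
  have h7 : 0 < OM S z ^ N := pow_pos (OM_pos S z) _
  calc ‖F k z‖ * ‖G k z‖ * OM S z ^ N ≤ (|C| * OM S z ^ m) * ‖G k z‖ * OM S z ^ N := by
        gcongr
        exact h1.trans (mul_le_mul_of_nonneg_right (le_abs_self C) h6.le)
    _ = |C| * (‖G k z‖ * OM S z ^ (N + m)) := by rw [pow_add]; ring
    _ ≤ |C| * C' := mul_le_mul_of_nonneg_left h2 (abs_nonneg _)

lemma HT_exp {M : ℝ} {T t : ℤ → ℝ} (hT : HT M T t) (B : ℝ) :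
    ∃ C : ℝ, ∀ k : ℤ, (B - |(k : ℝ)|) * T k ≤ C := by
  obtain ⟨N, hN⟩ := exists_nat_ge |B|
  refine ⟨∑ k ∈ Finset.Icc (-(N : ℤ)) N, |B| * T k, fun k => ?_⟩
  have hn : ∀ k : ℤ, 0 ≤ |B| * T k := fun k => mul_nonneg (abs_nonneg _) (hT.nn k)
  by_cases hk : k ∈ Finset.Icc (-(N : ℤ)) N
  · refine le_trans ?_ (Finset.single_le_sum (f := fun k => |B| * T k) (fun k _ => hn k) hk)
    have := le_abs_self B
    have := abs_nonneg (k : ℝ)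
    exact mul_le_mul_of_nonneg_right (by linarith) (hT.nn k)
  · refine le_trans ?_ (Finset.sum_nonneg fun k _ => hn k)
    have : (N : ℝ) ≤ |(k : ℝ)| := by
      rw [Finset.mem_Icc, ← abs_le, not_le] at hk
      exact_mod_cast hk.le
    have := le_abs_self B
    exact mul_nonpos_of_nonpos_of_nonneg (by linarith) (hT.nn k)

lemma HT_line {M : ℝ} (hM : 0 ≤ M) {T t : ℤ → ℝ} (hT : HT M T t) {k : ℤ} {s η : ℝ} (hs : |s - k| ≤ 1)
    (hη : |η - t k| ≤ M) : 2 * Real.pi * (s * η) ≤ (8 - |(k : ℝ)|) * T k ∧ |η| ≤ T k + M := by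
  have hb := hT.b1 k
  have hn := hT.nn k
  have hp := Real.pi_gt_three
  have hp2 := Real.pi_lt_d2
  rw [abs_le] at hs hη
  rcases lt_trichotomy k 0 with hk | hk | hk
  · have ht := hT.tn k hk
    rw [ht] at hη
    have hk1 : (k : ℝ) ≤ -1 := by exact_mod_cast Int.le_sub_one_of_lt hk
    have hka : |(k : ℝ)| = -k := abs_of_neg (by linarith)
    rw [hka] at hb ⊢
    have h1 : s * η ≤ (k + 1) * T k + (-k + 1) * M := by
      nlinarith
    refine ⟨?_, abs_le.2 ⟨by linarith, by linarith⟩⟩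
    have h2 : 2 * Real.pi * ((k + 1) * T k) ≤ (7 + k) * T k := by
      have : 2 * Real.pi * (k + 1) ≤ 7 + k := by nlinarith
      nlinarith
    nlinarith
  · subst hk
    rw [hT.t0] at hη
    simp at hb hs hη ⊢
    have h1 : s * η ≤ M := by nlinarith
    refine ⟨by nlinarith, abs_le.2 ⟨by linarith, by linarith⟩⟩
  · have ht := hT.tp k hk
    rw [ht] at hη
    have hk1 : (1 : ℝ) ≤ k := by exact_mod_cast hk
    have hka : |(k : ℝ)| = k := abs_of_pos (by linarith)
    rw [hka] at hb ⊢
    have h1 : s * η ≤ -(k - 1) * T k + (k + 1) * M := by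
      nlinarith
    refine ⟨?_, abs_le.2 ⟨by linarith, by linarith⟩⟩
    have h2 : 2 * Real.pi * (-(k - 1) * T k) ≤ (7 - k) * T k := by
      have : 2 * Real.pi * (-(k - 1)) ≤ 7 - k := by nlinarith
      nlinarith
    nlinarith

end MP
end MPsec11

noncomputable section MPsec12
namespace MP
open scoped ContDiff
open Complex MeasureTheory
variable {n : ℕ} {ι : Type}

lemma FT_bound0 {S : Finset (Fin n)} {i : Fin n} (hi : i ∉ S) {M : ℝ} (hM : 0 ≤ M) {T t : ℤ → ℝ}
    (hT : HT M T t) {G : ℤ → V n → ℂ} (hG : GG S i T G) (N : ℕ) :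
    ∃ C : ℝ, 0 ≤ C ∧ ∃ A : ℝ, 0 ≤ A ∧ ∀ (k : ℤ) z, |(z i).im - t k| ≤ M →
      (∀ j, j ∉ S → j ≠ i → |(z j).re| ≤ (N : ℝ)) →
      ‖FT i (G k) z‖ * OM S z ^ N ≤ C * Real.exp ((A - |(k : ℝ)|) * T k) := by
  obtain ⟨C, hC0, A, hA0, hC⟩ := hG.1.mem N
  refine ⟨2 * C, by positivity, A + 8, by positivity, fun k z hk hz => ?_⟩
  have hO : 0 < OM S z ^ N := pow_pos (OM_pos S z) N
  have e : FT i (G k) z = ∫ s in Set.Icc (k - 1 : ℝ) (k + 1), FTi i (G k) s z :=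
    (setIntegral_eq_integral_of_forall_compl_eq_zero fun s hs => FTi_zero (hG.PP k) z hs).symm
  have hb : ∀ s ∈ Set.Icc (k - 1 : ℝ) (k + 1), ‖FTi i (G k) s z‖ ≤
      C * Real.exp ((A + 8 - |(k : ℝ)|) * T k) / OM S z ^ N := by
    intro s hs
    have hs1 : |s - k| ≤ 1 := abs_le.2 ⟨by linarith [hs.1], by linarith [hs.2]⟩
    have h1 := hC k (Function.update z i s) (by simpa using hs1) (by
      intro j hj hji
      rw [Function.update_of_ne hji]; exact hz j hj hji)
    rw [OM_update hi, abs_of_nonneg (hT.nn k)] at h1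
    have h2 := (HT_line hM hT hs1 hk).1
    rw [le_div_iff₀ hO]
    unfold FTi
    rw [norm_mul, Complex.norm_exp]
    have e1 : (-(2 * Real.pi * I * s) * z i).re = 2 * Real.pi * (s * (z i).im) := by
      simp [mul_re, mul_im]; ring
    rw [e1, mul_assoc]
    calc _ ≤ Real.exp ((8 - |(k : ℝ)|) * T k) * (C * Real.exp (A * T k)) := by gcongr
      _ = C * Real.exp ((A + 8 - |(k : ℝ)|) * T k) := by
        rw [mul_left_comm, ← Real.exp_add]; ring_nf
  rw [← le_div_iff₀ hO, e]
  refine (norm_setIntegral_le_of_norm_le_const (by simp [Real.volume_Icc]) hb).trans (le_of_eq ?_)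
  simp [Real.volume_real_Icc]
  ring_nf

lemma FT_iter {S : Finset (Fin n)} {i : Fin n} {T : ℤ → ℝ} {G : ℤ → V n → ℂ} (hG : GG S i T G)
    (r : ℕ) : ∃ G', GG S i T G' ∧ ∀ k z, zz i z ^ r * FT i (G k) z = FT i (G' k) z := by
  induction r with
  | zero => exact ⟨G, hG, fun k z => by simp⟩
  | succ r ih =>
    obtain ⟨G', h1, h2⟩ := ih
    refine ⟨DF (i, false) G', GG_D h1 _, fun k z => ?_⟩
    rw [pow_succ', mul_assoc, h2, FT_ibp (h1.PP k)]
    rfl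

lemma FT_bound {S : Finset (Fin n)} {i : Fin n} (hi : i ∉ S) {M : ℝ} (hM : 0 ≤ M) {T t : ℤ → ℝ}
    (hT : HT M T t) {G : ℤ → V n → ℂ} (hG : GG S i T G) :
    (fun k => FT i (G k)) ∈ BdT (insert i S) i M t := by
  intro N
  obtain ⟨G', hG', hzz⟩ := FT_iter hG N
  obtain ⟨C, hC0, A, hA0, hC⟩ := FT_bound0 hi hM hT hG N
  obtain ⟨C', hC0', A', hA0', hC'⟩ := FT_bound0 hi hM hT hG' N
  obtain ⟨K, hK⟩ := HT_exp hT (A + A' + N)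
  refine ⟨2 ^ (N - 1) * (C + C') * (Real.exp (N * M) * Real.exp K), fun k z hk hz => ?_⟩
  have hz' : ∀ j, j ∉ S → j ≠ i → |(z j).re| ≤ (N : ℝ) := fun j hj hji => hz j (by simp [hj, hji])
  have h1 := hC k z hk hz'
  have h2 := hC' k z hk hz'
  have h3 := (HT_line (s := k) hM hT (by simp) hk).2
  have hn := hT.nn k
  have hO : 0 < OM S z ^ N := pow_pos (OM_pos S z) N
  rw [← hzz, norm_mul, norm_pow] at h2
  have h4 : ‖z i‖ ≤ ‖zz i z‖ := by
    have : ‖zz i z‖ = 2 * Real.pi * ‖z i‖ := by simp [zz, abs_of_pos Real.pi_pos]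
    rw [this]
    have := Real.pi_gt_three
    nlinarith [norm_nonneg (z i)]
  have h5 : (1 + ‖z i‖) ^ N ≤ 2 ^ (N - 1) * (1 + ‖zz i z‖ ^ N) := by
    calc _ ≤ (1 + ‖zz i z‖) ^ N := by gcongr
      _ ≤ _ := by simpa using add_pow_le (zero_le_one) (norm_nonneg (zz i z)) N
  have h6 : Real.exp |(z i).im| ^ N ≤ Real.exp (N * M) * Real.exp (N * T k) := by
    rw [← Real.exp_nat_mul, ← Real.exp_add]
    apply Real.exp_le_exp.2
    have : (0 : ℝ) ≤ N := N.cast_nonneg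
    nlinarith
  have h7 : Real.exp (N * T k) * Real.exp ((A - |(k : ℝ)|) * T k) ≤ Real.exp K := by
    rw [← Real.exp_add]
    apply Real.exp_le_exp.2
    refine le_trans ?_ (hK k)
    nlinarith [mul_nonneg hA0' hn]
  have h8 : Real.exp (N * T k) * Real.exp ((A' - |(k : ℝ)|) * T k) ≤ Real.exp K := by
    rw [← Real.exp_add]
    apply Real.exp_le_exp.2
    refine le_trans ?_ (hK k)
    nlinarith [mul_nonneg hA0 hn]
  rw [OM_insert hi, mul_pow, om, mul_pow]
  set f := ‖FT i (G k) z‖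
  have hf : 0 ≤ f := norm_nonneg _
  set O := OM S z ^ N
  set y := ‖zz i z‖ ^ N
  calc f * ((1 + ‖z i‖) ^ N * Real.exp |(z i).im| ^ N * O)
      ≤ f * ((2 ^ (N - 1) * (1 + y)) * (Real.exp (N * M) * Real.exp (N * T k)) * O) := by gcongr
    _ = 2 ^ (N - 1) * Real.exp (N * M) * (Real.exp (N * T k) * (f * O) +
        Real.exp (N * T k) * (y * f * O)) := by ring
    _ ≤ 2 ^ (N - 1) * Real.exp (N * M) * (Real.exp (N * T k) * (C * Real.exp ((A - |(k : ℝ)|) * T k)) +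
        Real.exp (N * T k) * (C' * Real.exp ((A' - |(k : ℝ)|) * T k))) := by gcongr
    _ = 2 ^ (N - 1) * Real.exp (N * M) * (C * (Real.exp (N * T k) * Real.exp ((A - |(k : ℝ)|) * T k)) +
        C' * (Real.exp (N * T k) * Real.exp ((A' - |(k : ℝ)|) * T k))) := by ring
    _ ≤ 2 ^ (N - 1) * Real.exp (N * M) * (C * Real.exp K + C' * Real.exp K) := by gcongr
    _ = _ := by ring

lemma FT_isG {S : Finset (Fin n)} {i : Fin n} (hi : i ∉ S) {M : ℝ} (hM : 0 ≤ M) {T t : ℤ → ℝ}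
    (hT : HT M T t) {G : ℤ → V n → ℂ} (hG : GG S i T G) :
    IsG (BdT (insert i S) i M t) (fun k => FT i (G k)) := by
  refine coind' _ {F | ∃ G, GG S i T G ∧ F = fun k => FT i (G k)} ?_ ?_ ?_ ⟨G, hG, rfl⟩
  · rintro _ ⟨G, hG, rfl⟩ k; exact (FT_D (hG.PP k)).1
  · rintro _ ⟨G, hG, rfl⟩; exact FT_bound hi hM hT hG
  · rintro _ ⟨G, hG, rfl⟩ b
    refine Submodule.subset_span ⟨_, GG_Fder hT hG b, ?_⟩
    funext k
    exact (FT_D (hG.PP k)).2 b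

/-- sum of a family with supports in separated strips -/
def Wsum (F : ℤ → V n → ℂ) (z : V n) : ℂ := ∑' k, F k z

/-- strip support -/
def SP (i : Fin n) (M : ℝ) (t : ℤ → ℝ) (F : ℤ → V n → ℂ) : Prop :=
  ∀ k z, F k z ≠ 0 → |(z i).im - t k| ≤ M

lemma closed_strip (i : Fin n) (a M : ℝ) : IsClosed {z : V n | |(z i).im - a| ≤ M} := by
  refine isClosed_le ?_ continuous_const
  fun_prop

lemma SP_D {i : Fin n} {M : ℝ} {t : ℤ → ℝ} {F : ℤ → V n → ℂ} (h : SP i M t F)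
    (b : Fin n × Bool) : SP i M t (DF b F) := by
  intro k z hz
  by_contra hn
  exact hz (DF_congr_support (closed_strip i (t k) M) (fun w hw => by
    by_contra h0; exact hw (h k w h0)) z hn)

lemma HT_uniq {M : ℝ} {T t : ℤ → ℝ} (hT : HT M T t) (η : ℝ) :
    ∃ k, ∀ l, l ≠ k → M + 1 < |η - t l| := by
  by_cases h : ∃ k, |η - t k| ≤ M + 1
  · obtain ⟨k, hk⟩ := h
    refine ⟨k, fun l hl => ?_⟩
    have h1 := hT.sep l k hl
    have h2 : |t l - t k| ≤ |η - t l| + |η - t k| := by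
      have : t l - t k = -(η - t l) + (η - t k) := by ring
      rw [this]
      exact (abs_add_le _ _).trans (by rw [abs_neg])
    linarith
  · push Not at h
    exact ⟨0, fun l _ => h l⟩

lemma Wsum_eq {i : Fin n} {M : ℝ} {t : ℤ → ℝ} {F : ℤ → V n → ℂ}
    (hF : SP i M t F) {z : V n} {k : ℤ} (hk : ∀ l, l ≠ k → M < |(z i).im - t l|) :
    Wsum F z = F k z := by
  refine tsum_eq_single k fun l hl => ?_
  by_contra h0
  exact absurd (hF l z h0) (not_le.2 (hk l hl))

lemma Wsum_loc {i : Fin n} {M : ℝ} {T t : ℤ → ℝ} (hT : HT M T t) (z : V n) :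
    ∃ k, ∀ F : ℤ → V n → ℂ, SP i M t F → Wsum F =ᶠ[nhds z] F k := by
  obtain ⟨k, hk⟩ := HT_uniq hT (z i).im
  refine ⟨k, fun F hF => ?_⟩
  have hU : {w : V n | |(w i).im - (z i).im| < 1} ∈ nhds z := by
    refine IsOpen.mem_nhds (isOpen_lt (by fun_prop) continuous_const) (by simp)
  filter_upwards [hU] with w hw
  refine Wsum_eq hF fun l hl => ?_
  have h1 := hk l hl
  have h2 : |(z i).im - t l| ≤ |(w i).im - (z i).im| + |(w i).im - t l| := by
    have : (z i).im - t l = -((w i).im - (z i).im) + ((w i).im - t l) := by ring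
    rw [this]
    exact (abs_add_le _ _).trans (by rw [abs_neg])
  have h3 : |(w i).im - (z i).im| < 1 := hw
  linarith

lemma Wsum_D {i : Fin n} {M : ℝ} {T t : ℤ → ℝ} (hT : HT M T t) {F : ℤ → V n → ℂ}
    (hF : SP i M t F) (hd : ∀ k, Differentiable ℝ (F k)) :
    Differentiable ℝ (Wsum F) ∧ ∀ b, D b (Wsum F) = Wsum (DF b F) := by
  constructor
  · intro z
    obtain ⟨k, hk⟩ := Wsum_loc (i := i) hT z
    exact (hk F hF).differentiableAt_iff.2 (hd k z)
  · intro b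
    funext z
    obtain ⟨k, hk⟩ := Wsum_loc (i := i) hT z
    rw [(hk _ (SP_D hF b)).eq_of_nhds]
    simp only [D, (hk F hF).fderiv_eq]
    rfl

lemma Wsum_mem {S : Finset (Fin n)} {i : Fin n} {M : ℝ} {T t : ℤ → ℝ} (hT : HT M T t)
    {F : ℤ → V n → ℂ} (hF : SP i M t F) (hG : IsG (BdT S i M t) F) (hI : ∀ k, Ind S (F k)) :
    Wsum F ∈ SS S := by
  refine ⟨coind' _ {H | ∃ F, SP i M t F ∧ IsG (BdT S i M t) F ∧ H = fun _ => Wsum F} ?_ ?_ ?_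
    ⟨F, hF, hG, rfl⟩, ?_⟩
  · rintro _ ⟨F, hF, hG, rfl⟩ _
    exact (Wsum_D hT hF hG.diff).1
  · rintro _ ⟨F, hF, hG, rfl⟩ N
    obtain ⟨C, hC⟩ := hG.mem N
    refine ⟨|C|, fun _ z hz => ?_⟩
    obtain ⟨k, hk⟩ := Wsum_loc (i := i) hT z
    show ‖Wsum F z‖ * _ ≤ _
    rw [(hk F hF).eq_of_nhds]
    by_cases h0 : F k z = 0
    · simp [h0]
    · exact (hC k z (hF k z h0) hz).trans (le_abs_self C)
  · rintro _ ⟨F, hF, hG, rfl⟩ b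
    refine Submodule.subset_span ⟨DF b F, SP_D hF b, hG.DF b, ?_⟩
    funext _
    exact (Wsum_D hT hF hG.diff).2 b
  · intro z w h1 h2
    unfold Wsum
    congr 1
    funext k
    exact hI k z w h1 h2

end MP
end MPsec12

noncomputable section MPsec13
namespace MP
open scoped ContDiff
open Complex MeasureTheory
variable {n : ℕ} {ι : Type}

lemma exists_T {M : ℝ} (hM : 0 ≤ M) (B : ℕ → ℤ → ℝ) : ∃ T t : ℤ → ℝ, HT M T t ∧
    ∀ (c : ℕ) (k : ℤ), c ≤ k.natAbs → B c k ≤ T k := by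
  set R : ℕ → ℝ := fun j => 2 * Real.pi * (M * (j + 1)) + j + (2 * M + 3) +
    ∑ c ∈ Finset.range (j + 1), (|B c j| + |B c (-j)|) with hR
  have hpi := Real.pi_pos
  have hs0 : ∀ j : ℕ, 0 ≤ ∑ c ∈ Finset.range (j + 1), (|B c j| + |B c (-j)|) := fun j =>
    Finset.sum_nonneg fun c _ => by positivity
  have hq0 : ∀ j : ℕ, 0 ≤ 2 * Real.pi * (M * ((j : ℝ) + 1)) := fun j => by positivity
  have hR1 : ∀ j, 2 * M + 3 ≤ R j := by
    intro j
    have := hs0 j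
    have := hq0 j
    have : (0 : ℝ) ≤ j := j.cast_nonneg
    simp only [hR]; linarith
  have hR0 : ∀ j, 0 ≤ R j := fun j => by have := hR1 j; linarith
  set τ : ℕ → ℝ := fun j => ∑ i ∈ Finset.range (j + 1), R i with hτ
  have hτR : ∀ j, R j ≤ τ j := fun j =>
    Finset.single_le_sum (f := R) (fun i _ => hR0 i) (Finset.self_mem_range_succ j)
  have hstep : ∀ a b, a < b → τ a + (2 * M + 3) ≤ τ b := by
    intro a b hab
    have h1 : τ (a + 1) ≤ τ b := Finset.sum_le_sum_of_subset_of_nonneg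
      (Finset.range_mono (by omega)) fun i _ _ => hR0 i
    have h2 : τ (a + 1) = τ a + R (a + 1) := Finset.sum_range_succ _ _
    have := hR1 (a + 1)
    linarith
  have hsep : ∀ a b, a ≠ b → 2 * M + 2 < |τ a - τ b| := by
    intro a b hab
    rcases lt_or_gt_of_ne hab with h | h
    · have := hstep a b h
      rw [abs_sub_comm]
      exact lt_of_lt_of_le (by linarith) (le_abs_self _)
    · have := hstep b a h
      exact lt_of_lt_of_le (by linarith) (le_abs_self _)
  have hpos : ∀ a, 2 * M + 3 ≤ τ a := fun a => (hR1 a).trans (hτR a)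
  have habs : ∀ k : ℤ, |(k : ℝ)| = (k.natAbs : ℝ) := fun k => by
    rw [Nat.cast_natAbs]; push_cast; rfl
  refine ⟨fun k => τ k.natAbs, fun k => if 0 < k then - τ k.natAbs else if k < 0 then τ k.natAbs
    else 0, ⟨?_, ?_, ?_, ?_, ?_, ?_, ?_⟩, ?_⟩
  · intro k; have := hpos k.natAbs; linarith
  · intro k
    rw [habs]
    refine le_trans ?_ (hτR _)
    have := hs0 k.natAbs
    have : (0 : ℝ) ≤ k.natAbs := Nat.cast_nonneg _
    simp only [hR]; linarith
  · intro k
    rw [habs]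
    refine le_trans ?_ (hτR _)
    have := hs0 k.natAbs
    have := hq0 k.natAbs
    simp only [hR]; linarith
  · intro k hk; simp [hk]
  · intro k hk; simp [hk, hk.le]
  · simp
  · intro k l hkl
    have h1 := hpos k.natAbs
    have h2 := hpos l.natAbs
    rcases lt_trichotomy k 0 with hk | hk | hk <;> rcases lt_trichotomy l 0 with hl | hl | hl
    · simp only [hk, hl, not_lt.2 hk.le, not_lt.2 hl.le, if_true, if_false]
      exact hsep _ _ (by omega)
    · simp only [hk, not_lt.2 hk.le, hl, lt_irrefl, if_true, if_false]
      exact lt_of_lt_of_le (by linarith) (le_abs_self _)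
    · simp only [hk, hl, not_lt.2 hk.le, if_true, if_false]
      exact lt_of_lt_of_le (by linarith) (le_abs_self _)
    · simp only [hk, hl, not_lt.2 hl.le, lt_irrefl, if_true, if_false]
      rw [abs_sub_comm]
      exact lt_of_lt_of_le (by linarith) (le_abs_self _)
    · omega
    · simp only [hk, hl, lt_irrefl, if_true, if_false]
      exact lt_of_lt_of_le (by linarith) (le_abs_self _)
    · simp only [hk, hl, not_lt.2 hl.le, if_true, if_false]
      rw [abs_sub_comm]
      exact lt_of_lt_of_le (by linarith) (le_abs_self _)
    · simp only [hk, hl, lt_irrefl, if_true, if_false]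
      rw [abs_sub_comm]
      exact lt_of_lt_of_le (by linarith) (le_abs_self _)
    · simp only [hk, hl, if_true]
      have := hsep l.natAbs k.natAbs (by omega)
      have e : -τ k.natAbs - -τ l.natAbs = τ l.natAbs - τ k.natAbs := by ring
      rwa [e]
  · intro c k hck
    refine le_trans ?_ (hτR _)
    have h0 := hq0 k.natAbs
    have h1 : (0 : ℝ) ≤ k.natAbs := Nat.cast_nonneg _
    have h2 := Finset.single_le_sum (f := fun c => |B c k.natAbs| + |B c (-k.natAbs)|)
      (fun c _ => by positivity) (Finset.mem_range.2 (Nat.lt_succ_of_le hck))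
    have h3 : B c k ≤ |B c k.natAbs| + |B c (-k.natAbs)| := by
      rcases Int.natAbs_eq k with h | h
      · conv_lhs => rw [h]
        have := le_abs_self (B c k.natAbs)
        have := abs_nonneg (B c (-k.natAbs))
        linarith
      · conv_lhs => rw [h]
        have := abs_nonneg (B c k.natAbs)
        have := le_abs_self (B c (-k.natAbs))
        linarith
    have h4 := h3.trans h2
    simp only [hR]
    linarith

/-- partition of unity -/
def chi (s : ℝ) : ℂ := ((Real.smoothTransition (s + 1) - Real.smoothTransition s : ℝ) : ℂ)

lemma chi_smooth : ContDiff ℝ ∞ chi := by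
  have h : ContDiff ℝ ∞ Real.smoothTransition := Real.smoothTransition.contDiff
  refine Complex.ofRealCLM.contDiff.comp ?_
  exact (h.comp (contDiff_id.add contDiff_const)).sub h

lemma chi_supp {s : ℝ} (h : chi s ≠ 0) : -1 < s ∧ s < 1 := by
  constructor
  · by_contra hn
    apply h
    unfold chi
    rw [Real.smoothTransition.zero_of_nonpos (by linarith), Real.smoothTransition.zero_of_nonpos (by linarith)]
    simp
  · by_contra hn
    apply h
    unfold chi
    rw [Real.smoothTransition.one_of_one_le (by linarith), Real.smoothTransition.one_of_one_le (by linarith)]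
    simp

lemma chi_cs : HasCompactSupport chi := by
  refine HasCompactSupport.intro (isCompact_Icc (a := (-1 : ℝ)) (b := 1)) fun s hs => ?_
  by_contra h
  exact hs ⟨(chi_supp h).1.le, (chi_supp h).2.le⟩

lemma chi_sum (x : ℝ) : chi (x - (⌊x⌋ : ℤ)) + chi (x - ((⌊x⌋ + 1 : ℤ) : ℝ)) = 1 := by
  have h1 := Int.floor_le x
  have h2 := Int.lt_floor_add_one x
  unfold chi
  push_cast
  rw [Real.smoothTransition.one_of_one_le (x := x - ⌊x⌋ + 1) (by linarith),
    Real.smoothTransition.zero_of_nonpos (x := x - (⌊x⌋ + 1)) (by linarith)]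
  have : x - ((⌊x⌋ : ℝ) + 1) + 1 = x - ⌊x⌋ := by ring
  rw [this]
  push_cast
  ring

lemma chi_out {x : ℝ} {k : ℤ} (h : chi (x - k) ≠ 0) : k = ⌊x⌋ ∨ k = ⌊x⌋ + 1 := by
  have h1 := Int.floor_le x
  have h2 := Int.lt_floor_add_one x
  obtain ⟨h3, h4⟩ := chi_supp h
  have h5 : (⌊x⌋ : ℝ) < k + 1 := by linarith
  have h6 : (k : ℝ) < ⌊x⌋ + 2 := by linarith
  have h5' : ⌊x⌋ < k + 1 := by exact_mod_cast h5
  have h6' : k < ⌊x⌋ + 2 := by exact_mod_cast h6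
  omega

lemma isG_bumpRe {S : Finset (Fin n)} {c : ℝ → ℂ} (hc : ContDiff ℝ ∞ c) (hcs : HasCompactSupport c)
    (i : Fin n) (s : ι → ℝ) : IsG (MuB ι S) (fun k z => c ((z i).re - s k)) := by
  refine coind' _ {F | ∃ c : ℝ → ℂ, ContDiff ℝ ∞ c ∧ HasCompactSupport c ∧
    F = fun k z => c ((z i).re - s k)} ?_ ?_ ?_ ⟨c, hc, hcs, rfl⟩
  · rintro _ ⟨c, hc, hcs, rfl⟩ k
    have h1 : Differentiable ℝ (fun z : V n => (z i).re - s k) :=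
      ((Complex.reCLM.comp (coordL i)).differentiable).sub_const _
    exact (hc.differentiable (by simp)).comp h1
  · rintro _ ⟨c, hc, hcs, rfl⟩ N
    obtain ⟨C, hC⟩ := hcs.exists_bound_of_continuous hc.continuous
    exact ⟨C, 0, fun k z _ => by simpa using hC _⟩
  · rintro _ ⟨c, hc, hcs, rfl⟩ b
    have e : DF b (fun (k : ι) (z : V n) => c ((z i).re - s k)) =
        ((bv b i).re : ℂ) • (fun k z => deriv c ((z i).re - s k)) := by
      funext k z
      have h1 : HasFDerivAt (fun z : V n => (z i).re - s k) (Complex.reCLM.comp (coordL i)) z :=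
        ((Complex.reCLM.comp (coordL i)).hasFDerivAt).sub_const _
      have h2 := ((hc.differentiable (by simp)) ((z i).re - s k)).hasFDerivAt.comp z h1
      show fderiv ℝ (c ∘ fun z : V n => (z i).re - s k) z (bv b) = _
      rw [h2.fderiv]
      simp
    rw [e]
    refine Submodule.smul_mem _ _ (Submodule.subset_span ⟨_, ?_, hcs.deriv, rfl⟩)
    exact ((contDiff_infty_iff_deriv.1 hc).2)

/-- slab cutoffs -/
def chF (i : Fin n) (k : ℤ) : V n → ℂ := fun z => chi ((z i).re - k)

lemma Mu_chF (S : Finset (Fin n)) (i : Fin n) (k : ℤ) : Mu S (chF i k) :=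
  ⟨isG_bumpRe (ι := Unit) chi_smooth chi_cs i fun _ => (k : ℝ), fun z w _ h2 => by simp [chF, h2 i]⟩

lemma D_chF {i : Fin n} {b : Fin n × Bool} (hb : b.1 ≠ i) (k : ℤ) : D b (chF i k) = 0 := by
  funext z
  have h1 : HasFDerivAt (fun z : V n => (z i).re - k) (Complex.reCLM.comp (coordL i)) z :=
    ((Complex.reCLM.comp (coordL i)).hasFDerivAt).sub_const _
  have h2 := ((chi_smooth.differentiable (by simp)) ((z i).re - k)).hasFDerivAt.comp z h1
  show fderiv ℝ (chi ∘ fun z : V n => (z i).re - k) z (bv b) = _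
  rw [h2.fderiv]
  simp [bv, Ne.symm hb]

/-- slab pieces -/
def Gp (i : Fin n) (g : V n → ℂ) : ℤ → V n → ℂ := fun k => chF i k * g

lemma Gp_mem {S : Finset (Fin n)} {g : V n → ℂ} (hg : g ∈ SS S) (i : Fin n) (k : ℤ) :
    Gp i g k ∈ SS S := SS.mul (Mu_chF S i k) hg

lemma Gp_supp (i : Fin n) (g : V n → ℂ) (k : ℤ) (z : V n) (h : Gp i g k z ≠ 0) :
    |(z i).re - k| ≤ 1 := by
  obtain ⟨h1, h2⟩ := chi_supp (left_ne_zero_of_mul h)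
  exact abs_le.2 ⟨h1.le, h2.le⟩

lemma DL_apply (l : List (Fin n × Bool)) (F : ι → V n → ℂ) (k : ι) :
    DL l F k = DL l (fun _ : Unit => F k) () := by
  induction l generalizing F with
  | nil => rfl
  | cons b l ih => exact ih (DF b F)

lemma exists_heights {S : Finset (Fin n)} {M : ℝ} (hM : 0 ≤ M) {g : V n → ℂ} (hg : g ∈ SS S)
    (i : Fin n) : ∃ T t : ℤ → ℝ, HT M T t ∧ GG S i T (Gp i g) := by
  have hB : ∀ (p : List (Fin n × Bool) × ℕ) (k : ℤ), ∃ C : ℝ, ∀ z, |(z i).re - (k : ℝ)| ≤ (1 : ℝ) →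
      (∀ j, j ∉ S → j ≠ i → |(z j).re| ≤ (p.2 : ℝ)) →
      ‖DL p.1 (Gp i g) k z‖ * OM S z ^ p.2 ≤ C := by
    rintro ⟨l, N⟩ k
    obtain ⟨C, hC⟩ := ((Gp_mem hg i k).1 l).2 (N + k.natAbs + 1)
    refine ⟨C, fun z hk hz => ?_⟩
    rw [DL_apply]
    have habs : |(k : ℝ)| = (k.natAbs : ℝ) := by rw [Nat.cast_natAbs]; push_cast; rfl
    refine le_trans ?_ (hC () z fun j hj => ?_)
    · exact mul_le_mul_of_nonneg_left (pow_le_pow_right₀ (one_le_OM S z) (by simp; omega))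
        (norm_nonneg _)
    · push_cast
      by_cases hji : j = i
      · subst hji
        have h3 : |(z j).re| ≤ |(z j).re - k| + |(k : ℝ)| := by
          have := abs_add_le ((z j).re - k) (k : ℝ); simpa using this
        rw [habs] at h3
        have : (0 : ℝ) ≤ N := N.cast_nonneg
        linarith
      · have h3 := hz j hj hji
        have : (0 : ℝ) ≤ k.natAbs := Nat.cast_nonneg _
        simp only at h3
        linarith
  choose B hB using hB
  set B' : ℕ → ℤ → ℝ := fun c k => match Encodable.decode (α := List (Fin n × Bool) × ℕ) c with
    | none => 0
    | some p => B p k with hB'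
  obtain ⟨T, t, hT, hBT⟩ := exists_T hM B'
  refine ⟨T, t, hT, fun l => ⟨fun k => ?_, fun N => ?_⟩, Gp_supp i g⟩
  · rw [DL_apply]
    exact ((Gp_mem hg i k).1 l).1 ()
  · set c := Encodable.encode (l, N) with hc
    have hBc : ∀ k, B' c k = B (l, N) k := by
      intro k; simp [hB', hc]
    set Q : ℝ := ∑ k ∈ Finset.Icc (-(c : ℤ)) c, |B' c k| with hQ
    have hQ0 : 0 ≤ Q := Finset.sum_nonneg fun k _ => abs_nonneg _
    refine ⟨1 + Q, by positivity, 1, zero_le_one, fun k z hk hz => ?_⟩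
    refine (hB (l, N) k z hk hz).trans ?_
    rw [← hBc, one_mul, abs_of_nonneg (hT.nn k)]
    have h1 := Real.add_one_le_exp (T k)
    have h2 := hT.nn k
    by_cases hck : c ≤ k.natAbs
    · have := hBT c k hck
      nlinarith
    · have h3 := Finset.single_le_sum (f := fun k => |B' c k|) (fun k _ => abs_nonneg _)
        (show k ∈ Finset.Icc (-(c : ℤ)) c by rw [Finset.mem_Icc]; omega)
      have h4 := le_abs_self (B' c k)
      nlinarith

end MP
end MPsec13

noncomputable section MPsec14
namespace MP
open scoped ContDiff
open Complex MeasureTheory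
variable {n : ℕ} {ι : Type}

lemma D_eq_zero_of_inv {f : V n → ℂ} (b : Fin n × Bool) (h : ∀ z (s : ℝ), f (z + s • bv b) = f z) :
    D b f = 0 := by
  funext z
  by_cases hd : DifferentiableAt ℝ f z
  · unfold MP.D
    rw [← hd.lineDeriv_eq_fderiv]
    unfold lineDeriv
    simp [h]
  · unfold MP.D
    rw [fderiv_zero_of_not_differentiableAt hd]; rfl

lemma FT_add {i : Fin n} {k : ℤ} {f g : V n → ℂ} (hf : PP i k f) (hg : PP i k g) :
    FT i (f + g) = FT i f + FT i g := by
  funext z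
  simp only [FT, Pi.add_apply]
  rw [← integral_add (FTi_int hf z) (FTi_int hg z)]
  congr 1; funext s
  simp [FTi, mul_add]

lemma FT_smul {i : Fin n} {f : V n → ℂ} (c : ℂ) :
    FT i (c • f) = c • FT i f := by
  funext z
  simp only [FT, Pi.smul_apply, smul_eq_mul]
  rw [← integral_const_mul]
  congr 1; funext s
  simp [FTi]; ring

lemma FT_zz {i j : Fin n} (hj : j ≠ i) (f : V n → ℂ) :
    FT i (zz j * f) = zz j * FT i f := by
  funext z
  simp only [FT, Pi.mul_apply]
  rw [← integral_const_mul]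
  congr 1; funext s
  simp [FTi, zz, hj]; ring

lemma FT_Ind {S : Finset (Fin n)} {i : Fin n} {f : V n → ℂ} (h : Ind S f) :
    Ind (insert i S) (FT i f) := by
  intro z w h1 h2
  unfold FT
  congr 1; funext s
  unfold FTi
  rw [h1 i (Finset.mem_insert_self _ _)]
  congr 1
  refine h _ _ (fun j hj => ?_) (fun j => ?_)
  · by_cases hji : j = i
    · subst hji; simp
    · simp [hji, h1 j (Finset.mem_insert_of_mem hj)]
  · by_cases hji : j = i
    · subst hji; simp
    · simp [hji, h2 j]

/-- admissible functions for heights `T` -/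
def NT (S : Finset (Fin n)) (i : Fin n) (T : ℤ → ℝ) : Submodule ℂ (SS S) where
  carrier := {g | GG S i T (Gp i g.1)}
  zero_mem' := by
    have : Gp i (0 : V n → ℂ) = 0 := by funext k; simp [Gp]
    refine ⟨?_, ?_⟩
    · show IsG _ (Gp i (0 : V n → ℂ))
      rw [this]; exact (Gm _).zero_mem
    · intro k z h; exact absurd (by simp [Gp]) h
  add_mem' := by
    intro f g hf hg
    refine ⟨?_, fun k z h => Gp_supp i _ k z h⟩
    have : Gp i (f + g).1 = Gp i f.1 + Gp i g.1 := by funext k; simp [Gp, mul_add]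
    rw [this]; exact hf.1.add hg.1
  smul_mem' := by
    intro c g hg
    refine ⟨?_, fun k z h => Gp_supp i _ k z h⟩
    have : Gp i (c • g).1 = c • Gp i g.1 := by funext k; simp [Gp]
    rw [this]; exact hg.1.smul c

/-- the lifted sum -/
def WW (i : Fin n) (A : ℤ → V n → ℂ) (g : V n → ℂ) : V n → ℂ :=
  Wsum (A * fun k => FT i (Gp i g k))

lemma SP_mul {i : Fin n} {M : ℝ} {t : ℤ → ℝ} {A F : ℤ → V n → ℂ} (h : SP i M t A) :
    SP i M t (A * F) := fun k z hz => h k z (left_ne_zero_of_mul hz)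

lemma Wsum_add {i : Fin n} {M : ℝ} {T t : ℤ → ℝ} (hT : HT M T t) {F G : ℤ → V n → ℂ}
    (hF : SP i M t F) (hG : SP i M t G) : Wsum (F + G) = Wsum F + Wsum G := by
  funext z
  obtain ⟨k, hk⟩ := HT_uniq hT (z i).im
  have hk' : ∀ l, l ≠ k → M < |(z i).im - t l| := fun l hl => by linarith [hk l hl]
  have hFG : SP i M t (F + G) := by
    intro k z hz
    by_cases h : F k z = 0
    · exact hG k z (fun h' => hz (by simp [h, h']))
    · exact hF k z h
  rw [Pi.add_apply, Wsum_eq hF hk', Wsum_eq hG hk', Wsum_eq hFG hk']; rfl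

lemma Wsum_mul_left (P : V n → ℂ) (F : ℤ → V n → ℂ) : P * Wsum F = Wsum (fun k => P * F k) := by
  funext z
  simp only [Wsum, Pi.mul_apply]
  rw [tsum_mul_left]

lemma WW_mem {S : Finset (Fin n)} {i : Fin n} (hi : i ∉ S) {M : ℝ} (hM : 0 ≤ M) {T t : ℤ → ℝ}
    (hT : HT M T t) {A : ℤ → V n → ℂ} (hA : IsG (MuB ℤ (insert i S)) A) (hs : SP i M t A)
    (hAI : ∀ k z w, (∀ j ∈ insert i S, z j = w j) → A k z = A k w) {g : V n → ℂ}
    (hg : g ∈ SS S) (hG : GG S i T (Gp i g)) : WW i A g ∈ SS (insert i S) := by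
  refine Wsum_mem hT (SP_mul hs) (hA.mul MuB_mul_BdT (FT_isG hi hM hT hG)) fun k => ?_
  refine Ind.mul (fun z w h _ => hAI k z w h) (FT_Ind (Gp_mem hg i k).2)

/-- the lifting operator -/
def We {S : Finset (Fin n)} {i : Fin n} (hi : i ∉ S) {M : ℝ} (hM : 0 ≤ M) {T t : ℤ → ℝ}
    (hT : HT M T t) {A : ℤ → V n → ℂ} (hA : IsG (MuB ℤ (insert i S)) A) (hs : SP i M t A)
    (hAI : ∀ k z w, (∀ j ∈ insert i S, z j = w j) → A k z = A k w) :
    NT S i T →ₗ[ℂ] SS (insert i S) where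
  toFun g := ⟨WW i A g.1.1, WW_mem hi hM hT hA hs hAI g.1.2 g.2⟩
  map_add' f g := by
    apply Subtype.ext
    show WW i A (f.1.1 + g.1.1) = WW i A f.1.1 + WW i A g.1.1
    unfold WW
    rw [← Wsum_add hT (SP_mul hs) (SP_mul hs)]
    congr 1
    funext k
    have : Gp i (f.1.1 + g.1.1) k = Gp i f.1.1 k + Gp i g.1.1 k := by simp [Gp, mul_add]
    simp only [Pi.mul_apply, Pi.add_apply]
    rw [this, FT_add (f.2.PP k) (g.2.PP k), mul_add]
  map_smul' c g := by
    apply Subtype.ext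
    show WW i A (c • g.1.1) = c • WW i A g.1.1
    unfold WW
    have h1 : ∀ f : V n → ℂ, c • f = (fun _ => c) * f := fun f => by funext z; simp
    rw [h1 (Wsum _), Wsum_mul_left]
    congr 1
    funext k
    have : Gp i (c • g.1.1) k = c • Gp i g.1.1 k := by simp [Gp]
    rw [Pi.mul_apply, this, FT_smul, ← h1]
    simp

lemma Gp_D {i : Fin n} {b : Fin n × Bool} (hb : b.1 ≠ i) {g : V n → ℂ} (hg : Differentiable ℝ g) :
    Gp i (D b g) = DF b (Gp i g) := by
  funext k
  show _ = D b (chF i k * g)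
  rw [D_mul ((Mu_chF ∅ i k).1.diff ()) hg, D_chF hb k]
  simp [Gp]

lemma Gp_zz (i j : Fin n) (g : V n → ℂ) :
    Gp i (zz j * g) = (fun _ => zz j) * Gp i g := by
  funext k
  simp only [Gp, Pi.mul_apply]; ring

lemma NT_Xe {S : Finset (Fin n)} {i j : Fin n} (hj : j ≠ i) {T : ℤ → ℝ} {g : SS S}
    (hg : g ∈ NT S i T) : Xe S j g ∈ NT S i T := by
  show GG S i T (Gp i (XO S j g.1))
  unfold XO
  split_ifs with h
  · refine ⟨?_, fun k z h => Gp_supp i _ k z h⟩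
    rw [Gp_zz]
    exact (MD_zz h).mul MD_mul_Dom hg.1
  · rw [Gp_D hj (SS.diff g.2)]
    exact GG_D hg _

lemma We_Xe {S : Finset (Fin n)} {i : Fin n} (hi : i ∉ S) {M : ℝ} (hM : 0 ≤ M) {T t : ℤ → ℝ}
    (hT : HT M T t) {A : ℤ → V n → ℂ} (hA : IsG (MuB ℤ (insert i S)) A) (hs : SP i M t A)
    (hAI : ∀ k z w, (∀ j ∈ insert i S, z j = w j) → A k z = A k w) {j : Fin n} (hj : j ≠ i)
    (g : NT S i T) : We hi hM hT hA hs hAI ⟨Xe S j g.1, NT_Xe hj g.2⟩ =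
      Xe (insert i S) j (We hi hM hT hA hs hAI g) := by
  apply Subtype.ext
  show WW i A (XO S j g.1.1) = XO (insert i S) j (WW i A g.1.1)
  by_cases h : j ∈ S
  · have h' : j ∈ insert i S := Finset.mem_insert_of_mem h
    simp only [XO, h, h', if_true]
    unfold WW
    rw [Wsum_mul_left, Gp_zz]
    congr 1; funext k
    simp only [Pi.mul_apply]
    rw [FT_zz hj]; ring
  · have h' : j ∉ insert i S := by simp [hj, h]
    simp only [XO, h, h', if_false]
    unfold WW
    have hd : ∀ k, Differentiable ℝ ((A * fun k => FT i (Gp i g.1.1 k)) k) := fun k =>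
      (hA.diff k).mul (FT_D (g.2.PP k)).1
    rw [(Wsum_D hT (SP_mul hs) hd).2, Gp_D hj (SS.diff g.1.2)]
    congr 1; funext k
    show A k * FT i (D (j, false) (Gp i g.1.1 k)) = D (j, false) (A k * FT i (Gp i g.1.1 k))
    rw [D_mul (hA.diff k) (FT_D (g.2.PP k)).1, (FT_D (g.2.PP k)).2]
    have h0 : D (j, false) (A k) = 0 := by
      refine D_eq_zero_of_inv _ fun z s => hAI k _ _ fun l hl => ?_
      have : l ≠ j := fun h => h' (h ▸ hl)
      simp [bv, this]
    rw [h0]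
    simp [Fder, hj]

lemma Lop_We {S : Finset (Fin n)} {i : Fin n} (hi : i ∉ S) {M : ℝ} {T t : ℤ → ℝ}
    (hT : HT M T t) {A Θ : ℤ → V n → ℂ} {P : V n → ℂ} (hs : SP i M t A)
    (hΘ : ∀ k z, A k z * P z = Θ k z)
    (hΘ1 : ∀ k z w, (∀ j ∈ S, z j = w j) → (z i).im = (w i).im → Θ k z = Θ k w)
    (hΘ2 : ∀ k z (ξ : ℝ), ∫ τ : ℝ, Θ k (Function.update z i (ξ + τ * I)) = 1)
    {g : V n → ℂ} (hg : g ∈ SS S) (hG : GG S i T (Gp i g))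
    (hm : P * WW i A g ∈ SS (insert i S)) : Lop i (P * WW i A g) = g := by
  have hsΘ : SP i M t Θ := fun k z h => hs k z (left_ne_zero_of_mul (by rw [hΘ]; exact h))
  have e1 : P * WW i A g = Wsum (Θ * fun k => FT i (Gp i g k)) := by
    unfold WW
    rw [Wsum_mul_left]
    congr 1; funext k; funext z
    simp only [Pi.mul_apply]
    rw [← hΘ]; ring
  rw [e1] at hm ⊢
  funext z
  set x : ℝ := (z i).re with hx
  set F := Wsum (Θ * fun k => FT i (Gp i g k)) with hF
  have hint := Lint_integrable hi hm z
  unfold Lop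
  have mp := (Complex.volume_preserving_equiv_real_prod.symm)
  rw [← mp.integral_comp (MeasurableEquiv.measurableEmbedding _) (fun ζ => Lint i F ζ z)]
  have hint2 := (mp.integrable_comp_emb (MeasurableEquiv.measurableEmbedding _)
    (g := fun ζ => Lint i F ζ z)).2 hint
  rw [Measure.volume_eq_prod] at hint2 ⊢
  refine (integral_prod_symm _ hint2).trans ?_
  simp only [Function.comp_apply]
  set θ : ℤ → ℝ → ℂ := fun k τ => Θ k (Function.update z i ((0 : ℝ) + τ * I)) with hθ
  have hGz : ∀ k, Gp i g k (Function.update z i (x : ℂ)) = chi (x - k) * g z := by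
    intro k
    simp only [Gp, chF, Pi.mul_apply, Function.update_self, ofReal_re]
    congr 1
    refine hg.2 _ _ (fun j hj => ?_) (fun j => ?_)
    · have : j ≠ i := fun h => hi (h ▸ hj)
      simp [this]
    · by_cases h : j = i
      · subst h; simp [hx]
      · simp [h]
  have hin : ∀ τ : ℝ, ∫ ξ : ℝ, Lint i F (Complex.measurableEquivRealProd.symm (ξ, τ)) z =
      θ ⌊x⌋ τ * (chi (x - ⌊x⌋) * g z) + θ (⌊x⌋ + 1) τ * (chi (x - (⌊x⌋ + 1 : ℤ)) * g z) := by
    intro τ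
    obtain ⟨k, hk⟩ := HT_uniq hT τ
    have hz0 : ∀ l, l ≠ k → θ l τ = 0 := by
      intro l hl
      by_contra h0
      have := hsΘ l _ h0
      simp at this
      linarith [hk l hl]
    have e2 : ∀ ξ : ℝ, Lint i F (Complex.measurableEquivRealProd.symm (ξ, τ)) z =
        θ k τ * (Complex.exp (2 * Real.pi * I * x * (ξ + τ * I)) *
          FT i (Gp i g k) (Function.update z i (ξ + τ * I))) := by
      intro ξ
      have e3 : Complex.measurableEquivRealProd.symm (ξ, τ) = (ξ + τ * I : ℂ) := by
        apply Complex.ext <;> simp [Complex.measurableEquivRealProd]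
      rw [e3]
      unfold Lint
      rw [hF, Wsum_eq (k := k) (SP_mul hsΘ) (by
        intro l hl
        have := hk l hl
        simp
        linarith)]
      simp only [Pi.mul_apply]
      rw [hΘ1 k (Function.update z i (ξ + τ * I)) (Function.update z i ((0 : ℝ) + τ * I))
        (fun j hj => by
          have : j ≠ i := fun h => hi (h ▸ hj)
          simp [this]) (by simp)]
      ring
    simp_rw [e2]
    rw [integral_const_mul, FT_inv (hG.PP k) z τ x, hGz]
    by_cases h1 : k = ⌊x⌋
    · subst h1
      rw [hz0 (⌊x⌋ + 1) (by omega)]; ring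
    · by_cases h2 : k = ⌊x⌋ + 1
      · subst h2
        rw [hz0 ⌊x⌋ (by omega)]; ring
      · rw [hz0 ⌊x⌋ (fun h => h1 h.symm), hz0 (⌊x⌋ + 1) (fun h => h2 h.symm)]
        have : chi (x - k) = 0 := by
          by_contra h; rcases chi_out h with h | h <;> contradiction
        rw [this]; ring
  have hθi : ∀ k, Integrable (θ k) := by
    intro k
    by_contra h
    have := hΘ2 k z 0
    rw [integral_undef h] at this
    exact zero_ne_one this
  rw [integral_congr_ae (Filter.Eventually.of_forall hin),
    integral_add ((hθi _).mul_const _) ((hθi _).mul_const _), integral_mul_const,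
    integral_mul_const, show ∫ τ, θ ⌊x⌋ τ = 1 from hΘ2 _ z 0,
    show ∫ τ, θ (⌊x⌋ + 1) τ = 1 from hΘ2 _ z 0, one_mul, one_mul, ← add_mul, chi_sum, one_mul]

theorem div_core {S : Finset (Fin n)} {i : Fin n} (hi : i ∉ S) {m : ℕ} (a : Fin m → V n → ℂ)
    (ha : ∀ r, IsG (MuB Unit (insert i S)) (fun _ => a r))
    (haS : ∀ r z w, (∀ j ∈ S, z j = w j) → a r z = a r w) (g : SS S) :
    ∃ (N : Submodule ℂ (SS S)) (W : N →ₗ[ℂ] SS (insert i S)), g ∈ N ∧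
      (∀ j, j ≠ i → ∀ f : N, ∃ h : Xe S j f.1 ∈ N, W ⟨Xe S j f.1, h⟩ = Xe (insert i S) j (W f)) ∧
      ∀ (f : N) (h : SS (insert i S)), h.1 = (fun z => hp (fun r => a r z) (zz i z)) * (W f).1 →
        Le S i hi h = f.1 := by
  have hM : (0 : ℝ) ≤ 4 * m + 1 := by positivity
  obtain ⟨T, t, hT, hG⟩ := exists_heights hM g.2 i
  obtain ⟨Θ, A, hA, hΘ, hs, hΘ1, hAI, hΘ2⟩ := theta hi a ha haS t
  refine ⟨NT S i T, We hi hM hT hA hs hAI, hG, fun j hj f => ⟨NT_Xe hj f.2,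
    We_Xe hi hM hT hA hs hAI hj f⟩, ?_⟩
  rintro f ⟨h, hh⟩ rfl
  apply Subtype.ext
  exact Lop_We hi hT hs hΘ hΘ1 hΘ2 f.1.2 f.2 hh

end MP
end MPsec14

noncomputable section MPsec15
namespace MP
open scoped ContDiff
open Complex MeasureTheory
variable {n : ℕ} {ι : Type}

lemma exists_act {N : Type*} [AddCommGroup N] [Module ℂ N] (X : Fin n → Module.End ℂ N)
    (h : ∀ j k, X j * X k = X k * X j) :
    ∃ α : MvPolynomial (Fin n) ℂ →ₐ[ℂ] Module.End ℂ N, ∀ j, α (MvPolynomial.X j) = X j := by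
  letI : CommRing (Algebra.adjoin ℂ (Set.range X)) :=
    Algebra.adjoinCommRingOfComm ℂ (s := Set.range X) (by
      rintro _ ⟨j, rfl⟩ _ ⟨k, rfl⟩; exact h j k)
  refine ⟨(Algebra.adjoin ℂ (Set.range X)).val.comp
    (MvPolynomial.aeval fun j => ⟨X j, Algebra.subset_adjoin ⟨j, rfl⟩⟩), fun j => ?_⟩
  simp

/-- the action of polynomials -/
def act (S : Finset (Fin n)) : MvPolynomial (Fin n) ℂ →ₐ[ℂ] Module.End ℂ (SS S) :=
  (exists_act (Xe S) (Xe_comm S)).choose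

lemma act_X (S : Finset (Fin n)) (j : Fin n) : act S (MvPolynomial.X j) = Xe S j :=
  (exists_act (Xe S) (Xe_comm S)).choose_spec j

instance modSS (S : Finset (Fin n)) : Module (MvPolynomial (Fin n) ℂ) (SS S) :=
  Module.compHom _ (act S).toRingHom

lemma smul_def' (S : Finset (Fin n)) (p : MvPolynomial (Fin n) ℂ) (g : SS S) :
    p • g = act S p g := rfl

lemma X_smul (S : Finset (Fin n)) (j : Fin n) (g : SS S) :
    (MvPolynomial.X j : MvPolynomial (Fin n) ℂ) • g = Xe S j g := by
  rw [smul_def', act_X]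

lemma C_smul (S : Finset (Fin n)) (c : ℂ) (g : SS S) :
    (MvPolynomial.C c : MvPolynomial (Fin n) ℂ) • g = c • g := by
  rw [smul_def', ← MvPolynomial.algebraMap_eq, AlgHom.commutes]
  rfl

lemma map_smul_of {N N' : Type*} [AddCommGroup N] [AddCommGroup N']
    [Module (MvPolynomial (Fin n) ℂ) N] [Module (MvPolynomial (Fin n) ℂ) N'] (f : N →+ N')
    (hC : ∀ c x, f ((MvPolynomial.C c : MvPolynomial (Fin n) ℂ) • x) =
      (MvPolynomial.C c : MvPolynomial (Fin n) ℂ) • f x)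
    (hX : ∀ j x, f ((MvPolynomial.X j : MvPolynomial (Fin n) ℂ) • x) =
      (MvPolynomial.X j : MvPolynomial (Fin n) ℂ) • f x) (p : MvPolynomial (Fin n) ℂ) (x : N) :
    f (p • x) = p • f x := by
  induction p using MvPolynomial.induction_on generalizing x with
  | C c => exact hC c x
  | add p q hp hq => rw [add_smul, map_add, hp, hq, add_smul]
  | mul_X p j hp => rw [mul_smul, hp, hX, mul_smul]

/-- `Le` as a homomorphism of modules -/
def LeA (S : Finset (Fin n)) (i : Fin n) (hi : i ∉ S) :
    SS (insert i S) →ₗ[MvPolynomial (Fin n) ℂ] SS S where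
  toFun := Le S i hi
  map_add' := map_add _
  map_smul' := map_smul_of (Le S i hi).toAddMonoidHom
    (fun c x => by rw [C_smul, C_smul]; exact map_smul (Le S i hi) c x)
    (fun j x => by rw [X_smul, X_smul]; exact Le_Xe S i hi j x)

/-- `dbe` as a homomorphism of modules -/
def dbeA (S : Finset (Fin n)) (i : Fin n) :
    SS S →ₗ[MvPolynomial (Fin n) ℂ] SS S where
  toFun := dbe S i
  map_add' := map_add _
  map_smul' := map_smul_of (dbe S i).toAddMonoidHom
    (fun c x => by rw [C_smul, C_smul]; exact map_smul (dbe S i) c x)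
    (fun j x => by rw [X_smul, X_smul]; exact DFunLike.congr_fun (dbe_Xe S i j) x)

open MvPolynomial in
/-- evaluation at `2 π i z` -/
def evz (p : MvPolynomial (Fin n) ℂ) : V n → ℂ := fun z => eval (fun j => zz j z) p

lemma Mu_evz {S : Finset (Fin n)} {p : MvPolynomial (Fin n) ℂ}
    (hp : p ∈ MvPolynomial.supported ℂ (S : Set (Fin n))) : Mu S (evz p) := by
  refine Algebra.adjoin_induction (p := fun p _ => Mu S (evz p)) ?_ ?_ ?_ ?_ hp
  · rintro _ ⟨j, hj, rfl⟩
    have : evz (MvPolynomial.X j) = zz (n := n) j := by funext z; simp [evz]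
    rw [this]; exact Mu.zz hj
  · intro c
    have : evz (algebraMap ℂ (MvPolynomial (Fin n) ℂ) c) = fun _ => c := by
      funext z; simp [evz, MvPolynomial.algebraMap_eq]
    rw [this]; exact Mu.const S c
  · intro x y _ _ hx hy
    have : evz (x + y) = evz x + evz y := by funext z; simp [evz]
    rw [this]; exact hx.add hy
  · intro x y _ _ hx hy
    have : evz (x * y) = evz x * evz y := by funext z; simp [evz]
    rw [this]; exact hx.mul hy

lemma evz_congr {S : Finset (Fin n)} {p : MvPolynomial (Fin n) ℂ}
    (hp : p ∈ MvPolynomial.supported ℂ (S : Set (Fin n))) (z w : V n) (h : ∀ j ∈ S, z j = w j) :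
    evz p z = evz p w := by
  refine Algebra.adjoin_induction (p := fun p _ => evz p z = evz p w) ?_ ?_ ?_ ?_ hp
  · rintro _ ⟨j, hj, rfl⟩
    simp [evz, zz, h j hj]
  · intro c; simp [evz, MvPolynomial.algebraMap_eq]
  · intro x y _ _ hx hy
    simp only [evz, map_add] at *; rw [hx, hy]
  · intro x y _ _ hx hy
    simp only [evz, map_mul] at *; rw [hx, hy]

lemma smul_evz {S : Finset (Fin n)} {p : MvPolynomial (Fin n) ℂ}
    (hp : p ∈ MvPolynomial.supported ℂ (S : Set (Fin n))) (g : SS S) :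
    (p • g).1 = evz p * g.1 := by
  refine Algebra.adjoin_induction (p := fun p _ => ∀ g : SS S, (p • g).1 = evz p * g.1)
    ?_ ?_ ?_ ?_ hp g
  · rintro _ ⟨j, hj, rfl⟩ g
    have : evz (MvPolynomial.X j) = zz (n := n) j := by funext z; simp [evz]
    rw [this, X_smul]
    show XO S j g.1 = _
    simp only [XO]
    rw [if_pos (by exact_mod_cast hj)]
  · intro c g
    rw [MvPolynomial.algebraMap_eq, C_smul]
    funext z; simp [evz]
  · intro x y _ _ hx hy g
    have : evz (x + y) = evz x + evz y := by funext z; simp [evz]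
    rw [this, add_smul, Submodule.coe_add, hx, hy, add_mul]
  · intro x y _ _ hx hy g
    have : evz (x * y) = evz x * evz y := by funext z; simp [evz]
    rw [this, mul_smul, hx, hy, mul_assoc]

/-- the division lemma -/
theorem division {S : Finset (Fin n)} {i : Fin n} (hi : i ∉ S) {m : ℕ}
    (c : Fin m → MvPolynomial (Fin n) ℂ)
    (hc : ∀ r, c r ∈ MvPolynomial.supported ℂ (S : Set (Fin n))) (p : MvPolynomial (Fin n) ℂ)
    (hpc : p = MvPolynomial.X i ^ m + ∑ r : Fin m, c r * MvPolynomial.X i ^ (r : ℕ)) (g : SS S) :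
    ∃ μ : SS (insert i S), LeA S i hi (p • μ) = g ∧
      ∀ q ∈ MvPolynomial.supported ℂ ({i}ᶜ : Set (Fin n)), q • g = 0 → q • μ = 0 := by
  have hc' : ∀ r, c r ∈ MvPolynomial.supported ℂ ((insert i S : Finset (Fin n)) : Set (Fin n)) :=
    fun r => MvPolynomial.supported_mono (by simp) (hc r)
  have hXi : (MvPolynomial.X i : MvPolynomial (Fin n) ℂ) ∈
      MvPolynomial.supported ℂ ((insert i S : Finset (Fin n)) : Set (Fin n)) :=
    Algebra.subset_adjoin ⟨i, by simp, rfl⟩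
  have hpS : p ∈ MvPolynomial.supported ℂ ((insert i S : Finset (Fin n)) : Set (Fin n)) := by
    rw [hpc]
    exact add_mem (pow_mem hXi _) (sum_mem fun r _ => mul_mem (hc' r) (pow_mem hXi _))
  obtain ⟨N, W, hg, h1, h2⟩ := div_core hi (fun r => evz (c r)) (fun r => (Mu_evz (hc' r)).1)
    (fun r z w h => evz_congr (hc r) z w h) g
  refine ⟨W ⟨g, hg⟩, ?_, ?_⟩
  · refine h2 ⟨g, hg⟩ _ ?_
    rw [smul_evz hpS]
    congr 1
    funext z
    simp [hpc, evz, hp]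
  · intro q hq
    have key : ∀ f : N, ∃ h : q • f.1 ∈ N, W ⟨q • f.1, h⟩ = q • W f := by
      refine Algebra.adjoin_induction
        (p := fun q _ => ∀ f : N, ∃ h : q • f.1 ∈ N, W ⟨q • f.1, h⟩ = q • W f) ?_ ?_ ?_ ?_ hq
      · rintro _ ⟨j, hj, rfl⟩ f
        simp only [X_smul]
        exact h1 j hj f
      · intro c f
        simp only [MvPolynomial.algebraMap_eq, C_smul]
        exact ⟨N.smul_mem c f.2, map_smul W c f⟩
      · intro x y _ _ hx hy f
        obtain ⟨a1, a2⟩ := hx f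
        obtain ⟨b1, b2⟩ := hy f
        simp only [add_smul]
        refine ⟨N.add_mem a1 b1, ?_⟩
        rw [← a2, ← b2, ← map_add]; rfl
      · intro x y _ _ hx hy f
        obtain ⟨b1, b2⟩ := hy f
        obtain ⟨a1, a2⟩ := hx ⟨y • f.1, b1⟩
        simp only [mul_smul]
        exact ⟨a1, by rw [a2, b2]⟩
    intro h0
    obtain ⟨k1, k2⟩ := key ⟨g, hg⟩
    rw [← k2]
    have : (⟨q • g, k1⟩ : N) = 0 := Subtype.ext h0
    rw [this, map_zero]

section ladder
variable {A : Type*} [CommRing A]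

/-- successive surjectivity -/
def KS {N : Type*} [AddCommGroup N] [Module A N] : Submodule A N → List A → Prop
  | _, [] => True
  | U, q :: qs => (∀ v ∈ U, ∃ u ∈ U, q • u = v) ∧ KS (U ⊓ LinearMap.ker (LinearMap.lsmul A N q)) qs

variable {X Y Z : Type*} [AddCommGroup X] [AddCommGroup Y] [AddCommGroup Z] [Module A X]
  [Module A Y] [Module A Z]

lemma KS_ladder (a : X →ₗ[A] Y) (b : Y →ₗ[A] Z) (ha : Function.Injective a)
    (hab : ∀ x, b (a x) = 0) (qs : List A) (U : Submodule A X) (U' : Submodule A Y)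
    (U'' : Submodule A Z) (h1 : ∀ x ∈ U, a x ∈ U') (h2 : ∀ y ∈ U', b y ∈ U'')
    (h3 : ∀ y ∈ U', b y = 0 → ∃ x ∈ U, a x = y) (h4 : ∀ z ∈ U'', ∃ y ∈ U', b y = z)
    (hX : KS U qs) (hY : KS U' qs) : KS U'' qs := by
  induction qs generalizing U U' U'' with
  | nil => trivial
  | cons q qs ih =>
    obtain ⟨hX1, hX2⟩ := hX
    obtain ⟨hY1, hY2⟩ := hY
    refine ⟨fun v hv => ?_, ih _ _ _ ?_ ?_ ?_ ?_ hX2 hY2⟩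
    · obtain ⟨y, hy, rfl⟩ := h4 v hv
      obtain ⟨y', hy', rfl⟩ := hY1 y hy
      exact ⟨b y', h2 _ hy', (map_smul b q y').symm⟩
    · rintro x ⟨hx, hx'⟩
      refine ⟨h1 x hx, ?_⟩
      have : q • x = 0 := hx'
      show q • a x = 0
      rw [← map_smul, this, map_zero]
    · rintro y ⟨hy, hy'⟩
      refine ⟨h2 y hy, ?_⟩
      have : q • y = 0 := hy'
      show q • b y = 0
      rw [← map_smul, this, map_zero]
    · rintro y ⟨hy, hy'⟩ h0
      obtain ⟨x, hx, rfl⟩ := h3 y hy h0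
      refine ⟨x, ⟨hx, ?_⟩, rfl⟩
      have : q • a x = 0 := hy'
      show q • x = 0
      apply ha
      rw [map_smul, this, map_zero]
    · rintro z ⟨hz, hz'⟩
      have hz' : q • z = 0 := hz'
      obtain ⟨y, hy, rfl⟩ := h4 z hz
      obtain ⟨x, hx, hxy⟩ := h3 (q • y) (U'.smul_mem q hy) (by rw [map_smul, hz'])
      obtain ⟨x', hx', rfl⟩ := hX1 x hx
      refine ⟨y - a x', ⟨U'.sub_mem hy (h1 _ hx'), ?_⟩, by rw [map_sub, hab, sub_zero]⟩
      show q • (y - a x') = 0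
      rw [smul_sub, ← hxy, map_smul, sub_self]

lemma KS_solve (qs : List A) (U : Submodule A X) (h : KS U qs) (f : A → X)
    (hf : ∀ q ∈ qs, f q ∈ U) (hc : ∀ q ∈ qs, ∀ q' ∈ qs, q • f q' = q' • f q) :
    ∃ u ∈ U, ∀ q ∈ qs, q • u = f q := by
  induction qs generalizing U f with
  | nil => exact ⟨0, U.zero_mem, by simp⟩
  | cons q qs ih =>
    obtain ⟨h1, h2⟩ := h
    obtain ⟨u0, hu0, e0⟩ := h1 (f q) (hf q (by simp))
    obtain ⟨u1, hu1, e1⟩ := ih _ h2 (fun q' => f q' - q' • u0) (fun q' hq' => by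
      refine ⟨U.sub_mem (hf q' (by simp [hq'])) (U.smul_mem _ hu0), ?_⟩
      show q • (f q' - q' • u0) = 0
      rw [smul_sub, smul_comm, e0, hc q (by simp) q' (by simp [hq']), sub_self])
      (fun q' hq' q'' hq'' => by
        rw [smul_sub, smul_sub, smul_comm q' q'', hc q' (by simp [hq']) q'' (by simp [hq''])])
    refine ⟨u0 + u1, U.add_mem hu0 hu1.1, fun q' hq' => ?_⟩
    rcases List.mem_cons.1 hq' with rfl | hq'
    · have : q' • u1 = 0 := hu1.2
      rw [smul_add, e0, this, add_zero]
    · rw [smul_add, e1 q' hq']; abel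

lemma KS_subsingleton [Subsingleton X] (qs : List A) (U : Submodule A X) : KS U qs := by
  induction qs generalizing U with
  | nil => trivial
  | cons q qs ih => exact ⟨fun v hv => ⟨v, hv, Subsingleton.elim _ _⟩, ih _⟩

end ladder

/-- monic in the variable `i` with coefficients in `S` -/
def MonicIn (S : Set (Fin n)) (i : Fin n) (p : MvPolynomial (Fin n) ℂ) : Prop :=
  ∃ (m : ℕ) (c : Fin m → MvPolynomial (Fin n) ℂ), (∀ r, c r ∈ MvPolynomial.supported ℂ S) ∧
    p = MvPolynomial.X i ^ m + ∑ r : Fin m, c r * MvPolynomial.X i ^ (r : ℕ)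

lemma MonicIn.supp {S : Set (Fin n)} {i j : Fin n} (hij : i ≠ j) (hj : j ∉ S)
    {p : MvPolynomial (Fin n) ℂ} (h : MonicIn S i p) : p ∈ MvPolynomial.supported ℂ ({j}ᶜ : Set (Fin n)) := by
  obtain ⟨m, c, hc, rfl⟩ := h
  have hXi : (MvPolynomial.X i : MvPolynomial (Fin n) ℂ) ∈
      MvPolynomial.supported ℂ ({j}ᶜ : Set (Fin n)) := Algebra.subset_adjoin ⟨i, by simpa, rfl⟩
  exact add_mem (pow_mem hXi _) (sum_mem fun r _ => mul_mem
    (MvPolynomial.supported_mono (by simpa using hj) (hc r)) (pow_mem hXi _))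

lemma KS_top {S : Finset (Fin n)} (q : Fin n → MvPolynomial (Fin n) ℂ) (L : List (Fin n))
    (hL : L.Nodup) (hLS : ∀ i ∈ L, i ∉ S) (hq : ∀ i ∈ L, MonicIn (S : Set (Fin n)) i (q i))
    (U : Submodule (MvPolynomial (Fin n) ℂ) (SS S)) (Q : Set (MvPolynomial (Fin n) ℂ))
    (hU : ∀ v, v ∈ U ↔ ∀ p ∈ Q, p • v = 0)
    (hQ : ∀ p ∈ Q, ∀ i ∈ L, p ∈ MvPolynomial.supported ℂ ({i}ᶜ : Set (Fin n))) :
    KS U (L.map q) := by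
  induction L generalizing U Q with
  | nil => trivial
  | cons i L ih =>
    rw [List.nodup_cons] at hL
    have hi := hLS i (by simp)
    refine ⟨fun v hv => ?_, ih hL.2 (fun j hj => hLS j (by simp [hj]))
      (fun j hj => hq j (by simp [hj])) _ (insert (q i) Q) ?_ ?_⟩
    · obtain ⟨m, c, hc, hp⟩ := hq i (by simp)
      obtain ⟨μ, h1, h2⟩ := division hi c hc (q i) hp v
      refine ⟨LeA S i hi μ, (hU _).2 fun p hp => ?_, by rw [← map_smul, h1]⟩
      rw [← map_smul, h2 p (hQ p hp i (by simp)) ((hU v).1 hv p hp), map_zero]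
    · intro v
      rw [Submodule.mem_inf, hU]
      simp only [Set.mem_insert_iff, forall_eq_or_imp, LinearMap.mem_ker, LinearMap.lsmul_apply]
      tauto
    · rintro p (rfl | hp) j hj
      · have hij : i ≠ j := fun h => hL.1 (h ▸ hj)
        exact (hq i (by simp)).supp hij (by exact_mod_cast hLS j (by simp [hj]))
      · exact hQ p hp j (by simp [hj])

lemma LeA_surj (S : Finset (Fin n)) (i : Fin n) (hi : i ∉ S) : Function.Surjective (LeA S i hi) := by
  intro g
  obtain ⟨μ, h, _⟩ := division hi (m := 0) (fun _ => 0) (fun r => r.elim0) 1 (by simp) g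
  exact ⟨_, h⟩

lemma KS_empty (S : Finset (Fin n)) (qs : List (MvPolynomial (Fin n) ℂ))
    (h : KS (⊤ : Submodule (MvPolynomial (Fin n) ℂ) (SS S)) qs) :
    KS (⊤ : Submodule (MvPolynomial (Fin n) ℂ) (SS (∅ : Finset (Fin n)))) qs := by
  induction S using Finset.induction_on with
  | empty => exact h
  | insert i S hi ih =>
    apply ih
    have he := dbe_exact hi
    refine KS_ladder (dbeA (insert i S) i) (LeA S i hi) he.1 ?_ qs ⊤ ⊤ ⊤ (fun _ _ => trivial)
      (fun _ _ => trivial) ?_ ?_ h h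
    · intro x; exact (he.2 _).2 ⟨x, rfl⟩
    · intro y _ hy
      obtain ⟨x, hx⟩ := (he.2 y).1 hy
      exact ⟨x, trivial, hx⟩
    · intro z _
      obtain ⟨y, hy⟩ := LeA_surj S i hi z
      exact ⟨y, trivial, hy⟩

end MP
end MPsec15

noncomputable section MPsec16

namespace MP
open scoped ContDiff
open Complex MeasureTheory
variable {n : ℕ} {ι : Type}

/-- real parts of the coordinates -/
def reV : V n →L[ℝ] (Fin n → ℝ) := ContinuousLinearMap.pi fun j => Complex.reCLM.comp (coordL j)

/-- inclusion of the real points -/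
def ofV : (Fin n → ℝ) →L[ℝ] V n :=
  ContinuousLinearMap.pi fun j => Complex.ofRealCLM.comp (ContinuousLinearMap.proj j)

lemma reV_apply (z : V n) (j : Fin n) : reV z j = (z j).re := by simp [reV, coordL]

lemma ofV_apply (x : Fin n → ℝ) (j : Fin n) : ofV x j = (x j : ℂ) := by simp [ofV]

lemma D_reV {f : (Fin n → ℝ) → ℂ} (hf : ContDiff ℝ ∞ f) (b : Fin n × Bool) :
    D b (fun z => f (reV z)) = fun z => fderiv ℝ f (reV z) (reV (bv b)) := by
  funext z
  have h1 := ((hf.differentiable (by simp)) (reV z)).hasFDerivAt.comp z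
    (reV (n := n)).hasFDerivAt
  show fderiv ℝ (f ∘ reV) z (bv b) = _
  rw [h1.fderiv]; rfl

lemma smooth_D {f : (Fin n → ℝ) → ℂ} (hf : ContDiff ℝ ∞ f) (v : Fin n → ℝ) :
    ContDiff ℝ ∞ (fun x => fderiv ℝ f x v) :=
  (hf.fderiv_right (m := ∞) (by simp)).clm_apply contDiff_const

lemma reV_mem {f : (Fin n → ℝ) → ℂ} (hf : ContDiff ℝ ∞ f) :
    (fun z => f (reV z)) ∈ SS (∅ : Finset (Fin n)) := by
  refine ⟨coind' _ {F | ∃ f : (Fin n → ℝ) → ℂ, ContDiff ℝ ∞ f ∧ F = fun _ z => f (reV z)}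
    ?_ ?_ ?_ ⟨f, hf, rfl⟩, ?_⟩
  · rintro _ ⟨f, hf, rfl⟩ _
    exact (hf.differentiable (by simp)).comp (reV (n := n)).differentiable
  · rintro _ ⟨f, hf, rfl⟩ N
    obtain ⟨C, hC⟩ := (isCompact_Icc (a := fun _ : Fin n => -(N : ℝ)) (b := fun _ => (N : ℝ))
      ).exists_bound_of_continuousOn hf.continuous.continuousOn
    refine ⟨C, fun k z hz => ?_⟩
    have : OM ∅ z = 1 := by simp [OM]
    rw [this, one_pow, mul_one]
    refine hC _ ⟨fun j => ?_, fun j => ?_⟩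
    · rw [reV_apply]; exact (abs_le.1 (hz j (by simp))).1
    · rw [reV_apply]; exact (abs_le.1 (hz j (by simp))).2
  · rintro _ ⟨f, hf, rfl⟩ b
    refine Submodule.subset_span ⟨_, smooth_D hf (reV (bv b)), ?_⟩
    funext k
    exact D_reV hf b
  · intro z w _ h2
    have : reV z = reV w := by funext j; rw [reV_apply, reV_apply, h2]
    simp [this]

section
variable [Module (MvPolynomial (Fin n) ℂ) (Cinf n)]

/-- the identification of smooth functions with `SS ∅` -/
def eE (hX : ∀ (i : Fin n) (f : Cinf n),
      (((MvPolynomial.X i : MvPolynomial (Fin n) ℂ) • f : Cinf n) : (Fin n → ℝ) → ℂ) =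
        fun x => fderiv ℝ (f : (Fin n → ℝ) → ℂ) x (Pi.single i 1))
    (hC : ∀ (c : ℂ) (f : Cinf n),
      ((MvPolynomial.C c : MvPolynomial (Fin n) ℂ) • f : Cinf n) = c • f) :
    Cinf n →ₗ[MvPolynomial (Fin n) ℂ] SS (∅ : Finset (Fin n)) where
  toFun f := ⟨fun z => f.1 (reV z), reV_mem f.2⟩
  map_add' f g := rfl
  map_smul' := map_smul_of (N := Cinf n) (N' := SS (∅ : Finset (Fin n)))
    { toFun := fun f => ⟨fun z => f.1 (reV z), reV_mem f.2⟩, map_zero' := rfl, map_add' := fun f g => rfl }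
    (fun c f => by rw [hC, C_smul]; rfl)
    (fun j f => by
      rw [X_smul]
      apply Subtype.ext
      show (fun z => ((MvPolynomial.X j : MvPolynomial (Fin n) ℂ) • f : Cinf n).1 (reV z)) =
        XO ∅ j (fun z => f.1 (reV z))
      unfold XO
      rw [if_neg (by simp), D_reV f.2, hX]
      have : reV (bv (j, false)) = (Pi.single j 1 : Fin n → ℝ) := by
        funext k
        rw [reV_apply]
        by_cases h : k = j
        · subst h; simp [bv]
        · simp [bv, h]
      rw [this])

lemma eE_bij (hX : ∀ (i : Fin n) (f : Cinf n),
      (((MvPolynomial.X i : MvPolynomial (Fin n) ℂ) • f : Cinf n) : (Fin n → ℝ) → ℂ) =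
        fun x => fderiv ℝ (f : (Fin n → ℝ) → ℂ) x (Pi.single i 1))
    (hC : ∀ (c : ℂ) (f : Cinf n),
      ((MvPolynomial.C c : MvPolynomial (Fin n) ℂ) • f : Cinf n) = c • f) :
    Function.Bijective (eE hX hC) := by
  have hro : ∀ x : Fin n → ℝ, reV (ofV x) = x := fun x => by
    funext j; rw [reV_apply, ofV_apply]; simp
  constructor
  · intro f g h
    apply Subtype.ext
    funext x
    have := congrFun (congrArg Subtype.val h) (ofV x)
    have h' : f.1 (reV (ofV x)) = g.1 (reV (ofV x)) := this
    rwa [hro] at h'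
  · intro g
    refine ⟨⟨fun x => g.1 (ofV x), (SS.contDiff g.2).comp ofV.contDiff⟩, ?_⟩
    apply Subtype.ext
    funext z
    show g.1 (ofV (reV z)) = g.1 z
    refine g.2.2 _ _ (by simp) fun j => ?_
    rw [ofV_apply, reV_apply]; simp

theorem KS_Cinf (hX : ∀ (i : Fin n) (f : Cinf n),
      (((MvPolynomial.X i : MvPolynomial (Fin n) ℂ) • f : Cinf n) : (Fin n → ℝ) → ℂ) =
        fun x => fderiv ℝ (f : (Fin n → ℝ) → ℂ) x (Pi.single i 1))
    (hC : ∀ (c : ℂ) (f : Cinf n),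
      ((MvPolynomial.C c : MvPolynomial (Fin n) ℂ) • f : Cinf n) = c • f)
    {S : Finset (Fin n)} (q : Fin n → MvPolynomial (Fin n) ℂ) (L : List (Fin n))
    (hL : L.Nodup) (hLS : ∀ i ∈ L, i ∉ S) (hq : ∀ i ∈ L, MonicIn (S : Set (Fin n)) i (q i)) :
    KS (⊤ : Submodule (MvPolynomial (Fin n) ℂ) (Cinf n)) (L.map q) := by
  have h1 := KS_empty S _ (KS_top q L hL hLS hq ⊤ ∅ (by simp) (by simp))
  set e := LinearEquiv.ofBijective (eE hX hC) (eE_bij hX hC)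
  refine KS_ladder (X := PUnit) (0 : PUnit →ₗ[MvPolynomial (Fin n) ℂ] SS (∅ : Finset (Fin n)))
    e.symm.toLinearMap (Function.injective_of_subsingleton _) (by simp) _ ⊤ ⊤ ⊤
    (by simp) (by simp) ?_ ?_ (KS_subsingleton _ _) h1
  · intro y _ hy
    refine ⟨PUnit.unit, trivial, ?_⟩
    have : y = 0 := by simpa using hy
    simp [this]
  · intro z _
    exact ⟨e z, trivial, by simp⟩

end

end MP
end MPsec16

noncomputable section MPsec17
namespace MP

lemma loc_abs {R A S : Type} [CommRing R] [IsDomain R] [Algebra ℂ R] [CommRing A] [Algebra ℂ A]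
    [Algebra R A] [IsScalarTower ℂ R A] [CommRing S] [IsLocalRing S] [Algebra A S] [Algebra R S]
    [Algebra ℂ S] [IsScalarTower ℂ A S] [IsScalarTower R A S] [IsScalarTower ℂ R S]
    [e3 : Algebra.EssFiniteType ℂ S]
    (hRu : ∀ y : R, y ≠ 0 → IsUnit (algebraMap R S y))
    (hfrac : ∀ x : S, ∃ a s : A, IsUnit (algebraMap A S s) ∧
      algebraMap A S s * x = algebraMap A S a)
    (G : Set A) (hG : Algebra.adjoin ℂ G = ⊤)
    (hq : ∀ x ∈ G, ∃ f : Polynomial R, algebraMap A S (Polynomial.aeval x f) = 0 ∧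
      IsUnit (algebraMap A S (Polynomial.aeval x (Polynomial.derivative f)))) :
    IsLocalRing.maximalIdeal S = ⊥ := by
  let K := FractionRing R
  have hKu : ∀ y : nonZeroDivisors R, IsUnit (algebraMap R S y) := fun y =>
    hRu _ (nonZeroDivisors.ne_zero y.2)
  letI algK : Algebra K S := (IsLocalization.lift (M := nonZeroDivisors R) hKu).toAlgebra
  haveI t1 : IsScalarTower R K S := IsScalarTower.of_algebraMap_eq fun r =>
    (IsLocalization.lift_eq (M := nonZeroDivisors R) (S := K) hKu r).symm
  haveI t2 : IsScalarTower ℂ K S := IsScalarTower.of_algebraMap_eq fun c => by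
    rw [IsScalarTower.algebraMap_apply ℂ R K, ← IsScalarTower.algebraMap_apply R K S,
      ← IsScalarTower.algebraMap_apply ℂ R S]
  haveI e4 : Algebra.EssFiniteType K S := Algebra.EssFiniteType.of_comp ℂ K S
  have hD : ∀ x : S, KaehlerDifferential.D K S x = 0 := by
    have hA : ∀ a : A, KaehlerDifferential.D K S (algebraMap A S a) = 0 := by
      intro a
      have ha : a ∈ Algebra.adjoin ℂ G := by rw [hG]; trivial
      refine Algebra.adjoin_induction
        (p := fun a _ => KaehlerDifferential.D K S (algebraMap A S a) = 0) ?_ ?_ ?_ ?_ ha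
      · intro x hx
        obtain ⟨f, h1, hf2⟩ := hq x hx
        rw [← Polynomial.aeval_algebraMap_apply] at h1
        have h2 := Derivation.map_aeval ((KaehlerDifferential.D K S).restrictScalars R) f (algebraMap A S x)
        rw [h1, map_zero, Polynomial.aeval_algebraMap_apply] at h2
        exact (hf2.smul_eq_zero).1 h2.symm
      · intro c
        rw [← IsScalarTower.algebraMap_apply ℂ A S, IsScalarTower.algebraMap_apply ℂ K S]
        exact Derivation.map_algebraMap _ _
      · intro x y _ _ hx hy
        rw [map_add, map_add, hx, hy, add_zero]
      · intro x y _ _ hx hy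
        rw [map_mul, Derivation.leibniz, hx, hy, smul_zero, smul_zero, add_zero]
    intro x
    obtain ⟨a, s, hs, h1⟩ := hfrac x
    have h2 := congrArg (KaehlerDifferential.D K S) h1
    rw [Derivation.leibniz, hA, hA, smul_zero, add_zero] at h2
    exact (hs.smul_eq_zero).1 h2
  haveI : Algebra.FormallyUnramified K S := by
    constructor
    refine (subsingleton_iff_forall_eq 0).mpr fun y => ?_
    have : y ∈ Submodule.span S (Set.range (KaehlerDifferential.D K S)) := by
      rw [KaehlerDifferential.span_range_derivation]; trivial
    refine Submodule.span_induction ?_ rfl ?_ ?_ this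
    · rintro _ ⟨x, rfl⟩; exact hD x
    · rintro x y _ _ rfl rfl; simp
    · rintro a x _ rfl; simp
  have hmax := Algebra.FormallyUnramified.map_maximalIdeal (R := K) (S := S)
  rw [IsLocalRing.maximalIdeal_eq_bot, Ideal.map_bot] at hmax
  exact hmax.symm

lemma loc_core {A : Type} [CommRing A] [IsDomain A] [Algebra ℂ A] [Algebra.FiniteType ℂ A]
    (R : Subalgebra ℂ A) (P J : Ideal A) [hP : P.IsPrime] (hJP : J ≤ P)
    (hR : ∀ r ∈ R, r ∈ P → r = 0) (G : Set A) (hG : Algebra.adjoin ℂ G = ⊤)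
    (hq : ∀ x ∈ G, ∃ f : Polynomial R, Polynomial.aeval x f ∈ J ∧
      Polynomial.aeval x (Polynomial.derivative f) ∉ P) :
    ∀ p ∈ P, ∃ s, s ∉ P ∧ s * p ∈ J := by
  let AP := Localization.AtPrime P
  let J' : Ideal AP := J.map (algebraMap A AP)
  let S := AP ⧸ J'
  have hJ' : J' ≤ IsLocalRing.maximalIdeal AP := by
    rw [← Localization.AtPrime.map_eq_maximalIdeal]
    exact Ideal.map_mono hJP
  have hJne : J' ≠ ⊤ := fun h => (IsLocalRing.maximalIdeal.isMaximal AP).ne_top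
    (top_le_iff.1 (h ▸ hJ'))
  haveI : Nontrivial S := Ideal.Quotient.nontrivial_iff.2 hJne
  haveI : IsLocalRing S := .of_surjective' _ Ideal.Quotient.mk_surjective
  have hunit : ∀ a : A, a ∉ P → IsUnit (algebraMap A S a) := by
    intro a ha
    have h1 : IsUnit (algebraMap A AP a) := IsLocalization.map_units AP (⟨a, ha⟩ : P.primeCompl)
    rw [IsScalarTower.algebraMap_apply A AP S]
    exact h1.map _
  haveI e1 : Algebra.EssFiniteType A AP := Algebra.EssFiniteType.of_isLocalization AP P.primeCompl
  haveI e2 : Algebra.EssFiniteType ℂ AP := Algebra.EssFiniteType.comp ℂ A AP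
  haveI e3 : Algebra.EssFiniteType ℂ S := Algebra.EssFiniteType.comp ℂ AP S
  have hmax : IsLocalRing.maximalIdeal S = ⊥ := by
    refine loc_abs (R := R) (A := A) (S := S) ?_ ?_ G hG ?_
    · intro y hy
      rw [IsScalarTower.algebraMap_apply R A S]
      exact hunit _ fun h => hy (Subtype.ext (hR _ y.2 h))
    · intro x
      obtain ⟨x, rfl⟩ := Ideal.Quotient.mk_surjective x
      obtain ⟨a, s, rfl⟩ := IsLocalization.exists_mk'_eq P.primeCompl x
      refine ⟨a, s, hunit _ s.2, ?_⟩
      rw [IsScalarTower.algebraMap_apply A AP S, IsScalarTower.algebraMap_apply A AP S]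
      show Ideal.Quotient.mk J' _ * _ = Ideal.Quotient.mk J' _
      rw [← map_mul, mul_comm, IsLocalization.mk'_spec]
    · intro x hx
      obtain ⟨f, hf1, hf2⟩ := hq x hx
      refine ⟨f, ?_, hunit _ hf2⟩
      rw [IsScalarTower.algebraMap_apply A AP S]
      exact Ideal.Quotient.eq_zero_iff_mem.2 (Ideal.mem_map_of_mem _ hf1)
  intro p hp
  have h1 : algebraMap A AP p ∈ IsLocalRing.maximalIdeal AP := by
    rw [← Localization.AtPrime.map_eq_maximalIdeal]; exact Ideal.mem_map_of_mem _ hp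
  have h2 : Ideal.Quotient.mk J' (algebraMap A AP p) ∈ IsLocalRing.maximalIdeal S := by
    rw [IsLocalRing.mem_maximalIdeal] at h1 ⊢
    intro h
    obtain ⟨b, hb⟩ := h.exists_right_inv
    obtain ⟨b, rfl⟩ := Ideal.Quotient.mk_surjective b
    rw [← map_mul, ← map_one (Ideal.Quotient.mk J'), Ideal.Quotient.eq] at hb
    have h3 := (IsLocalRing.maximalIdeal AP).sub_mem
      (Ideal.mul_mem_right b _ ((IsLocalRing.mem_maximalIdeal _).2 h1)) (hJ' hb)
    rw [sub_sub_cancel] at h3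
    exact (IsLocalRing.mem_maximalIdeal _).1 h3 isUnit_one
  rw [hmax, Ideal.mem_bot, Ideal.Quotient.eq_zero_iff_mem] at h2
  obtain ⟨⟨x, s⟩, hx⟩ := (IsLocalization.mem_map_algebraMap_iff P.primeCompl AP).1 h2
  rw [← map_mul] at hx
  obtain ⟨c, hc⟩ := (IsLocalization.eq_iff_exists P.primeCompl AP).1 hx
  refine ⟨c * s, P.primeCompl.mul_mem c.2 s.2, ?_⟩
  have : (c * s : A) * p = c * (p * s) := by ring
  rw [this, hc]
  exact J.mul_mem_left _ x.2

end MP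
end MPsec17

noncomputable section MPsec18
namespace MP
open MvPolynomial

/-- Polynomials in the first `d` variables. -/
abbrev Ud (n d : ℕ) : Subalgebra ℂ (MvPolynomial (Fin n) ℂ) :=
  MvPolynomial.supported ℂ {i : Fin n | i.1 < d}

/-- All coordinates are integral over `Ud n d` modulo `P`. -/
def IntP {n : ℕ} (d : ℕ) (P : Ideal (MvPolynomial (Fin n) ℂ)) : Prop :=
  ∀ j, IsIntegral (Ud n d) (Ideal.Quotient.mk P (X j))

/-- Generic solvability at a prime. -/
def ClaimP {n : ℕ} (E : Type*) [AddCommGroup E] [Module (MvPolynomial (Fin n) ℂ) E]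
    (P : Ideal (MvPolynomial (Fin n) ℂ)) : Prop :=
  ∀ φ : P →ₗ[MvPolynomial (Fin n) ℂ] E, ∃ s, s ∉ P ∧ ∃ u : E, ∀ p : P, (p : MvPolynomial (Fin n) ℂ) • u = s • φ p

lemma unif_s {A : Type} [CommRing A] [IsNoetherianRing A] (P J : Ideal A) [hP : P.IsPrime]
    (h : ∀ p ∈ P, ∃ s, s ∉ P ∧ s * p ∈ J) : ∃ s, s ∉ P ∧ ∀ p ∈ P, s * p ∈ J := by
  obtain ⟨T, hT⟩ : P.FG := IsNoetherian.noetherian P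
  have hTP : ∀ p ∈ T, p ∈ P := fun p hp => hT ▸ Ideal.subset_span hp
  classical
  choose! s hs1 hs2 using h
  refine ⟨∏ p ∈ T, s p, ?_, ?_⟩
  · intro hmem
    obtain ⟨p, hp, h⟩ := (Ideal.IsPrime.prod_mem_iff).1 hmem
    exact hs1 p (hTP p hp) h
  · intro p hp
    rw [← hT] at hp
    refine Submodule.span_induction ?_ ?_ ?_ ?_ hp
    · intro x hx
      rw [← Finset.mul_prod_erase T s hx, mul_right_comm]
      exact J.mul_mem_right _ (hs2 x (hTP x hx))
    · simp
    · intro x y _ _ hx hy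
      rw [mul_add]; exact J.add_mem hx hy
    · intro a x _ hx
      rw [smul_eq_mul, mul_left_comm]; exact J.mul_mem_left _ hx

lemma monicIn_aeval {n : ℕ} {S : Set (Fin n)} (i : Fin n) (f : Polynomial (MvPolynomial.supported ℂ S))
    (hf : f.Monic) : MonicIn S i (Polynomial.aeval (X i : MvPolynomial (Fin n) ℂ) f) := by
  refine ⟨f.natDegree, fun r => (f.coeff r : MvPolynomial (Fin n) ℂ), fun r => (f.coeff r).2, ?_⟩
  conv_lhs => rw [hf.as_sum]
  rw [map_add, map_sum, map_pow, Polynomial.aeval_X, ← Fin.sum_univ_eq_sum_range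
    (fun r => Polynomial.aeval (X i : MvPolynomial (Fin n) ℂ) (Polynomial.C (f.coeff r) * Polynomial.X ^ r))]
  congr 1
  refine Finset.sum_congr rfl fun r _ => ?_
  rw [map_mul, Polynomial.aeval_C, map_pow, Polynomial.aeval_X]
  rfl

lemma minpoly_deriv {A B : Type} [CommRing A] [IsDomain A] [Algebra ℂ A] [CommRing B] [Nontrivial B] [Algebra A B]
    (x : B) (hx : IsIntegral A x) : Polynomial.aeval x (Polynomial.derivative (minpoly A x)) ≠ 0 := by
  intro h
  have hm := minpoly.monic hx
  set m := (minpoly A x).natDegree with hmdef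
  have hpos : 0 < m := minpoly.natDegree_pos hx
  set f := minpoly A x with hf
  let g : Polynomial A := Polynomial.C (algebraMap ℂ A (1 / (m : ℂ))) * Polynomial.derivative f
  have hg1 : g.natDegree ≤ m - 1 :=
    (Polynomial.natDegree_C_mul_le _ _).trans (Polynomial.natDegree_derivative_le f)
  have hg2 : g.coeff (m - 1) = 1 := by
    have h1 : f.coeff m = 1 := hm
    have hm0 : (m : ℂ) ≠ 0 := by exact_mod_cast hpos.ne'
    have h2 : ((m - 1 : ℕ) : A) + 1 = algebraMap ℂ A (m : ℂ) := by
      rw [map_natCast, ← Nat.cast_add_one, Nat.sub_add_cancel hpos]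
    rw [Polynomial.coeff_C_mul, Polynomial.coeff_derivative, h2, Nat.sub_add_cancel hpos, h1, one_mul,
      ← map_mul, one_div, inv_mul_cancel₀ hm0, map_one]
  have hg3 : g.Monic := Polynomial.monic_of_natDegree_le_of_coeff_eq_one _ hg1 hg2
  have h4 := minpoly.min A x hg3 (by rw [map_mul, h, mul_zero])
  have h5 := Polynomial.natDegree_le_natDegree h4
  omega

theorem main_case {n : ℕ} {E : Type*} [AddCommGroup E] [Module (MvPolynomial (Fin n) ℂ) E]
    (hE : ∀ (S : Finset (Fin n)) (q : Fin n → MvPolynomial (Fin n) ℂ) (L : List (Fin n)),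
      L.Nodup → (∀ i ∈ L, i ∉ S) → (∀ i ∈ L, MonicIn (S : Set (Fin n)) i (q i)) →
      KS (⊤ : Submodule (MvPolynomial (Fin n) ℂ) E) (L.map q))
    (d : ℕ) (P : Ideal (MvPolynomial (Fin n) ℂ)) [hP : P.IsPrime] (hI : IntP d P)
    (h0 : ∀ g ∈ P, g ∈ Ud n d → g = 0) : ClaimP E P := by
  intro φ
  let f : Fin n → Polynomial (Ud n d) := fun i => minpoly (Ud n d) (Ideal.Quotient.mk P (X i))
  let q : Fin n → MvPolynomial (Fin n) ℂ := fun i => Polynomial.aeval (X i) (f i)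
  have hmk : ∀ i (g : Polynomial (Ud n d)), Polynomial.aeval (Ideal.Quotient.mk P (X i)) g =
      Ideal.Quotient.mk P (Polynomial.aeval (X i) g) := fun i g =>
    Polynomial.aeval_algebraMap_apply (MvPolynomial (Fin n) ℂ ⧸ P) (X i : MvPolynomial (Fin n) ℂ) g
  have hqP : ∀ i, q i ∈ P := fun i => by
    rw [← Ideal.Quotient.eq_zero_iff_mem, ← hmk]; exact minpoly.aeval _ _
  have hfP : ∀ i, Polynomial.aeval (X i) (Polynomial.derivative (f i)) ∉ P := fun i => by
    rw [← Ideal.Quotient.eq_zero_iff_mem, ← hmk]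
    exact minpoly_deriv _ (hI i)
  let L : List (Fin n) := (Finset.univ.filter fun i : Fin n => ¬ i.1 < d).toList
  have hL : ∀ i, i ∈ L ↔ ¬ i.1 < d := fun i => by simp [L]
  let J : Ideal (MvPolynomial (Fin n) ℂ) := Ideal.span {x | ∃ i ∈ L, q i = x}
  have hJP : J ≤ P := Ideal.span_le.2 (by rintro _ ⟨i, _, rfl⟩; exact hqP i)
  obtain ⟨s, hs, hsJ⟩ := unif_s P J (loc_core (Ud n d) P J hJP (fun r h1 h2 => h0 r h2 h1)
    (Set.range X) (MvPolynomial.adjoin_range_X) (by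
      rintro _ ⟨i, rfl⟩
      by_cases hi : i.1 < d
      · refine ⟨Polynomial.X - Polynomial.C ⟨X i, MvPolynomial.X_mem_supported.2 hi⟩, ?_, ?_⟩
        · simp [Polynomial.aeval_def]
        · simp only [Polynomial.derivative_sub, Polynomial.derivative_X, Polynomial.derivative_C, sub_zero, map_one]
          exact (Ideal.ne_top_iff_one P).1 hP.ne_top
      · exact ⟨f i, Ideal.subset_span ⟨i, (hL i).2 hi, rfl⟩, hfP i⟩))
  have hKS := hE (Finset.univ.filter fun i : Fin n => i.1 < d) q L (Finset.nodup_toList _)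
    (fun i hi => by simpa using (hL i).1 hi)
    (fun i hi => by
      have := monicIn_aeval i (f i) (minpoly.monic (hI i))
      convert this using 1
      ext; simp)
  classical
  let F : MvPolynomial (Fin n) ℂ → E := fun x => if h : x ∈ P then φ ⟨x, h⟩ else 0
  have hF : ∀ x (h : x ∈ P), F x = φ ⟨x, h⟩ := fun x h => dif_pos h
  have hLP : ∀ x ∈ L.map q, x ∈ P := fun x hx => by
    obtain ⟨i, _, rfl⟩ := List.mem_map.1 hx; exact hqP i
  obtain ⟨u, -, hu⟩ := KS_solve (L.map q) ⊤ hKS F (fun _ _ => trivial) (by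
    intro x hx y hy
    rw [hF x (hLP x hx), hF y (hLP y hy), ← map_smul, ← map_smul]
    congr 1
    apply Subtype.ext
    exact mul_comm _ _)
  have hJ : ∀ x (hx : x ∈ J), x • u = φ ⟨x, hJP hx⟩ := by
    intro x hx
    refine Submodule.span_induction (p := fun x hx => x • u = φ ⟨x, hJP hx⟩) ?_ ?_ ?_ ?_ hx
    · rintro _ ⟨i, hi, rfl⟩
      rw [hu (q i) (List.mem_map_of_mem hi), hF _ (hqP i)]
    · rw [zero_smul]; exact (map_zero φ).symm
    · intro x y hx hy h1 h2
      rw [add_smul, h1, h2, ← map_add]; rfl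
    · intro a x hx h1
      rw [smul_assoc, h1, ← map_smul]; rfl
  refine ⟨s, hs, s • u, fun p => ?_⟩
  rw [smul_smul, mul_comm, hJ _ (hsJ p p.2), ← map_smul]
  rfl

end MP
end MPsec18

noncomputable section MPsec19
namespace MP

section ext
variable {A : Type} [CommRing A] {E : Type*} [AddCommGroup E] [Module A E]

/-- Every map from `I` is multiplication by an element. -/
def ExtI (E : Type*) [AddCommGroup E] [Module A E] (I : Ideal A) : Prop :=
  ∀ φ : I →ₗ[A] E, ∃ u : E, ∀ x : I, φ x = (x : A) • u

lemma ext_step (I : Ideal A) (a : A) (φ : I →ₗ[A] E) (u : E)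
    (hu : ∀ x (h : x * a ∈ I), x • u = φ ⟨x * a, h⟩) (hE : ExtI E (I ⊔ Ideal.span {a})) :
    ∃ v : E, ∀ x : I, φ x = (x : A) • v := by
  have hex : ∀ y : (I ⊔ Ideal.span {a} : Ideal A), ∃ p : I, ∃ x : A, (y : A) = p + x * a := by
    intro y
    obtain ⟨p, hp, z, hz, h⟩ := Submodule.mem_sup.1 y.2
    obtain ⟨x, rfl⟩ := Ideal.mem_span_singleton'.1 hz
    exact ⟨⟨p, hp⟩, x, h.symm⟩
  choose p x hpx using hex
  have wd : ∀ (p p' : I) (x x' : A), (p : A) + x * a = p' + x' * a → φ p + x • u = φ p' + x' • u := by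
    intro p p' x x' h
    have h1 : (x - x') * a = ((p' - p : I) : A) := by
      rw [sub_mul, Submodule.coe_sub, sub_eq_sub_iff_add_eq_add, add_comm, h]
    have h2 : (x - x') * a ∈ I := h1 ▸ (p' - p).2
    have h3 := hu (x - x') h2
    have h4 : (⟨(x - x') * a, h2⟩ : I) = p' - p := Subtype.ext h1
    rw [h4, map_sub, sub_smul, sub_eq_sub_iff_add_eq_add] at h3
    rw [add_comm, h3]
  let χ : (I ⊔ Ideal.span {a} : Ideal A) →ₗ[A] E :=
    { toFun := fun y => φ (p y) + x y • u
      map_add' := by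
        intro y z
        have := wd (p (y + z)) (p y + p z) (x (y + z)) (x y + x z) (by
          rw [← hpx, Submodule.coe_add, Submodule.coe_add, hpx y, hpx z]; ring)
        rw [this, map_add, add_smul]; abel
      map_smul' := by
        intro c y
        have := wd (p (c • y)) (c • p y) (x (c • y)) (c * x y) (by
          rw [← hpx, Submodule.coe_smul, Submodule.coe_smul, hpx y, smul_eq_mul, smul_eq_mul]; ring)
        rw [this, map_smul, mul_smul, RingHom.id_apply, smul_add] }
  obtain ⟨v, hv⟩ := hE χ
  refine ⟨v, fun y => ?_⟩
  have h1 := hv ⟨y, Submodule.mem_sup_left y.2⟩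
  rw [← h1]
  have := wd y (p ⟨y, Submodule.mem_sup_left y.2⟩) 0 (x ⟨y, Submodule.mem_sup_left y.2⟩) (by
    rw [← hpx]; simp)
  rw [zero_smul, add_zero] at this
  exact this

lemma baer_of_claim [IsNoetherianRing A]
    (hcl : ∀ P : Ideal A, P.IsPrime → ∀ φ : P →ₗ[A] E, ∃ s, s ∉ P ∧ ∃ u : E, ∀ p : P,
      (p : A) • u = s • φ p) : Module.Baer A E := by
  have key : ∀ I : Ideal A, ExtI E I := by
    intro I
    refine IsNoetherian.induction (R := A) (M := A) (P := fun I => ExtI E I) ?_ I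
    intro (I : Ideal A) ih φ
    have hlt : ∀ a ∉ I, I < I ⊔ Ideal.span {a} := fun a ha =>
      lt_of_le_of_ne le_sup_left fun h => ha (h ▸ Submodule.mem_sup_right (Ideal.mem_span_singleton_self a))
    by_cases hI : I.IsPrime
    · obtain ⟨s, hs, u, hu⟩ := hcl I hI φ
      refine ext_step I s φ u ?_ (ih _ (hlt s hs))
      intro x h
      have hx : x ∈ I := (hI.mem_or_mem h).resolve_right hs
      rw [hu ⟨x, hx⟩, ← map_smul]
      congr 1
      exact Subtype.ext (mul_comm _ _)
    · by_cases htop : I = ⊤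
      · subst htop
        refine ⟨φ ⟨1, trivial⟩, fun x => ?_⟩
        rw [← map_smul]
        congr 1
        exact Subtype.ext (mul_one _).symm
      · rw [Ideal.isPrime_iff] at hI
        push Not at hI
        obtain ⟨b, a, hab, hb, ha⟩ := hI htop
        let I' : Ideal A := Submodule.comap (LinearMap.mulRight A a) I
        have hI' : I < I' := lt_of_le_of_ne (fun x hx => I.mul_mem_right a hx)
          fun h => hb (h ▸ (show b * a ∈ I from hab))
        let φ' : I' →ₗ[A] E :=
          { toFun := fun x => φ ⟨x * a, x.2⟩
            map_add' := fun x y => by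
              rw [← map_add]; congr 1; exact Subtype.ext (add_mul _ _ _)
            map_smul' := fun c x => by
              rw [RingHom.id_apply, ← map_smul]; congr 1; exact Subtype.ext (mul_assoc _ _ _) }
        obtain ⟨u, hu⟩ := ih I' hI' φ'
        exact ext_step I a φ u (fun x h => (hu ⟨x, h⟩).symm) (ih _ (hlt a ha))
  intro I φ
  obtain ⟨u, hu⟩ := key I φ
  exact ⟨LinearMap.toSpanSingleton A E u, fun x hx => by rw [hu]; rfl⟩
end ext
end MP
end MPsec19

noncomputable section MPsec20
namespace MP
open MvPolynomial

lemma coeff_prod_le' {R ι : Type} [CommRing R] (s : Finset ι) (f : ι → Polynomial R) (d : ι → ℕ)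
    (h : ∀ i ∈ s, (f i).natDegree ≤ d i) :
    (∏ i ∈ s, f i).natDegree ≤ ∑ i ∈ s, d i ∧
    (∏ i ∈ s, f i).coeff (∑ i ∈ s, d i) = ∏ i ∈ s, (f i).coeff (d i) := by
  classical
  induction s using Finset.induction_on with
  | empty => simp
  | insert a s ha ih =>
    obtain ⟨h1, h2⟩ := ih fun i hi => h i (Finset.mem_insert_of_mem hi)
    have h3 := h a (Finset.mem_insert_self _ _)
    rw [Finset.prod_insert ha, Finset.sum_insert ha, Finset.prod_insert ha]
    refine ⟨Polynomial.natDegree_mul_le_of_le h3 h1, ?_⟩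
    rw [Polynomial.coeff_mul_add_eq_of_natDegree_le h3 h1, h2]

lemma int_trans_closure {R B : Type} [CommRing R] [CommRing B] [Algebra R B] (x : B)
    (h : IsIntegral (integralClosure R B) x) : IsIntegral R x := isIntegral_trans _ h

variable {n : ℕ}

/-- Linear substitution into polynomials in one more variable. -/
def Phi (y : Fin n → MvPolynomial (Fin n) ℂ) (b : Fin n → ℂ) :
    MvPolynomial (Fin n) ℂ →ₐ[ℂ] Polynomial (MvPolynomial (Fin n) ℂ) :=
  aeval fun i => Polynomial.C (y i) + Polynomial.C (C (b i)) * Polynomial.X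

lemma Phi_deg (y : Fin n → MvPolynomial (Fin n) ℂ) (b : Fin n → ℂ) (g : MvPolynomial (Fin n) ℂ) :
    (Phi y b g).natDegree ≤ g.totalDegree ∧
    (Phi y b g).coeff g.totalDegree = C (eval b (homogeneousComponent g.totalDegree g)) := by
  have hexp : Phi y b g = ∑ s ∈ g.support, Polynomial.C (C (g.coeff s)) *
      ∏ i, (Polynomial.C (y i) + Polynomial.C (C (b i)) * Polynomial.X) ^ s i := by
    rw [Phi, aeval_def, eval₂_eq']
    rfl
  have hmon : ∀ s : Fin n →₀ ℕ,
      (Polynomial.C (C (g.coeff s)) *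
        ∏ i, (Polynomial.C (y i) + Polynomial.C (C (b i)) * Polynomial.X) ^ s i).natDegree ≤ s.degree ∧
      (Polynomial.C (C (g.coeff s)) *
        ∏ i, (Polynomial.C (y i) + Polynomial.C (C (b i)) * Polynomial.X) ^ s i).coeff s.degree =
        C (g.coeff s * ∏ i, b i ^ s i) := by
    intro s
    have h1 : ∀ i, (Polynomial.C (y i) + Polynomial.C (C (b i)) * Polynomial.X).natDegree ≤ 1 := by
      intro i
      refine Polynomial.natDegree_add_le_of_degree_le (by simp) ?_
      exact (Polynomial.natDegree_C_mul_le _ _).trans Polynomial.natDegree_X_le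
    obtain ⟨h2, h3⟩ := coeff_prod_le' Finset.univ
      (fun i => (Polynomial.C (y i) + Polynomial.C (C (b i)) * Polynomial.X) ^ s i) (fun i => s i * 1)
      (fun i _ => Polynomial.natDegree_pow_le_of_le _ (h1 i))
    have h4 : ∑ i, s i * 1 = s.degree := by rw [Finsupp.degree_eq_sum]; simp
    rw [h4] at h2 h3
    refine ⟨(Polynomial.natDegree_C_mul_le _ _).trans h2, ?_⟩
    rw [Polynomial.coeff_C_mul, h3, map_mul, map_prod]
    congr 1
    refine Finset.prod_congr rfl fun i _ => ?_
    rw [Polynomial.coeff_pow_of_natDegree_le (h1 i), map_pow]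
    simp
  have hle : ∀ s ∈ g.support, s.degree ≤ g.totalDegree := fun s hs => by
    have := le_totalDegree hs
    rwa [Finsupp.degree_eq_sum, ← Finsupp.sum_fintype _ (fun _ e => e) (fun _ => rfl)]
  constructor
  · rw [hexp]
    exact Polynomial.natDegree_sum_le_of_forall_le _ _ fun s hs => (hmon s).1.trans (hle s hs)
  · rw [hexp, Polynomial.finsetSum_coeff, homogeneousComponent_apply, map_sum, map_sum,
      Finset.sum_filter]
    refine Finset.sum_congr rfl fun s hs => ?_
    split_ifs with h
    · rw [← h, (hmon s).2, eval_monomial, Finsupp.prod_fintype _ _ (fun _ => pow_zero _)]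
    · exact Polynomial.coeff_eq_zero_of_natDegree_lt
        (lt_of_le_of_lt (hmon s).1 (lt_of_le_of_ne (hle s hs) h))

lemma exists_dir (κ : Fin n) (g : MvPolynomial (Fin n) ℂ) (hg : g ≠ 0) :
    ∃ b : Fin n → ℝ, b κ = 1 ∧
      eval (fun i => (b i : ℂ)) (homogeneousComponent g.totalDegree g) ≠ 0 := by
  set h := homogeneousComponent g.totalDegree g with hh
  have hne : h ≠ 0 := by
    obtain ⟨s, hs, hs2⟩ := Finset.exists_mem_eq_sup g.support (support_nonempty.2 hg)
      (fun s => s.sum fun _ e => e)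
    intro h0
    have h1 : coeff s h = coeff s g := by
      rw [hh, coeff_homogeneousComponent, if_pos]
      rw [Finsupp.degree_eq_sum, ← Finsupp.sum_fintype _ (fun _ e => e) (fun _ => rfl)]
      exact hs2.symm
    rw [h0, coeff_zero] at h1
    exact mem_support_iff.1 hs h1.symm
  have hx : ∃ x : Fin n → ℝ, eval (fun i => (x i : ℂ)) (h * X κ) ≠ 0 := by
    by_contra hcon
    push Not at hcon
    refine mul_ne_zero hne (X_ne_zero κ) ?_
    refine funext_set (fun _ => Set.range ((↑) : ℝ → ℂ))
      (fun _ => Set.infinite_range_of_injective Complex.ofReal_injective) ?_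
    intro x hx
    choose x' hx' using fun i => hx i trivial
    have : x = fun i => (x' i : ℂ) := funext fun i => (hx' i).symm
    rw [this, hcon, map_zero]
  obtain ⟨x, hx⟩ := hx
  rw [map_mul, eval_X] at hx
  have hκ : (x κ : ℂ) ≠ 0 := right_ne_zero_of_mul hx
  have hκ' : x κ ≠ 0 := by exact_mod_cast hκ
  refine ⟨fun i => x i / x κ, div_self hκ', ?_⟩
  have hsc : eval (fun i => (x i : ℂ)) h = (x κ : ℂ) ^ g.totalDegree *
      eval (fun i => ((x i / x κ : ℝ) : ℂ)) h := by
    rw [hh, homogeneousComponent_apply, map_sum, map_sum, Finset.mul_sum]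
    refine Finset.sum_congr rfl fun s hs => ?_
    rw [eval_monomial, eval_monomial, Finsupp.prod_fintype _ _ (fun _ => pow_zero _),
      Finsupp.prod_fintype _ _ (fun _ => pow_zero _), ← (Finset.mem_filter.1 hs).2,
      Finsupp.degree_eq_sum, ← Finset.prod_pow_eq_pow_sum, mul_left_comm, ← Finset.prod_mul_distrib]
    congr 1
    refine Finset.prod_congr rfl fun i _ => ?_
    rw [← mul_pow, Complex.ofReal_div, mul_div_cancel₀ _ hκ]
  intro h0
  rw [hsc, h0] at hx
  simp at hx

lemma Phi_coeff (y : Fin n → MvPolynomial (Fin n) ℂ) (b : Fin n → ℂ) (S : Set (Fin n))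
    (U : Subalgebra ℂ (MvPolynomial (Fin n) ℂ)) (hy : ∀ i ∈ S, y i ∈ U)
    (g : MvPolynomial (Fin n) ℂ) (hg : g ∈ supported ℂ S) : ∀ r, (Phi y b g).coeff r ∈ U := by
  have hC : ∀ c : ℂ, (C c : MvPolynomial (Fin n) ℂ) ∈ U := fun c => U.algebraMap_mem c
  refine Algebra.adjoin_induction (p := fun g _ => ∀ r, (Phi y b g).coeff r ∈ U) ?_ ?_ ?_ ?_ hg
  · rintro _ ⟨i, hi, rfl⟩ r
    rw [Phi, aeval_X, Polynomial.coeff_add, Polynomial.coeff_C, Polynomial.coeff_C_mul,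
      Polynomial.coeff_X]
    refine U.add_mem ?_ (U.mul_mem (hC _) ?_)
    · split_ifs
      · exact hy i hi
      · exact U.zero_mem
    · split_ifs
      · exact U.one_mem
      · exact U.zero_mem
  · intro c r
    rw [AlgHom.commutes, IsScalarTower.algebraMap_apply ℂ (MvPolynomial (Fin n) ℂ),
      Polynomial.algebraMap_eq, Polynomial.coeff_C]
    split_ifs
    · exact U.algebraMap_mem c
    · exact U.zero_mem
  · intro p q _ _ hp hq r
    rw [map_add, Polynomial.coeff_add]; exact U.add_mem (hp r) (hq r)
  · intro p q _ _ hp hq r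
    rw [map_mul, Polynomial.coeff_mul]
    exact U.sum_mem fun x _ => U.mul_mem (hp _) (hq _)

/-- Shear of the coordinates. -/
def sig (κ : Fin n) (c : Fin n → ℝ) : MvPolynomial (Fin n) ℂ →ₐ[ℂ] MvPolynomial (Fin n) ℂ :=
  aeval fun i => X i + C (c i : ℂ) * X κ

lemma sig_X (κ : Fin n) (c : Fin n → ℝ) (i : Fin n) : sig κ c (X i) = X i + C (c i : ℂ) * X κ :=
  aeval_X _ _

lemma sig_sig (κ : Fin n) (c : Fin n → ℝ) (hc : c κ = 0) (p : MvPolynomial (Fin n) ℂ) :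
    sig κ (-c) (sig κ c p) = p := by
  have : (sig κ (-c)).comp (sig κ c) = AlgHom.id ℂ _ := by
    apply MvPolynomial.algHom_ext
    intro i
    rw [AlgHom.comp_apply, sig_X, map_add, map_mul, sig_X, sig_X, ← MvPolynomial.algebraMap_eq,
      AlgHom.commutes]
    simp [hc]
  exact DFunLike.congr_fun this p

lemma shear_int (κ : Fin n) (P : Ideal (MvPolynomial (Fin n) ℂ))
    (hI : IntP (κ.1 + 1) P) (g : MvPolynomial (Fin n) ℂ) (hgP : g ∈ P) (hg : g ∈ Ud n (κ.1 + 1))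
    (hg0 : g ≠ 0) : ∃ c : Fin n → ℝ, c κ = 0 ∧ IntP κ.1 (P.comap (sig κ (-c))) := by
  obtain ⟨b, hbκ, hb⟩ := exists_dir κ g hg0
  let c : Fin n → ℝ := fun i => if i = κ then 0 else b i
  have hc : c κ = 0 := if_pos rfl
  refine ⟨c, hc, ?_⟩
  set P' := P.comap (sig κ (-c)) with hP'
  let B := MvPolynomial (Fin n) ℂ ⧸ P'
  have hmem : ∀ p ∈ P, sig κ c p ∈ P' := fun p hp => by
    rw [hP', Ideal.mem_comap, sig_sig κ c hc]; exact hp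
  let y : Fin n → MvPolynomial (Fin n) ℂ := fun i => if i = κ then 0 else X i
  -- the distinguished coordinate
  have hκ : IsIntegral (Ud n κ.1) (Ideal.Quotient.mk P' (X κ)) := by
    obtain ⟨h1, h2⟩ := Phi_deg y (fun i => (b i : ℂ)) g
    set a := eval (fun i => (b i : ℂ)) (homogeneousComponent g.totalDegree g) with ha
    have h3 := Phi_coeff y (fun i => (b i : ℂ)) {i | i.1 < κ.1 + 1} (Ud n κ.1) (by
      intro i hi
      by_cases hik : i = κ
      · simp only [y, if_pos hik]; exact Subalgebra.zero_mem _
      · simp only [y, if_neg hik]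
        refine X_mem_supported.2 ?_
        have : i.1 ≠ κ.1 := fun h => hik (Fin.ext h)
        have : i.1 < κ.1 + 1 := hi
        show i.1 < κ.1
        omega) g hg
    have h4 : (Phi y (fun i => (b i : ℂ)) g).eval (X κ) = sig κ c g := by
      have : ((Polynomial.aeval (X κ : MvPolynomial (Fin n) ℂ)).restrictScalars ℂ).comp
          (Phi y (fun i => (b i : ℂ))) = sig κ c := by
        apply MvPolynomial.algHom_ext
        intro i
        rw [AlgHom.comp_apply, sig_X, Phi, aeval_X]
        by_cases hik : i = κ
        · subst hik; simp [y, c, hbκ]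
        · simp [y, c, hik]
      rw [← this]
      simp [Polynomial.coe_aeval_eq_eval]
    let f : Polynomial (MvPolynomial (Fin n) ℂ) := Polynomial.C (C a⁻¹) * Phi y (fun i => (b i : ℂ)) g
    have hf1 : f.Monic := Polynomial.monic_of_natDegree_le_of_coeff_eq_one g.totalDegree
      ((Polynomial.natDegree_C_mul_le _ _).trans h1) (by
        rw [Polynomial.coeff_C_mul, h2, ← map_mul, inv_mul_cancel₀ hb, map_one])
    have hf2 : f ∈ Polynomial.lifts (algebraMap (Ud n κ.1) (MvPolynomial (Fin n) ℂ)) := by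
      rw [Polynomial.lifts_iff_coeff_lifts]
      intro r
      refine ⟨⟨f.coeff r, ?_⟩, rfl⟩
      rw [Polynomial.coeff_C_mul]
      exact Subalgebra.mul_mem _ (Subalgebra.algebraMap_mem (Ud n κ.1) _) (h3 r)
    obtain ⟨F, hF1, -, hF2⟩ := Polynomial.lifts_and_natDegree_eq_and_monic hf2 hf1
    refine ⟨F, hF2, ?_⟩
    have h5 : Polynomial.aeval (Ideal.Quotient.mk P' (X κ)) F =
        Ideal.Quotient.mk P' (Polynomial.aeval (X κ) F) :=
      Polynomial.aeval_algebraMap_apply B (X κ : MvPolynomial (Fin n) ℂ) F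
    rw [← Polynomial.aeval_def, h5, Polynomial.aeval_def, ← Polynomial.eval_map, hF1,
      Polynomial.eval_mul, h4, Ideal.Quotient.eq_zero_iff_mem]
    exact P'.mul_mem_left _ (hmem g hgP)
  let C0 := integralClosure (Ud n κ.1) B
  let Ψ : MvPolynomial (Fin n) ℂ →ₐ[ℂ] B := (Ideal.Quotient.mkₐ ℂ P').comp (sig κ c)
  have hΨ : ∀ j, Ψ (X j) = Ideal.Quotient.mk P' (X j) +
      Ideal.Quotient.mk P' (C (c j : ℂ)) * Ideal.Quotient.mk P' (X κ) := by
    intro j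
    show Ideal.Quotient.mk P' (sig κ c (X j)) = _
    rw [sig_X, map_add, map_mul]
  have hbase : ∀ x ∈ Ud n κ.1, Ideal.Quotient.mk P' x ∈ C0 := fun x hx =>
    C0.algebraMap_mem ⟨x, hx⟩
  have hcx : ∀ j, Ideal.Quotient.mk P' (C (c j : ℂ)) * Ideal.Quotient.mk P' (X κ) ∈ C0 := fun j =>
    C0.mul_mem (hbase _ ((Ud n κ.1).algebraMap_mem _)) hκ
  have hΨU : ∀ x ∈ Ud n (κ.1 + 1), Ψ x ∈ C0 := by
    intro x hx
    refine Algebra.adjoin_induction (p := fun x _ => Ψ x ∈ C0) ?_ ?_ ?_ ?_ hx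
    · rintro _ ⟨i, hi, rfl⟩
      rw [hΨ]
      refine C0.add_mem ?_ (hcx i)
      by_cases hik : i = κ
      · subst hik; exact hκ
      · refine hbase _ (X_mem_supported.2 ?_)
        have : i.1 ≠ κ.1 := fun h => hik (Fin.ext h)
        have : i.1 < κ.1 + 1 := hi
        show i.1 < κ.1
        omega
    · intro r
      rw [AlgHom.commutes]
      exact hbase _ ((Ud n κ.1).algebraMap_mem r)
    · intro p q _ _ hp hq
      rw [map_add]; exact C0.add_mem hp hq
    · intro p q _ _ hp hq
      rw [map_mul]; exact C0.mul_mem hp hq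
  let θ : Ud n (κ.1 + 1) →+* C0 :=
    (Ψ.toRingHom.comp (Ud n (κ.1 + 1)).val.toRingHom).codRestrict C0 fun x => hΨU x x.2
  intro j
  obtain ⟨f, hf1, hf2⟩ := hI j
  have hfP : Polynomial.aeval (X j) f ∈ P := by
    rw [← Ideal.Quotient.eq_zero_iff_mem, ← hf2]
    exact (Polynomial.aeval_algebraMap_apply (MvPolynomial (Fin n) ℂ ⧸ P)
      (X j : MvPolynomial (Fin n) ℂ) f).symm
  have h6 : Ψ (Polynomial.aeval (X j) f) = 0 := by
    show Ideal.Quotient.mk P' (sig κ c _) = 0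
    exact Ideal.Quotient.eq_zero_iff_mem.2 (hmem _ hfP)
  have h7 : IsIntegral C0 (Ψ (X j)) := by
    refine ⟨f.map θ, hf1.map θ, ?_⟩
    rw [Polynomial.eval₂_map, ← h6, Polynomial.aeval_def]
    exact (Polynomial.hom_eval₂ f (algebraMap (Ud n (κ.1 + 1)) (MvPolynomial (Fin n) ℂ))
      Ψ.toRingHom (X j)).symm
  have h8 : Ψ (X j) ∈ C0 := int_trans_closure _ h7
  have h9 := C0.sub_mem h8 (hcx j)
  rw [hΨ, add_sub_cancel_right] at h9
  exact h9

end MP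
end MPsec20

noncomputable section MPsec21
namespace MP
open MvPolynomial
open scoped ContDiff
variable {n : ℕ}

lemma claim_tr {A : Type} [CommRing A] {E : Type*} [AddCommGroup E] [Module A E]
    (σ σ' : A →+* A) (h1 : ∀ p, σ' (σ p) = p) (h2 : ∀ p, σ (σ' p) = p) (τ τ' : E →+ E)
    (h3 : ∀ f, τ' (τ f) = f) (h4 : ∀ p f, τ (p • f) = σ p • τ f)
    (h5 : ∀ p f, τ' (p • f) = σ' p • τ' f) (P : Ideal A)
    (h : ∀ φ : (P.comap σ' : Ideal A) →ₗ[A] E, ∃ s, s ∉ P.comap σ' ∧ ∃ u : E,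
      ∀ p : (P.comap σ' : Ideal A), (p : A) • u = s • φ p) (φ : P →ₗ[A] E) :
    ∃ s, s ∉ P ∧ ∃ u : E, ∀ p : P, (p : A) • u = s • φ p := by
  let φ' : (P.comap σ' : Ideal A) →ₗ[A] E :=
    { toFun := fun x => τ (φ ⟨σ' x, x.2⟩)
      map_add' := fun x y => by
        rw [← map_add, ← map_add]
        congr 2
        exact Subtype.ext (map_add σ' _ _)
      map_smul' := fun a x => by
        have h6 : (⟨σ' (a • x : (P.comap σ' : Ideal A)), (a • x).2⟩ : P) =
            σ' a • (⟨σ' x, x.2⟩ : P) :=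
          Subtype.ext (map_mul σ' _ _)
        rw [RingHom.id_apply, h6, map_smul, h4, h2] }
  obtain ⟨s, hs, u, hu⟩ := h φ'
  refine ⟨σ' s, fun h => hs h, τ' u, fun p => ?_⟩
  have hp : σ p ∈ P.comap σ' := by
    rw [Ideal.mem_comap, h1]; exact p.2
  have h7 := congrArg τ' (hu ⟨σ p, hp⟩)
  rw [h5, h5] at h7
  have h8 : τ' (φ' ⟨σ p, hp⟩) = φ p := by
    show τ' (τ (φ ⟨σ' (σ p), _⟩)) = φ p
    rw [h3]
    congr 1
    exact Subtype.ext (h1 p)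
  rw [h8] at h7
  simp only [h1] at h7
  exact h7

/-- The linear functional `x ↦ ∑ cᵢ xᵢ`. -/
def dotc (c : Fin n → ℝ) : (Fin n → ℝ) →L[ℝ] ℝ :=
  ∑ i, c i • ContinuousLinearMap.proj (R := ℝ) (φ := fun _ : Fin n => ℝ) i

lemma dotc_apply (c x : Fin n → ℝ) : dotc c x = ∑ i, c i * x i := by
  simp [dotc]

/-- The shear of `ℝⁿ` dual to `sig`. -/
def Nl (κ : Fin n) (c : Fin n → ℝ) : (Fin n → ℝ) →L[ℝ] (Fin n → ℝ) :=
  ContinuousLinearMap.id ℝ _ - (dotc c).smulRight (Pi.single κ (1 : ℝ) : Fin n → ℝ)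

lemma Nl_apply (κ : Fin n) (c x : Fin n → ℝ) :
    Nl κ c x = x - dotc c x • (Pi.single κ (1 : ℝ) : Fin n → ℝ) := rfl

lemma dotc_single (c : Fin n → ℝ) (i : Fin n) : dotc c (Pi.single i (1 : ℝ)) = c i := by
  rw [dotc_apply, Finset.sum_eq_single i]
  · simp
  · intro j _ hj; simp [hj]
  · simp

lemma dotc_neg (c x : Fin n → ℝ) : dotc (-c) x = - dotc c x := by
  simp [dotc_apply]

lemma Nl_Nl (κ : Fin n) (c : Fin n → ℝ) (hc : c κ = 0) (x : Fin n → ℝ) :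
    Nl κ c (Nl κ (-c) x) = x := by
  rw [Nl_apply κ c, Nl_apply, map_sub, map_smul, dotc_single, hc, dotc_neg]
  simp

/-- Composition with the shear. -/
def tau (κ : Fin n) (c : Fin n → ℝ) : Cinf n →ₗ[ℂ] Cinf n where
  toFun f := ⟨fun x => f.1 (Nl κ c x), (show ContDiff ℝ ∞ f.1 from f.2).comp (Nl κ c).contDiff⟩
  map_add' _ _ := rfl
  map_smul' _ _ := rfl

lemma tau_tau (κ : Fin n) (c : Fin n → ℝ) (hc : c κ = 0) (f : Cinf n) :
    tau κ (-c) (tau κ c f) = f := by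
  apply Subtype.ext
  funext x
  show f.1 (Nl κ c (Nl κ (-c) x)) = f.1 x
  rw [Nl_Nl κ c hc]

variable [Module (MvPolynomial (Fin n) ℂ) (Cinf n)]

lemma tau_smul (hX : ∀ (i : Fin n) (f : Cinf n),
      (((MvPolynomial.X i : MvPolynomial (Fin n) ℂ) • f : Cinf n) : (Fin n → ℝ) → ℂ) =
        fun x => fderiv ℝ (f : (Fin n → ℝ) → ℂ) x (Pi.single i 1))
    (hC : ∀ (c : ℂ) (f : Cinf n),
      ((MvPolynomial.C c : MvPolynomial (Fin n) ℂ) • f : Cinf n) = c • f)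
    (κ : Fin n) (c : Fin n → ℝ) (hc : c κ = 0) (p : MvPolynomial (Fin n) ℂ) (f : Cinf n) :
    tau κ c (p • f) = sig κ c p • tau κ c f := by
  have hd : ∀ (j : Fin n) (f : Cinf n), (X j : MvPolynomial (Fin n) ℂ) • tau κ c f =
      tau κ c ((X j : MvPolynomial (Fin n) ℂ) • f) -
        (c j : ℂ) • tau κ c ((X κ : MvPolynomial (Fin n) ℂ) • f) := by
    intro j f
    apply Subtype.ext
    rw [hX]
    funext x
    have hf : DifferentiableAt ℝ f.1 (Nl κ c x) :=
      ((show ContDiff ℝ ∞ f.1 from f.2).differentiable (by simp)).differentiableAt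
    have h1 : fderiv ℝ (tau κ c f : (Fin n → ℝ) → ℂ) x =
        (fderiv ℝ f.1 (Nl κ c x)).comp (Nl κ c) :=
      (hf.hasFDerivAt.comp x (Nl κ c).hasFDerivAt).fderiv
    show fderiv ℝ (tau κ c f : (Fin n → ℝ) → ℂ) x (Pi.single j 1) =
      ((X j : MvPolynomial (Fin n) ℂ) • f).1 (Nl κ c x) -
        (c j : ℂ) * ((X κ : MvPolynomial (Fin n) ℂ) • f).1 (Nl κ c x)
    rw [h1, ContinuousLinearMap.comp_apply, Nl_apply κ c (Pi.single j 1), map_sub, map_smul, dotc_single]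
    have h2 := congrFun (hX j f) (Nl κ c x)
    have h3 := congrFun (hX κ f) (Nl κ c x)
    rw [h2, h3, Complex.real_smul]
  induction p using MvPolynomial.induction_on generalizing f with
  | C a =>
    rw [hC, map_smul]
    have : sig κ c (C a) = C a := (sig κ c).commutes a
    rw [this, hC]
  | add p q hp hq => rw [add_smul, map_add, hp, hq, map_add, add_smul]
  | mul_X p j hp =>
    rw [mul_smul, hp, map_mul, mul_smul, sig_X, add_smul, mul_smul, hC, hd j, hd κ, hc]
    simp

lemma claim_transport (hX : ∀ (i : Fin n) (f : Cinf n),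
      (((MvPolynomial.X i : MvPolynomial (Fin n) ℂ) • f : Cinf n) : (Fin n → ℝ) → ℂ) =
        fun x => fderiv ℝ (f : (Fin n → ℝ) → ℂ) x (Pi.single i 1))
    (hC : ∀ (c : ℂ) (f : Cinf n),
      ((MvPolynomial.C c : MvPolynomial (Fin n) ℂ) • f : Cinf n) = c • f)
    (κ : Fin n) (c : Fin n → ℝ) (hc : c κ = 0) (P : Ideal (MvPolynomial (Fin n) ℂ))
    (h : ClaimP (Cinf n) (P.comap (sig κ (-c)))) : ClaimP (Cinf n) P := by
  have hc' : (-c) κ = 0 := by simp [hc]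
  have hss : ∀ p, sig κ c (sig κ (-c) p) = p := fun p => by
    have := sig_sig κ (-c) hc' p
    rwa [neg_neg] at this
  intro φ
  exact claim_tr (sig κ c).toRingHom (sig κ (-c)).toRingHom (sig_sig κ c hc) hss
    (tau κ c).toAddMonoidHom (tau κ (-c)).toAddMonoidHom (tau_tau κ c hc)
    (tau_smul hX hC κ c hc) (tau_smul hX hC κ (-c) hc') P h φ

lemma claim_all (hX : ∀ (i : Fin n) (f : Cinf n),
      (((MvPolynomial.X i : MvPolynomial (Fin n) ℂ) • f : Cinf n) : (Fin n → ℝ) → ℂ) =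
        fun x => fderiv ℝ (f : (Fin n → ℝ) → ℂ) x (Pi.single i 1))
    (hC : ∀ (c : ℂ) (f : Cinf n),
      ((MvPolynomial.C c : MvPolynomial (Fin n) ℂ) • f : Cinf n) = c • f) (k : ℕ) (hk : k ≤ n)
    (P : Ideal (MvPolynomial (Fin n) ℂ)) (hP : P.IsPrime) (hI : IntP k P) : ClaimP (Cinf n) P := by
  have hE := fun (S : Finset (Fin n)) q L h1 h2 h3 => KS_Cinf hX hC (S := S) q L h1 h2 h3
  induction k generalizing P with
  | zero =>
    refine main_case hE 0 P hI ?_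
    intro g hg hg0
    have : {i : Fin n | i.1 < 0} = ∅ := by ext; simp
    rw [Ud, this, supported_empty] at hg0
    obtain ⟨a, rfl⟩ := Algebra.mem_bot.1 hg0
    by_contra hne
    have ha : a ≠ 0 := fun h => hne (by rw [h, map_zero])
    exact hP.ne_top (Ideal.eq_top_of_isUnit_mem _ hg ((IsUnit.mk0 a ha).map (algebraMap ℂ (MvPolynomial (Fin n) ℂ))))
  | succ k ih =>
    by_cases h0 : ∀ g ∈ P, g ∈ Ud n (k + 1) → g = 0
    · exact main_case hE (k + 1) P hI h0
    · push Not at h0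
      obtain ⟨g, hgP, hg, hg0⟩ := h0
      obtain ⟨c, hc, hI'⟩ := shear_int (⟨k, hk⟩ : Fin n) P hI g hgP hg hg0
      exact claim_transport hX hC _ c hc P (ih (by omega) _ (Ideal.comap_isPrime _ P) hI')

theorem main_thm (hX : ∀ (i : Fin n) (f : Cinf n),
      (((MvPolynomial.X i : MvPolynomial (Fin n) ℂ) • f : Cinf n) : (Fin n → ℝ) → ℂ) =
        fun x => fderiv ℝ (f : (Fin n → ℝ) → ℂ) x (Pi.single i 1))
    (hC : ∀ (c : ℂ) (f : Cinf n),
      ((MvPolynomial.C c : MvPolynomial (Fin n) ℂ) • f : Cinf n) = c • f) :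
    Module.Baer (MvPolynomial (Fin n) ℂ) (Cinf n) := by
  refine baer_of_claim fun P hP => claim_all hX hC n le_rfl P hP fun j => ?_
  exact isIntegral_algebraMap (R := Ud n n) (A := MvPolynomial (Fin n) ℂ ⧸ P)
    (x := ⟨X j, X_mem_supported.2 j.2⟩)

end MP
end MPsec21

/-- **Malgrange–Palamodov**: `C^∞(ℝⁿ, ℂ)`, as a module over `A = ℂ[∂₁, …, ∂ₙ]` acting by
partial differentiation, is an injective `A`-module: any homomorphism to `C^∞` extends along
any injective homomorphism. -/
theorem smooth_functions_injective_module (n : ℕ) (hn : 0 < n)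
    [Module (MvPolynomial (Fin n) ℂ) (Cinf n)]
    (hX : ∀ (i : Fin n) (f : Cinf n),
      (((MvPolynomial.X i : MvPolynomial (Fin n) ℂ) • f : Cinf n) : (Fin n → ℝ) → ℂ) =
        fun x => fderiv ℝ (f : (Fin n → ℝ) → ℂ) x (Pi.single i 1))
    (hC : ∀ (c : ℂ) (f : Cinf n),
      ((MvPolynomial.C c : MvPolynomial (Fin n) ℂ) • f : Cinf n) = c • f)
    (M M' : Type*) [AddCommGroup M] [Module (MvPolynomial (Fin n) ℂ) M]
    [AddCommGroup M'] [Module (MvPolynomial (Fin n) ℂ) M']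
    (ι : M →ₗ[MvPolynomial (Fin n) ℂ] M') (hι : Function.Injective ι)
    (φ : M →ₗ[MvPolynomial (Fin n) ℂ] Cinf n) :
    ∃ ψ : M' →ₗ[MvPolynomial (Fin n) ℂ] Cinf n, ∀ x : M, ψ (ι x) = φ x := by
  obtain ⟨ψ, hψ⟩ := (MP.main_thm hX hC).extension_property ι hι φ
  exact ⟨ψ, fun x => DFunLike.congr_fun hψ x⟩
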